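/- For every positive integer m, every pair of positive integers e, f with gcd(e,f) = 1, and every ε > 0, there are infinitely many primes p with p ≡ e (mod f) such that f₃(m,p) ≥ exp( ( (5 log 2)/(12 · lcm(m,f)) − ε ) · (log p)/(log log p) ). -/

import Mathlib

/-- `numSols k m n` is the number of nondecreasing `k`-tuples of positive integers
`(a₁, …, a_k)` with `m / n = 1/a₁ + ⋯ + 1/a_k`. -/
noncomputable def numSols (k m n : ℕ) : ℕ :=
  Nat.card {a : Fin k → ℕ // (∀ i, 0 < a i) ∧ Monotone a ∧
    (m : ℚ) / n = ∑ i, (1 : ℚ) / a i}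

section

/-! ### Gaussian separation of variables -/

/-- `n ^ (i t)`. -/
noncomputable def tw (t : ℝ) (n : ℕ) : ℂ := Complex.exp (Complex.I * t * (Real.log n : ℝ))

/-- Gaussian weight in `log n` centred at `y`. -/
noncomputable def gv (y : ℝ) (n : ℕ) : ℝ := Real.exp (-(Real.log n - y) ^ 2 / 2)

/-- Gaussian averaging functional. -/
noncomputable def gI (y : ℝ) (F : ℝ → ℂ) : ℂ :=
  (∫ t : ℝ, Complex.exp (Complex.I * t * (-y : ℝ)) * Complex.exp (-(1/2 : ℂ) * (t : ℂ) ^ 2) * F t) /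
    (Real.sqrt (2 * Real.pi) : ℝ)

lemma tw_mul (t : ℝ) {a b : ℕ} (ha : a ≠ 0) (hb : b ≠ 0) : tw t (a * b) = tw t a * tw t b := by
  unfold tw
  rw [← Complex.exp_add]
  congr 1
  rw [Nat.cast_mul, Real.log_mul (by exact_mod_cast ha) (by exact_mod_cast hb)]
  push_cast; ring

lemma norm_tw (t : ℝ) (n : ℕ) : ‖tw t n‖ = 1 := by
  unfold tw
  rw [show Complex.I * (t : ℂ) * ((Real.log n : ℝ) : ℂ) = ((t * Real.log n : ℝ) : ℂ) * Complex.I by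
    push_cast; ring]
  exact Complex.norm_exp_ofReal_mul_I _

lemma tw_one (t : ℝ) : tw t 1 = 1 := by simp [tw]

lemma continuous_tw (n : ℕ) : Continuous (fun t => tw t n) := by
  unfold tw; fun_prop

lemma gv_pos (y : ℝ) (n : ℕ) : 0 < gv y n := Real.exp_pos _
lemma gv_le_one (y : ℝ) (n : ℕ) : gv y n ≤ 1 := by
  unfold gv
  rw [Real.exp_le_one_iff]
  nlinarith [sq_nonneg (Real.log n - y)]

lemma gI_tw (y : ℝ) (n : ℕ) : gI y (fun t => tw t n) = gv y n := by
  unfold gI tw gv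
  have h := fourierIntegral_gaussian (b := (1/2 : ℂ)) (by norm_num) ((Real.log n - y : ℝ) : ℂ)
  have e : ∀ t : ℝ, Complex.exp (Complex.I * t * (-y : ℝ)) * Complex.exp (-(1/2 : ℂ) * (t : ℂ) ^ 2) *
      Complex.exp (Complex.I * t * (Real.log n : ℝ)) =
      Complex.exp (Complex.I * ((Real.log n - y : ℝ) : ℂ) * t) * Complex.exp (-(1/2 : ℂ) * (t : ℂ) ^ 2) := by
    intro t
    rw [← Complex.exp_add, ← Complex.exp_add, ← Complex.exp_add]
    congr 1; push_cast; ring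
  simp_rw [e]
  rw [h]
  have h2 : ((Real.pi : ℂ) / (1/2)) ^ (1/2 : ℂ) = ((Real.sqrt (2 * Real.pi) : ℝ) : ℂ) := by
    rw [Real.sqrt_eq_rpow, Complex.ofReal_cpow (by positivity)]
    push_cast; congr 1; ring
  rw [h2]
  have h3 : ((Real.sqrt (2 * Real.pi) : ℝ) : ℂ) ≠ 0 := by
    rw [Complex.ofReal_ne_zero]; positivity
  rw [mul_div_assoc, mul_comm, div_mul_cancel₀ _ h3]
  push_cast; congr 1; ring

/-- `F` is a finite sum `∑ a_i n_i^{it}` and `F1 = ∑ (a_i/n_i) n_i^{it}` with all `n_i ≥ N` and `∑ |a_i| ≤ B`. -/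
def TP (F F1 : ℝ → ℂ) (N : ℕ) (B : ℝ) : Prop :=
  0 < N ∧ ∃ (k : ℕ) (a : Fin k → ℂ) (n : Fin k → ℕ), (∀ i, N ≤ n i) ∧ (∑ i, ‖a i‖) ≤ B ∧
    (∀ t, F t = ∑ i, a i * tw t (n i)) ∧ (∀ t, F1 t = ∑ i, a i / (n i) * tw t (n i))

lemma TP.of_fintype {ι : Type*} (s : Finset ι) {F F1 : ℝ → ℂ} {N : ℕ} {B : ℝ} (hN : 0 < N) (a : ι → ℂ) (n : ι → ℕ)
    (hn : ∀ i ∈ s, N ≤ n i) (hB : (∑ i ∈ s, ‖a i‖) ≤ B) (hF : ∀ t, F t = ∑ i ∈ s, a i * tw t (n i))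
    (hF1 : ∀ t, F1 t = ∑ i ∈ s, a i / (n i) * tw t (n i)) : TP F F1 N B := by
  classical
  refine ⟨hN, s.card, fun i => a (s.equivFin.symm i), fun i => n (s.equivFin.symm i), fun i => hn _ (s.equivFin.symm i).2, ?_, ?_, ?_⟩
  · rw [s.equivFin.symm.sum_comp (fun i : s => ‖a i‖), Finset.sum_coe_sort s (fun i => ‖a i‖)]
    exact hB
  · intro t
    rw [s.equivFin.symm.sum_comp (fun i : s => a i * tw t (n i)), Finset.sum_coe_sort s (fun i => a i * tw t (n i)), hF]
  · intro t
    rw [s.equivFin.symm.sum_comp (fun i : s => a i / (n i) * tw t (n i)), Finset.sum_coe_sort s (fun i => a i / (n i) * tw t (n i)), hF1]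

lemma TP.mul {F F1 G G1 : ℝ → ℂ} {N N' : ℕ} {B B' : ℝ} (h : TP F F1 N B) (h' : TP G G1 N' B') :
    TP (fun t => F t * G t) (fun t => F1 t * G1 t) (N * N') (B * B') := by
  obtain ⟨hN, k, a, n, h1, h2, h3, h4⟩ := h
  obtain ⟨hN', k', a', n', h1', h2', h3', h4'⟩ := h'
  refine TP.of_fintype (Finset.univ : Finset (Fin k × Fin k')) (by positivity) (fun i => a i.1 * a' i.2) (fun i => n i.1 * n' i.2)
    (fun i _ => Nat.mul_le_mul (h1 _) (h1' _)) ?_ ?_ ?_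
  · rw [← Finset.univ_product_univ, Finset.sum_product]
    simp_rw [norm_mul]
    rw [← Finset.sum_mul_sum]
    exact mul_le_mul h2 h2' (Finset.sum_nonneg fun _ _ => norm_nonneg _) ((Finset.sum_nonneg fun _ _ => norm_nonneg _).trans h2)
  · intro t
    rw [h3, h3', Finset.sum_mul_sum, ← Finset.univ_product_univ, Finset.sum_product]
    refine Finset.sum_congr rfl fun i _ => Finset.sum_congr rfl fun j _ => ?_
    rw [tw_mul t (a := n i) (b := n' j) (by have := h1 i; omega) (by have := h1' j; omega)]; ring
  · intro t
    rw [h4, h4', Finset.sum_mul_sum, ← Finset.univ_product_univ, Finset.sum_product]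
    refine Finset.sum_congr rfl fun i _ => Finset.sum_congr rfl fun j _ => ?_
    rw [tw_mul t (a := n i) (b := n' j) (by have := h1 i; omega) (by have := h1' j; omega)]
    push_cast
    rw [mul_div_mul_comm]; ring

lemma TP.mono {F F1 : ℝ → ℂ} {N N' : ℕ} {B B' : ℝ} (h : TP F F1 N B) (hN : 0 < N') (hNN : N' ≤ N) (hB : B ≤ B') :
    TP F F1 N' B' := by
  obtain ⟨_, k, a, n, h1, h2, h3, h4⟩ := h
  exact ⟨hN, k, a, n, fun i => hNN.trans (h1 i), h2.trans hB, h3, h4⟩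

lemma TP.add {F F1 G G1 : ℝ → ℂ} {N : ℕ} {B B' : ℝ} (h : TP F F1 N B) (h' : TP G G1 N B') :
    TP (fun t => F t + G t) (fun t => F1 t + G1 t) N (B + B') := by
  obtain ⟨hN, k, a, n, h1, h2, h3, h4⟩ := h
  obtain ⟨hN', k', a', n', h1', h2', h3', h4'⟩ := h'
  refine TP.of_fintype (Finset.univ : Finset (Fin k ⊕ Fin k')) hN (Sum.elim a a') (Sum.elim n n') ?_ ?_ ?_ ?_
  · rintro (i | i) _
    · exact h1 i
    · exact h1' i
  · rw [Fintype.sum_sum_type]; simp only [Sum.elim_inl, Sum.elim_inr]; linarith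
  · intro t; rw [Fintype.sum_sum_type, h3, h3']; rfl
  · intro t; rw [Fintype.sum_sum_type, h4, h4']; rfl

lemma TP.const_mul {F F1 : ℝ → ℂ} {N : ℕ} {B : ℝ} (c : ℂ) (h : TP F F1 N B) :
    TP (fun t => c * F t) (fun t => c * F1 t) N (‖c‖ * B) := by
  obtain ⟨hN, k, a, n, h1, h2, h3, h4⟩ := h
  refine ⟨hN, k, fun i => c * a i, n, h1, ?_, ?_, ?_⟩
  · simp_rw [norm_mul, ← Finset.mul_sum]; gcongr
  · intro t; simp only []; rw [h3, Finset.mul_sum]; exact Finset.sum_congr rfl fun i _ => by ring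
  · intro t; simp only []; rw [h4, Finset.mul_sum]; exact Finset.sum_congr rfl fun i _ => by ring

lemma TP.one : TP (fun _ => 1) (fun _ => 1) 1 1 :=
  ⟨one_pos, 1, fun _ => 1, fun _ => 1, by simp, by simp, by simp [tw_one], by simp [tw_one]⟩

lemma integrable_tw (y : ℝ) (n : ℕ) : MeasureTheory.Integrable (fun t : ℝ =>
    Complex.exp (Complex.I * t * (-y : ℝ)) * Complex.exp (-(1/2 : ℂ) * (t : ℂ) ^ 2) * tw t n) := by
  have := integrable_cexp_quadratic (b := (1/2:ℂ)) (by norm_num) (Complex.I * (Real.log n - y : ℝ)) 0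
  refine this.congr (Filter.Eventually.of_forall fun t => ?_)
  simp only [tw]
  rw [← Complex.exp_add, ← Complex.exp_add]
  congr 1; push_cast; ring

lemma TP.integrable {F F1 : ℝ → ℂ} {N : ℕ} {B : ℝ} (h : TP F F1 N B) (y : ℝ) : MeasureTheory.Integrable (fun t : ℝ =>
    Complex.exp (Complex.I * t * (-y : ℝ)) * Complex.exp (-(1/2 : ℂ) * (t : ℂ) ^ 2) * F t) := by
  obtain ⟨hN, k, a, n, h1, h2, h3, h4⟩ := h
  simp_rw [h3, Finset.mul_sum]
  refine MeasureTheory.integrable_finsetSum _ fun i _ => ?_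
  refine ((integrable_tw y (n i)).const_mul (a i)).congr (Filter.Eventually.of_forall fun t => ?_)
  simp only; ring

lemma TP.gI_add {F F1 G G1 : ℝ → ℂ} {N N' : ℕ} {B B' : ℝ} (h : TP F F1 N B) (h' : TP G G1 N' B') (y : ℝ) :
    gI y (fun t => F t + G t) = gI y F + gI y G := by
  unfold gI
  rw [← add_div, ← MeasureTheory.integral_add (h.integrable y) (h'.integrable y)]
  congr 2; ext t; ring

lemma gI_sum {k : ℕ} (a : Fin k → ℂ) (n : Fin k → ℕ) (y : ℝ) :
    gI y (fun t => ∑ i, a i * tw t (n i)) = ∑ i, a i * gv y (n i) := by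
  have : ∀ i, (gv y (n i) : ℂ) = gI y (fun t => tw t (n i)) := fun i => (gI_tw y (n i)).symm
  simp_rw [this]
  unfold gI
  simp_rw [mul_div_assoc', ← Finset.sum_div, ← MeasureTheory.integral_const_mul]
  rw [← MeasureTheory.integral_finsetSum]
  · congr 2; ext t; rw [Finset.mul_sum]; exact Finset.sum_congr rfl fun i _ => by ring
  · intro i _
    exact (integrable_tw y (n i)).const_mul (a i)

lemma gI_finset_sum {ι : Type*} (s : Finset ι) (a : ι → ℂ) (n : ι → ℕ) (y : ℝ) :
    gI y (fun t => ∑ i ∈ s, a i * tw t (n i)) = ∑ i ∈ s, a i * gv y (n i) := by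
  classical
  have := gI_sum (fun i => a (s.equivFin.symm i)) (fun i => n (s.equivFin.symm i)) y
  rw [s.equivFin.symm.sum_comp (fun i : s => a i * gv y (n i)), Finset.sum_coe_sort s (fun i => a i * gv y (n i))] at this
  rw [← this]
  congr 1; ext t
  rw [s.equivFin.symm.sum_comp (fun i : s => a i * tw t (n i)), Finset.sum_coe_sort s (fun i => a i * tw t (n i))]

/-- shift identity for the weight -/
lemma gv_shift (y : ℝ) {n : ℕ} (hn : n ≠ 0) : gv y n = Real.exp (y + 1/2) / n * gv (y + 1) n := by
  unfold gv
  have : (n : ℝ) = Real.exp (Real.log n) := (Real.exp_log (by positivity)).symm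
  nth_rewrite 2 [this]
  rw [← Real.exp_sub, ← Real.exp_add]
  congr 1; ring

lemma TP.gI_shift {F F1 : ℝ → ℂ} {N : ℕ} {B : ℝ} (h : TP F F1 N B) (y : ℝ) :
    gI y F = Real.exp (y + 1/2) * gI (y + 1) F1 := by
  obtain ⟨hN, k, a, n, h1, h2, h3, h4⟩ := h
  rw [funext h3, funext h4, gI_sum, gI_sum, Finset.mul_sum]
  refine Finset.sum_congr rfl fun i _ => ?_
  rw [gv_shift y (n := n i) (by have := h1 i; omega)]
  push_cast; ring

lemma TP.norm_gI_le {F F1 : ℝ → ℂ} {N : ℕ} {B v : ℝ} (h : TP F F1 N B) (y : ℝ) (hv : ∀ n, N ≤ n → gv y n ≤ v) :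
    ‖gI y F‖ ≤ B * v := by
  obtain ⟨hN, k, a, n, h1, h2, h3, h4⟩ := h
  have hv0 : 0 ≤ v := (gv_pos y N).le.trans (hv N le_rfl)
  rw [funext h3, gI_sum]
  calc _ ≤ ∑ i, ‖a i * gv y (n i)‖ := norm_sum_le _ _
    _ ≤ ∑ i, ‖a i‖ * v := by
        refine Finset.sum_le_sum fun i _ => ?_
        rw [norm_mul, Complex.norm_real, Real.norm_of_nonneg (gv_pos _ _).le]
        exact mul_le_mul_of_nonneg_left (hv _ (h1 i)) (norm_nonneg _)
    _ ≤ _ := by rw [← Finset.sum_mul]; gcongr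

/-- The main averaging lemma. -/
lemma sep_bound {ι : Type*} (s : Finset ι) (F F1 : ι → ℝ → ℂ) {N : ℕ} {B' : ℝ} (y B : ℝ)
    (hF : ∀ i ∈ s, TP (F i) (F1 i) N B')
    (hB : ∀ t : ℝ, ∑ i ∈ s, ‖F i t‖ ≤ B * Real.exp (t ^ 2 / 4)) :
    ∑ i ∈ s, ‖gI y (F i)‖ ≤ 2 * B := by
  have hB0 : 0 ≤ B := by
    have := (Finset.sum_nonneg fun i _ => norm_nonneg _).trans (hB 0)
    simpa using this
  have hnorm : ∀ (i : ι) (t : ℝ), ‖Complex.exp (Complex.I * t * (-y : ℝ)) * Complex.exp (-(1/2 : ℂ) * (t : ℂ) ^ 2) * F i t‖ =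
      Real.exp (-(1/2) * t ^ 2) * ‖F i t‖ := by
    intro i t
    rw [norm_mul, norm_mul]
    congr 1
    rw [show Complex.I * (t : ℂ) * ((-y : ℝ) : ℂ) = ((t * (-y) : ℝ) : ℂ) * Complex.I by push_cast; ring,
      Complex.norm_exp_ofReal_mul_I, one_mul,
      show -(1/2 : ℂ) * (t : ℂ) ^ 2 = ((-(1/2) * t ^ 2 : ℝ) : ℂ) by push_cast; ring, Complex.norm_exp_ofReal]
  have hs : 0 < Real.sqrt (2 * Real.pi) := by positivity
  have h1 : ∀ i ∈ s, ‖gI y (F i)‖ ≤ (∫ t : ℝ, Real.exp (-(1/2) * t ^ 2) * ‖F i t‖) / Real.sqrt (2 * Real.pi) := by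
    intro i hi
    unfold gI
    rw [norm_div, Complex.norm_real, Real.norm_of_nonneg hs.le]
    gcongr
    refine (MeasureTheory.norm_integral_le_integral_norm _).trans (le_of_eq ?_)
    simp_rw [hnorm]
  have hIntg : ∀ i ∈ s, MeasureTheory.Integrable (fun t : ℝ => Real.exp (-(1/2) * t ^ 2) * ‖F i t‖) := by
    intro i hi
    have := ((hF i hi).integrable y).norm
    simpa only [hnorm] using this
  calc ∑ i ∈ s, ‖gI y (F i)‖ ≤ ∑ i ∈ s, (∫ t : ℝ, Real.exp (-(1/2) * t ^ 2) * ‖F i t‖) / Real.sqrt (2 * Real.pi) :=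
        Finset.sum_le_sum h1
    _ = (∫ t : ℝ, ∑ i ∈ s, Real.exp (-(1/2) * t ^ 2) * ‖F i t‖) / Real.sqrt (2 * Real.pi) := by
        rw [← Finset.sum_div, MeasureTheory.integral_finsetSum _ hIntg]
    _ ≤ (∫ t : ℝ, B * Real.exp (-(1/4) * t ^ 2)) / Real.sqrt (2 * Real.pi) := by
        refine div_le_div_of_nonneg_right ?_ hs.le
        refine MeasureTheory.integral_mono (MeasureTheory.integrable_finsetSum _ hIntg)
          ((integrable_exp_neg_mul_sq (b := 1/4) (by norm_num)).const_mul B) fun t => ?_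
        simp only
        rw [← Finset.mul_sum]
        calc _ ≤ Real.exp (-(1/2) * t ^ 2) * (B * Real.exp (t ^ 2 / 4)) := by gcongr; exact hB t
          _ = B * (Real.exp (-(1/2) * t ^ 2) * Real.exp (t ^ 2 / 4)) := by ring
          _ = B * Real.exp (-(1/4) * t ^ 2) := by rw [← Real.exp_add]; congr 2; ring
    _ = B * Real.sqrt 2 := by
        rw [MeasureTheory.integral_const_mul, integral_gaussian, mul_div_assoc, ← Real.sqrt_div (by positivity)]
        congr 2
        field_simp; norm_num
    _ ≤ 2 * B := by
        have : Real.sqrt 2 ≤ 2 := by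
          rw [Real.sqrt_le_left (by norm_num)]; norm_num
        nlinarith

end

section

/-! ### Pólya–Vinogradov -/

lemma harm_le (N : ℕ) : ∑ n ∈ Finset.Icc 1 N, (1 : ℝ) / n ≤ 1 + Real.log N := by
  have h := harmonic_le_one_add_log N
  rw [harmonic_eq_sum_Icc] at h
  push_cast at h
  simpa only [one_div] using h

lemma sum_gcd_div_le (Q : ℕ) (hQ : 0 < Q) :
    ∑ a ∈ Finset.Icc 1 Q, (Nat.gcd a Q : ℝ) / a ≤ Q.divisors.card * (1 + Real.log Q) := by
  have h1 : ∀ a ∈ Finset.Icc 1 Q, (Nat.gcd a Q : ℝ) / a ≤ ∑ g ∈ Q.divisors, if g ∣ a then (g : ℝ) / a else 0 := by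
    intro a _
    have := Finset.single_le_sum (f := fun g : ℕ => if g ∣ a then (g : ℝ) / a else 0) (s := Q.divisors)
      (fun g _ => by split_ifs <;> positivity) (a := Nat.gcd a Q)
      (Nat.mem_divisors.2 ⟨Nat.gcd_dvd_right _ _, hQ.ne'⟩)
    simpa [Nat.gcd_dvd_left] using this
  refine (Finset.sum_le_sum h1).trans ?_
  rw [Finset.sum_comm, ← nsmul_eq_mul]
  refine Finset.sum_le_card_nsmul _ _ _ fun g hg => ?_
  have hg0 : 0 < g := Nat.pos_of_mem_divisors hg
  refine le_trans ?_ (harm_le Q)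
  rw [← Finset.sum_filter]
  have hsub : (Finset.Icc 1 Q).filter (fun a => g ∣ a) ⊆ (Finset.Icc 1 Q).image (fun b => g * b) := by
    intro a ha
    simp only [Finset.mem_filter, Finset.mem_Icc] at ha
    obtain ⟨⟨h1, h2⟩, b, rfl⟩ := ha
    refine Finset.mem_image.2 ⟨b, Finset.mem_Icc.2 ⟨?_, ?_⟩, rfl⟩
    · exact Nat.pos_of_mul_pos_left h1
    · nlinarith
  refine (Finset.sum_le_sum_of_subset_of_nonneg hsub fun _ _ _ => by positivity).trans ?_
  rw [Finset.sum_image (fun x _ y _ h => Nat.eq_of_mul_eq_mul_left hg0 h)]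
  refine Finset.sum_le_sum fun b hb => le_of_eq ?_
  have : (b : ℝ) ≠ 0 := by have := (Finset.mem_Icc.1 hb).1; positivity
  push_cast
  field_simp

section
variable {Q : ℕ} [NeZero Q]

open ZMod in
/-- Fourier coefficient. -/
noncomputable def fc (χ : DirichletCharacter ℂ Q) (a : ZMod Q) : ℂ := ∑ x : ZMod Q, χ x * stdAddChar (-(x * a))

lemma fc_inv (χ : DirichletCharacter ℂ Q) (n : ZMod Q) :
    χ n = (Q : ℂ)⁻¹ * ∑ a : ZMod Q, fc χ a * ZMod.stdAddChar (a * n) := by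
  have h := congrFun (ZMod.dft.symm_apply_apply (fun x : ZMod Q => χ x)) n
  rw [ZMod.invDFT_apply] at h
  rw [← h]
  simp only [smul_eq_mul, ZMod.dft_apply]
  congr 1
  refine Finset.sum_congr rfl fun a _ => ?_
  unfold fc
  rw [mul_comm]
  congr 1
  exact Finset.sum_congr rfl fun x _ => mul_comm _ _

lemma fc_parseval (χ : DirichletCharacter ℂ Q) : ∑ a : ZMod Q, ‖fc χ a‖ ^ 2 ≤ Q * Q.totient := by
  have key : ((∑ a : ZMod Q, ‖fc χ a‖ ^ 2 : ℝ) : ℂ) = Q * ∑ x : ZMod Q, (‖χ x‖ ^ 2 : ℝ) := by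
    push_cast
    have h1 : ∀ a : ZMod Q, (‖fc χ a‖ : ℂ) ^ 2 = ∑ x : ZMod Q, (starRingEnd ℂ) (χ x) * (fc χ a * ZMod.stdAddChar (a * x)) := by
      intro a
      rw [← Complex.conj_mul']
      conv_lhs => enter [1]; unfold fc
      rw [map_sum, Finset.sum_mul]
      refine Finset.sum_congr rfl fun x _ => ?_
      rw [map_mul, ← AddChar.map_neg_eq_conj, neg_neg, mul_comm x a]
      ring
    simp_rw [h1]
    rw [Finset.sum_comm, Finset.mul_sum]
    refine Finset.sum_congr rfl fun x _ => ?_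
    rw [← Finset.mul_sum, ← Complex.conj_mul']
    conv_rhs => rw [fc_inv χ x]
    have hQ : (Q : ℂ) ≠ 0 := by exact_mod_cast NeZero.ne Q
    rw [← fc_inv χ x]
    conv_lhs => rw [show (∑ a : ZMod Q, fc χ a * ZMod.stdAddChar (a * x)) = Q * χ x by
      rw [fc_inv χ x, mul_inv_cancel_left₀ hQ]]
    ring
  have key2 : ∑ a : ZMod Q, ‖fc χ a‖ ^ 2 = Q * ∑ x : ZMod Q, ‖χ x‖ ^ 2 := by exact_mod_cast key
  rw [key2]
  gcongr
  have : ∀ x : ZMod Q, ‖χ x‖ ^ 2 ≤ if IsUnit x then 1 else 0 := by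
    intro x
    split_ifs with h
    · have := χ.norm_le_one x
      exact pow_le_one₀ (norm_nonneg _) this
    · rw [χ.map_nonunit h]; simp
  refine (Finset.sum_le_sum fun x _ => this x).trans ?_
  classical
  rw [← ZMod.card_units_eq_totient, ← Finset.sum_filter]
  simp only [Finset.sum_const, nsmul_eq_mul, mul_one]
  norm_cast
  refine (Finset.card_le_card (t := Finset.univ.image (fun u : (ZMod Q)ˣ => (u : ZMod Q))) ?_).trans Finset.card_image_le
  intro x hx
  obtain ⟨u, rfl⟩ := (Finset.mem_filter.1 hx).2
  exact Finset.mem_image_of_mem _ (Finset.mem_univ _)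

lemma fc_unit (χ : DirichletCharacter ℂ Q) (b : (ZMod Q)ˣ) (a : ZMod Q) : ‖fc χ (b * a)‖ = ‖fc χ a‖ := by
  have : fc χ a = χ b * fc χ (b * a) := by
    unfold fc
    rw [Finset.mul_sum, ← Equiv.sum_comp (Units.mulLeft b)]
    refine Finset.sum_congr rfl fun x _ => ?_
    simp only [Units.mulLeft_apply, map_mul]
    rw [mul_assoc]
    congr 3
    ring_nf
  rw [this, norm_mul]
  have : ‖χ b‖ = 1 := χ.unit_norm_eq_one b
  rw [this, one_mul]

lemma card_mul_zero_le (a : ZMod Q) : (Finset.univ.filter (fun b : ZMod Q => b * a = 0)).card ≤ Nat.gcd a.val Q := by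
  classical
  have hg : 0 < Nat.gcd a.val Q := Nat.gcd_pos_of_pos_right _ (NeZero.pos Q)
  refine le_trans (Finset.card_le_card ?_) (IsAddCyclic.card_nsmul_eq_zero_le (α := ZMod Q) hg)
  intro b hb
  simp only [Finset.mem_filter, Finset.mem_univ, true_and] at hb ⊢
  have h := Nat.gcd_eq_gcd_ab a.val Q
  have h2 := congrArg (fun z : ℤ => (z : ZMod Q)) h
  push_cast at h2
  simp only [ZMod.natCast_val, ZMod.cast_id', id, CharP.cast_eq_zero, zero_mul, add_zero] at h2
  rw [nsmul_eq_mul, h2]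
  calc _ = (b * a) * ((a.val.gcdA Q : ℤ) : ZMod Q) := by ring
    _ = 0 := by rw [hb, zero_mul]

lemma card_mul_eq_le (a c : ZMod Q) : (Finset.univ.filter (fun b : ZMod Q => b * a = c)).card ≤ Nat.gcd a.val Q := by
  classical
  rcases (Finset.univ.filter (fun b : ZMod Q => b * a = c)).eq_empty_or_nonempty with h | ⟨b0, hb0⟩
  · rw [h]; simp
  · refine le_trans ?_ (card_mul_zero_le a)
    refine Finset.card_le_card_of_injOn (fun b => b - b0) ?_ ?_
    · intro b hb
      simp only [Finset.coe_filter, Finset.mem_filter, Finset.mem_univ, true_and, Set.mem_ofPred_eq] at hb hb0 ⊢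
      rw [sub_mul, hb, hb0, sub_self]
    · intro x _ y _ h
      simpa using h

lemma fc_sq_le (χ : DirichletCharacter ℂ Q) (a : ZMod Q) : ‖fc χ a‖ ^ 2 ≤ Q * Nat.gcd a.val Q := by
  classical
  have h1 : (Q.totient : ℝ) * ‖fc χ a‖ ^ 2 = ∑ b : (ZMod Q)ˣ, ‖fc χ (b * a)‖ ^ 2 := by
    simp_rw [fc_unit]
    rw [Finset.sum_const, nsmul_eq_mul, Finset.card_univ, ZMod.card_units_eq_totient]
  have h2 : ∑ b : (ZMod Q)ˣ, ‖fc χ (b * a)‖ ^ 2 ≤ ∑ b : ZMod Q, ‖fc χ (b * a)‖ ^ 2 := by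
    rw [← Finset.sum_image (s := Finset.univ) (g := fun b : (ZMod Q)ˣ => (b : ZMod Q)) (f := fun b => ‖fc χ (b * a)‖ ^ 2)
      (fun x _ y _ h => Units.ext h)]
    exact Finset.sum_le_sum_of_subset_of_nonneg (Finset.subset_univ _) fun _ _ _ => by positivity
  have h3 : ∑ b : ZMod Q, ‖fc χ (b * a)‖ ^ 2 ≤ Nat.gcd a.val Q * ∑ c : ZMod Q, ‖fc χ c‖ ^ 2 := by
    rw [← Finset.sum_fiberwise (s := Finset.univ) (g := fun b : ZMod Q => b * a), Finset.mul_sum]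
    refine Finset.sum_le_sum fun c _ => ?_
    rw [Finset.sum_congr rfl (g := fun _ => ‖fc χ c‖ ^ 2) (fun b hb => by rw [(Finset.mem_filter.1 hb).2]),
      Finset.sum_const, nsmul_eq_mul]
    gcongr
    exact card_mul_eq_le a c
  have h4 := fc_parseval χ
  have h5 : (0 : ℝ) < Q.totient := by exact_mod_cast Nat.totient_pos.2 (NeZero.pos Q)
  have h6 : (Q.totient : ℝ) * ‖fc χ a‖ ^ 2 ≤ Q.totient * (Q * Nat.gcd a.val Q) := by
    calc _ ≤ _ := h1.le.trans (h2.trans h3)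
      _ ≤ Nat.gcd a.val Q * (Q * Q.totient) := by gcongr
      _ = _ := by ring
  exact le_of_mul_le_mul_left h6 h5

lemma geom_std_le {a : ℕ} (ha : 0 < a) (haQ : a < Q) (N : ℕ) :
    ‖∑ n ∈ Finset.range N, (ZMod.stdAddChar ((a : ZMod Q) * (n : ZMod Q)) : ℂ)‖ ≤ Q / 2 * (1 / a + 1 / ((Q - a : ℕ) : ℝ)) := by
  set z : ℂ := ZMod.stdAddChar (a : ZMod Q) with hz
  have hz1 : ‖z‖ = 1 := by simp [hz]
  have hpow : ∀ n : ℕ, (ZMod.stdAddChar ((a : ZMod Q) * (n : ZMod Q)) : ℂ) = z ^ n := by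
    intro n
    rw [hz, ← AddChar.map_nsmul_eq_pow, nsmul_eq_mul, mul_comm]
  simp_rw [hpow]
  have hQ : (0 : ℝ) < Q := by exact_mod_cast NeZero.pos Q
  have ha' : (0 : ℝ) < a := by exact_mod_cast ha
  have haQ' : (a : ℝ) < Q := by exact_mod_cast haQ
  have hsub : ((Q - a : ℕ) : ℝ) = Q - a := by rw [Nat.cast_sub haQ.le]
  rw [hsub]
  have hq : (0 : ℝ) < Q - a := by linarith
  have hsin : ‖z - 1‖ = 2 * |Real.sin (Real.pi * a / Q)| := by
    have : z = Complex.exp (Complex.I * ((2 * Real.pi * a / Q : ℝ) : ℂ)) := by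
      rw [hz]
      have := ZMod.stdAddChar_coe (N := Q) (a : ℤ)
      push_cast at this
      rw [this]; congr 1; push_cast; ring
    rw [this, Complex.norm_exp_I_mul_ofReal_sub_one, Real.norm_eq_abs, abs_mul, abs_two]
    congr 3; ring
  -- lower bound
  have hpi := Real.pi_pos
  have hlow : 1 / ‖z - 1‖ ≤ Q / 4 * (1 / a + 1 / (Q - a)) ∧ z ≠ 1 := by
    have hA : ∃ m : ℝ, 0 < m ∧ 4 * m / Q ≤ ‖z - 1‖ ∧ 1 / m ≤ 1 / a + 1 / ((Q : ℝ) - a) := by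
      by_cases h : (a : ℝ) ≤ Q / 2
      · refine ⟨a, ha', ?_, ?_⟩
        · rw [hsin]
          have := Real.mul_le_sin (x := Real.pi * a / Q) (by positivity) (by
            rw [div_le_div_iff₀ hQ two_pos]; nlinarith)
          have h3 : 2 / Real.pi * (Real.pi * a / Q) = 2 * a / Q := by field_simp
          rw [h3] at this
          have h4 := le_abs_self (Real.sin (Real.pi * a / Q))
          calc 4 * (a : ℝ) / Q = 2 * (2 * a / Q) := by ring
            _ ≤ _ := by linarith
        · have : 0 < 1 / ((Q : ℝ) - a) := by positivity
          linarith
      · push Not at h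
        refine ⟨Q - a, hq, ?_, ?_⟩
        · rw [hsin]
          have := Real.mul_le_sin (x := Real.pi * (Q - a) / Q) (by positivity) (by
            rw [div_le_div_iff₀ hQ two_pos]; nlinarith)
          have h3 : 2 / Real.pi * (Real.pi * (Q - a) / Q) = 2 * (Q - a) / Q := by field_simp
          rw [h3] at this
          have h5 : Real.sin (Real.pi * (Q - a) / Q) = Real.sin (Real.pi * a / Q) := by
            rw [← Real.sin_pi_sub]; congr 1; field_simp; ring
          rw [h5] at this
          have h4 := le_abs_self (Real.sin (Real.pi * a / Q))
          calc 4 * ((Q : ℝ) - a) / Q = 2 * (2 * (Q - a) / Q) := by ring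
            _ ≤ _ := by linarith
        · have : 0 < 1 / (a : ℝ) := by positivity
          linarith
    obtain ⟨m, hm, h1, h2⟩ := hA
    constructor
    · calc 1 / ‖z - 1‖ ≤ 1 / (4 * m / Q) := one_div_le_one_div_of_le (by positivity) h1
        _ = Q / 4 * (1 / m) := by field_simp
        _ ≤ _ := by gcongr
    · intro h
      rw [h, sub_self, norm_zero] at h1
      have : 0 < 4 * m / Q := by positivity
      linarith
  rw [geom_sum_eq hlow.2, norm_div]
  have h2 : ‖z ^ N - 1‖ ≤ 2 := by
    calc _ ≤ ‖z ^ N‖ + ‖(1 : ℂ)‖ := norm_sub_le _ _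
      _ = 2 := by rw [norm_pow, hz1]; norm_num
  calc ‖z ^ N - 1‖ / ‖z - 1‖ ≤ 2 / ‖z - 1‖ := by gcongr
    _ = 2 * (1 / ‖z - 1‖) := by ring
    _ ≤ 2 * (Q / 4 * (1 / a + 1 / (Q - a))) := by linarith [hlow.1]
    _ = _ := by ring

/-- Pólya–Vinogradov (with a divisor factor, valid for all non-principal characters). -/
lemma pv (χ : DirichletCharacter ℂ Q) (hχ : χ ≠ 1) (N : ℕ) :
    ‖∑ n ∈ Finset.range N, χ (n : ZMod Q)‖ ≤ Real.sqrt Q * Q.divisors.card * (1 + Real.log Q) := by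
  have hQ : (0 : ℝ) < Q := by exact_mod_cast NeZero.pos Q
  have h0 : fc χ 0 = 0 := by
    unfold fc
    simpa using MulChar.sum_eq_zero_of_ne_one hχ
  simp_rw [fun n : ℕ => fc_inv χ (n : ZMod Q)]
  rw [← Finset.mul_sum, Finset.sum_comm]
  simp_rw [← Finset.mul_sum]
  rw [norm_mul, norm_inv, Complex.norm_natCast]
  have hb : ∀ a : ℕ, a ∈ Finset.Ico 1 Q → ‖fc χ (a : ZMod Q) * ∑ n ∈ Finset.range N, (ZMod.stdAddChar ((a : ZMod Q) * (n : ZMod Q)) : ℂ)‖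
      ≤ Real.sqrt Q * (Q / 2) * (Nat.gcd a Q / a + Nat.gcd (Q - a) Q / ((Q - a : ℕ) : ℝ)) := by
    intro a ha
    obtain ⟨ha1, ha2⟩ := Finset.mem_Ico.1 ha
    rw [norm_mul]
    have h1 : ‖fc χ (a : ZMod Q)‖ ≤ Real.sqrt Q * Nat.gcd a Q := by
      have h := fc_sq_le χ (a : ZMod Q)
      rw [ZMod.val_natCast, Nat.mod_eq_of_lt ha2] at h
      refine le_of_sq_le_sq ?_ (by positivity)
      rw [mul_pow, Real.sq_sqrt hQ.le]
      refine h.trans ?_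
      gcongr
      have : (1 : ℝ) ≤ Nat.gcd a Q := by
        exact_mod_cast Nat.gcd_pos_of_pos_left _ ha1
      nlinarith
    have h2 := geom_std_le (Q := Q) (a := a) ha1 ha2 N
    have h3 : Nat.gcd (Q - a) Q = Nat.gcd a Q := by
      rw [Nat.gcd_comm, Nat.gcd_self_sub_right ha2.le, Nat.gcd_comm]
    rw [h3]
    calc _ ≤ (Real.sqrt Q * Nat.gcd a Q) * (Q / 2 * (1 / a + 1 / ((Q - a : ℕ) : ℝ))) := by gcongr
      _ = _ := by ring
  have hsum : ∑ a : ZMod Q, fc χ a * ∑ n ∈ Finset.range N, (ZMod.stdAddChar (a * (n : ZMod Q)) : ℂ)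
      = ∑ a ∈ Finset.Ico 1 Q, fc χ (a : ZMod Q) * ∑ n ∈ Finset.range N, (ZMod.stdAddChar ((a : ZMod Q) * (n : ZMod Q)) : ℂ) := by
    have e1 : ∑ a : ZMod Q, fc χ a * ∑ n ∈ Finset.range N, (ZMod.stdAddChar (a * (n : ZMod Q)) : ℂ)
      = ∑ a ∈ Finset.range Q, fc χ (a : ZMod Q) * ∑ n ∈ Finset.range N, (ZMod.stdAddChar ((a : ZMod Q) * (n : ZMod Q)) : ℂ) := by
      refine Finset.sum_nbij' (fun a => a.val) (fun a => (a : ZMod Q)) ?_ ?_ ?_ ?_ ?_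
      · intro a _; exact Finset.mem_range.2 (ZMod.val_lt a)
      · intro a _; exact Finset.mem_univ _
      · intro a _; simp
      · intro a ha; simp [ZMod.val_natCast, Nat.mod_eq_of_lt (Finset.mem_range.1 ha)]
      · intro a _; simp
    rw [e1, Finset.range_eq_Ico, Finset.sum_eq_sum_Ico_succ_bot (NeZero.pos Q)]
    simp [h0]
  rw [hsum]
  have hr : ∑ a ∈ Finset.Ico 1 Q, (Nat.gcd (Q - a) Q / ((Q - a : ℕ) : ℝ)) = ∑ a ∈ Finset.Ico 1 Q, (Nat.gcd a Q / (a : ℝ)) := by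
    refine Finset.sum_nbij' (fun a => Q - a) (fun a => Q - a) ?_ ?_ ?_ ?_ ?_
    all_goals intro a ha; simp only [Finset.mem_Ico] at ha ⊢
    · omega
    · omega
    · omega
    · omega
  have hs : ∑ a ∈ Finset.Ico 1 Q, ((Nat.gcd a Q : ℝ) / (a : ℝ)) ≤ Q.divisors.card * (1 + Real.log Q) := by
    refine le_trans (Finset.sum_le_sum_of_subset_of_nonneg ?_ fun _ _ _ => by positivity) (sum_gcd_div_le Q (NeZero.pos Q))
    intro a ha; simp only [Finset.mem_Ico, Finset.mem_Icc] at ha ⊢; omega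
  calc _ ≤ (Q : ℝ)⁻¹ * ∑ a ∈ Finset.Ico 1 Q, Real.sqrt Q * (Q / 2) * (Nat.gcd a Q / a + Nat.gcd (Q - a) Q / ((Q - a : ℕ) : ℝ)) := by
        gcongr
        exact (norm_sum_le _ _).trans (Finset.sum_le_sum hb)
    _ = Real.sqrt Q * ∑ a ∈ Finset.Ico 1 Q, ((Nat.gcd a Q : ℝ) / (a : ℝ)) := by
        rw [← Finset.mul_sum, Finset.sum_add_distrib, hr]; field_simp; ring
    _ ≤ _ := by rw [mul_assoc]; gcongr
end

end

section

/-! ### Abel summation -/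

lemma abel_identity (a w : ℕ → ℂ) (A B : ℕ) (hAB : A ≤ B) :
    ∑ n ∈ Finset.Icc A B, a n * w n = (∑ n ∈ Finset.range (B + 1), a n) * w B - (∑ n ∈ Finset.range A, a n) * w A
      - ∑ n ∈ Finset.Ico A B, (∑ j ∈ Finset.range (n + 1), a j) * (w (n + 1) - w n) := by
  induction B, hAB using Nat.le_induction with
  | base => simp [Finset.sum_range_succ]; ring
  | succ B hB ih =>
    rw [← Finset.insert_Icc_right_eq_Icc_add_one (by omega), Finset.sum_insert (by simp), ih, Finset.sum_Ico_succ_top hB, Finset.sum_range_succ _ (B + 1)]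
    ring

lemma abel_bound (a w : ℕ → ℂ) (A B : ℕ) (hAB : A ≤ B) (P : ℝ) (hP : ∀ N, ‖∑ n ∈ Finset.range N, a n‖ ≤ P) :
    ‖∑ n ∈ Finset.Icc A B, a n * w n‖ ≤ P * (‖w B‖ + ‖w A‖ + ∑ n ∈ Finset.Ico A B, ‖w (n + 1) - w n‖) := by
  rw [abel_identity a w A B hAB]
  have h3 : ‖∑ n ∈ Finset.Ico A B, (∑ j ∈ Finset.range (n + 1), a j) * (w (n + 1) - w n)‖ ≤
      P * ∑ n ∈ Finset.Ico A B, ‖w (n + 1) - w n‖ := by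
    rw [Finset.mul_sum]
    refine (norm_sum_le _ _).trans (Finset.sum_le_sum fun n _ => ?_)
    rw [norm_mul]
    exact mul_le_mul_of_nonneg_right (hP _) (norm_nonneg _)
  have h1 : ‖(∑ n ∈ Finset.range (B + 1), a n) * w B‖ ≤ P * ‖w B‖ := by
    rw [norm_mul]; exact mul_le_mul_of_nonneg_right (hP _) (norm_nonneg _)
  have h2 : ‖(∑ n ∈ Finset.range A, a n) * w A‖ ≤ P * ‖w A‖ := by
    rw [norm_mul]; exact mul_le_mul_of_nonneg_right (hP _) (norm_nonneg _)
  calc _ ≤ ‖(∑ n ∈ Finset.range (B + 1), a n) * w B‖ + ‖(∑ n ∈ Finset.range A, a n) * w A‖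
        + ‖∑ n ∈ Finset.Ico A B, (∑ j ∈ Finset.range (n + 1), a j) * (w (n + 1) - w n)‖ :=
        (norm_sub_le _ _).trans (add_le_add_left (norm_sub_le _ _) _)
    _ ≤ _ := by linarith

lemma log_succ_sub (n : ℕ) (hn : 0 < n) : 0 ≤ Real.log ((n + 1 : ℕ) : ℝ) - Real.log n ∧
    Real.log ((n + 1 : ℕ) : ℝ) - Real.log n ≤ 1 / n := by
  have hn' : (0 : ℝ) < n := by exact_mod_cast hn
  constructor
  · rw [sub_nonneg]; exact Real.log_le_log hn' (by push_cast; linarith)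
  · rw [← Real.log_div (by positivity) hn'.ne']
    refine (Real.log_le_sub_one_of_pos (by positivity)).trans (le_of_eq ?_)
    push_cast; field_simp; ring

lemma tw_diff (t : ℝ) (n : ℕ) (hn : 0 < n) : ‖tw t (n + 1) - tw t n‖ ≤ |t| / n := by
  set x : ℝ := t * (Real.log ((n + 1 : ℕ) : ℝ) - Real.log n) with hx
  have h : tw t (n + 1) = tw t n * Complex.exp (Complex.I * (x : ℂ)) := by
    unfold tw; rw [← Complex.exp_add]; congr 1; rw [hx]; push_cast; ring
  rw [h, show tw t n * Complex.exp (Complex.I * (x : ℂ)) - tw t n = tw t n * (Complex.exp (Complex.I * (x : ℂ)) - 1) by ring,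
    norm_mul, norm_tw, one_mul, Complex.norm_exp_I_mul_ofReal_sub_one, Real.norm_eq_abs, abs_mul, abs_two]
  have h1 := Real.abs_sin_le_abs (x := x / 2)
  rw [abs_div, abs_two] at h1
  have h2 : |x| ≤ |t| / n := by
    rw [hx, abs_mul, abs_of_nonneg (log_succ_sub n hn).1]
    calc _ ≤ |t| * (1 / n) := by gcongr; exact (log_succ_sub n hn).2
      _ = _ := by ring
  linarith

lemma sum_Ico_inv_le (Y : ℕ) : ∑ n ∈ Finset.Ico 1 Y, (1 : ℝ) / n ≤ 1 + Real.log Y := by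
  refine le_trans (Finset.sum_le_sum_of_subset_of_nonneg ?_ fun _ _ _ => by positivity) (harm_le Y)
  intro a ha; simp only [Finset.mem_Ico, Finset.mem_Icc] at ha ⊢; omega

lemma L_bound (a : ℕ → ℂ) (P : ℝ) (hP : ∀ N, ‖∑ n ∈ Finset.range N, a n‖ ≤ P) (Y : ℕ) (hY : 1 ≤ Y) (t : ℝ) :
    ‖∑ n ∈ Finset.Icc 1 Y, a n * tw t n‖ ≤ P * (2 + |t| * (1 + Real.log Y)) := by
  have hP0 : 0 ≤ P := (norm_nonneg _).trans (hP 0)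
  refine (abel_bound a (tw t) 1 Y hY P hP).trans ?_
  refine mul_le_mul_of_nonneg_left ?_ hP0
  rw [norm_tw, norm_tw]
  have : ∑ n ∈ Finset.Ico 1 Y, ‖tw t (n + 1) - tw t n‖ ≤ |t| * (1 + Real.log Y) := by
    calc _ ≤ ∑ n ∈ Finset.Ico 1 Y, |t| * (1 / (n : ℝ)) := Finset.sum_le_sum fun n hn => by
          have := tw_diff t n (Finset.mem_Ico.1 hn).1
          rw [mul_one_div]; exact this
      _ ≤ _ := by rw [← Finset.mul_sum]; gcongr; exact sum_Ico_inv_le Y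
  linarith

lemma D_bound (a : ℕ → ℂ) (P : ℝ) (hP : ∀ N, ‖∑ n ∈ Finset.range N, a n‖ ≤ P) (Y : ℕ) (hY : 1 ≤ Y) (t : ℝ) :
    ‖∑ n ∈ Finset.Icc 1 Y, a n * ((Real.log n : ℝ) * tw t n)‖ ≤ P * (Real.log Y * (2 + |t| * (1 + Real.log Y))) := by
  have hP0 : 0 ≤ P := (norm_nonneg _).trans (hP 0)
  refine (abel_bound a (fun n => (Real.log n : ℝ) * tw t n) 1 Y hY P hP).trans ?_
  gcongr
  have hlY : 0 ≤ Real.log Y := Real.log_natCast_nonneg Y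
  have e1 : ‖((Real.log Y : ℝ) : ℂ) * tw t Y‖ = Real.log Y := by
    rw [norm_mul, norm_tw, Complex.norm_real, Real.norm_of_nonneg hlY, mul_one]
  have e2 : ‖((Real.log (1 : ℕ) : ℝ) : ℂ) * tw t 1‖ = 0 := by simp
  rw [e1, e2]
  have : ∑ n ∈ Finset.Ico 1 Y, ‖((Real.log ((n + 1 : ℕ) : ℝ) : ℝ) : ℂ) * tw t (n + 1) - ((Real.log n : ℝ) : ℂ) * tw t n‖
      ≤ Real.log Y + Real.log Y * (|t| * (1 + Real.log Y)) := by
    have hb : ∀ n ∈ Finset.Ico 1 Y, ‖((Real.log ((n + 1 : ℕ) : ℝ) : ℝ) : ℂ) * tw t (n + 1) - ((Real.log n : ℝ) : ℂ) * tw t n‖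
       ≤ (Real.log ((n + 1 : ℕ) : ℝ) - Real.log n) + Real.log Y * (|t| * (1 / n)) := by
      intro n hn
      obtain ⟨h1, h2⟩ := Finset.mem_Ico.1 hn
      have h3 := log_succ_sub n h1
      have h4 := tw_diff t n h1
      rw [show ((Real.log ((n + 1 : ℕ) : ℝ) : ℝ) : ℂ) * tw t (n + 1) - ((Real.log n : ℝ) : ℂ) * tw t n =
        ((Real.log ((n + 1 : ℕ) : ℝ) - Real.log n : ℝ) : ℂ) * tw t (n + 1) + ((Real.log n : ℝ) : ℂ) * (tw t (n + 1) - tw t n) by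
          push_cast; ring]
      refine (norm_add_le _ _).trans ?_
      rw [norm_mul, norm_mul, norm_tw, Complex.norm_real, Complex.norm_real, Real.norm_of_nonneg h3.1,
        Real.norm_of_nonneg (Real.log_natCast_nonneg n), mul_one]
      have h5 : Real.log n ≤ Real.log Y := Real.log_le_log (by exact_mod_cast h1) (by exact_mod_cast h2.le)
      rw [mul_one_div]
      gcongr
    refine (Finset.sum_le_sum hb).trans ?_
    rw [Finset.sum_add_distrib, Finset.sum_Ico_sub (fun n : ℕ => Real.log (n : ℝ)) hY, ← Finset.mul_sum, ← Finset.mul_sum]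
    have := sum_Ico_inv_le Y
    simp only [Nat.cast_one, Real.log_one, sub_zero]
    gcongr
  have e3 : Real.log Y * (2 + |t| * (1 + Real.log Y)) = 2 * Real.log Y + Real.log Y * (|t| * (1 + Real.log Y)) := by ring
  rw [e3]
  linarith

lemma one_bound (a : ℕ → ℂ) (P : ℝ) (hP : ∀ N, ‖∑ n ∈ Finset.range N, a n‖ ≤ P) (A B : ℕ) (hA : 1 ≤ A) (hAB : A ≤ B) (t : ℝ) :
    ‖∑ n ∈ Finset.Icc A B, a n * (tw t n / n)‖ ≤ P * ((3 + |t|) / A) := by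
  have hP0 : 0 ≤ P := (norm_nonneg _).trans (hP 0)
  refine (abel_bound a (fun n => tw t n / n) A B hAB P hP).trans ?_
  gcongr
  have hA' : (0 : ℝ) < A := by exact_mod_cast hA
  have hAB' : (A : ℝ) ≤ B := by exact_mod_cast hAB
  have e : ∀ n : ℕ, ‖tw t n / (n : ℂ)‖ = 1 / n := fun n => by rw [norm_div, norm_tw, Complex.norm_natCast]
  rw [e, e]
  have : ∑ n ∈ Finset.Ico A B, ‖tw t (n + 1) / ((n + 1 : ℕ) : ℂ) - tw t n / n‖ ≤ (1 + |t|) * (1 / A) := by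
    have hb : ∀ n ∈ Finset.Ico A B, ‖tw t (n + 1) / ((n + 1 : ℕ) : ℂ) - tw t n / n‖ ≤
       (1 + |t|) * ((-1 / ((n + 1 : ℕ) : ℝ)) - (-1 / n)) := by
      intro n hn
      have h1 : 0 < n := lt_of_lt_of_le hA (Finset.mem_Ico.1 hn).1
      have hn' : (0 : ℝ) < n := by exact_mod_cast h1
      have h4 := tw_diff t n h1
      have hnc : (n : ℂ) ≠ 0 := by exact_mod_cast h1.ne'
      have hnc1 : ((n + 1 : ℕ) : ℂ) ≠ 0 := by exact_mod_cast (Nat.succ_ne_zero n)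
      rw [show tw t (n + 1) / ((n + 1 : ℕ) : ℂ) - tw t n / n = (tw t (n + 1) - tw t n) * (((1 / ((n + 1 : ℕ) : ℝ)) : ℝ) : ℂ) -
        tw t n * ((1 / n - 1 / ((n + 1 : ℕ) : ℝ) : ℝ) : ℂ) by push_cast at hnc1 ⊢; field_simp; ring]
      refine (norm_sub_le _ _).trans ?_
      have h5 : 0 ≤ (1 : ℝ) / n - 1 / ((n + 1 : ℕ) : ℝ) := by
        rw [sub_nonneg]; exact one_div_le_one_div_of_le hn' (by push_cast; linarith)
      rw [norm_mul, norm_mul, norm_tw, Complex.norm_real, Complex.norm_real, Real.norm_of_nonneg h5, one_mul,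
        Real.norm_of_nonneg (by positivity)]
      have h6 : ‖tw t (n + 1) - tw t n‖ * (1 / ((n + 1 : ℕ) : ℝ)) ≤ |t| / n * (1 / ((n + 1 : ℕ) : ℝ)) := by gcongr
      have h7 : |t| / n * (1 / ((n + 1 : ℕ) : ℝ)) = |t| * ((-1 / ((n + 1 : ℕ) : ℝ)) - (-1 / n)) := by
        push_cast; field_simp; ring
      rw [h7] at h6
      calc _ ≤ _ := add_le_add_left h6 _
        _ = _ := by ring
    refine (Finset.sum_le_sum hb).trans ?_
    rw [← Finset.mul_sum, Finset.sum_Ico_sub (fun n : ℕ => -1 / (n : ℝ)) hAB]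
    have : 0 < 1 / (B : ℝ) := one_div_pos.2 (hA'.trans_le hAB')
    gcongr
    have e1 : -1 / (B : ℝ) - -1 / A = 1 / A - 1 / B := by ring
    rw [e1]; linarith
  have h8 : 1 / (B : ℝ) ≤ 1 / A := one_div_le_one_div_of_le hA' hAB'
  calc _ ≤ 1 / (A : ℝ) + 1 / A + (1 + |t|) * (1 / A) := by linarith
    _ = _ := by ring

end

section

/-! ### Large sieve for one modulus, and divisor sums -/

section
variable {Q : ℕ} [NeZero Q]

lemma orth_bound (x y : ZMod Q) : ‖∑ χ : DirichletCharacter ℂ Q, χ x * (starRingEnd ℂ) (χ y)‖ ≤ if x = y then (Q.totient : ℝ) else 0 := by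
  by_cases hy : IsUnit y
  · have h := DirichletCharacter.sum_char_inv_mul_char_eq ℂ hy x
    have e : ∀ χ : DirichletCharacter ℂ Q, χ x * (starRingEnd ℂ) (χ y) = χ y⁻¹ * χ x := by
      intro χ
      rw [mul_comm]
      congr 1
      have := MulChar.star_apply' χ y
      rw [← Complex.star_def, this]
      obtain ⟨u, rfl⟩ := hy
      rw [MulChar.inv_apply_eq_inv', ZMod.inv_coe_unit, ← MulChar.inv_apply_eq_inv', MulChar.inv_apply, Ring.inverse_unit]
    simp_rw [e]
    rw [h]
    by_cases hxy : x = y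
    · simp [hxy]
    · simp [hxy, Ne.symm hxy]
  · have e : ∀ χ : DirichletCharacter ℂ Q, χ x * (starRingEnd ℂ) (χ y) = 0 := by
      intro χ; rw [χ.map_nonunit hy]; simp
    simp_rw [e]
    simp only [Finset.sum_const_zero, norm_zero]
    split_ifs <;> positivity

lemma ls_gen (s : Finset (DirichletCharacter ℂ Q)) (I : Finset ℕ) (a : ℕ → ℂ) :
    ∑ χ ∈ s, ‖∑ n ∈ I, a n * χ (n : ZMod Q)‖ ^ 2 ≤
      Q.totient * ∑ n ∈ I, ∑ n' ∈ I.filter (fun n' : ℕ => (n : ZMod Q) = (n' : ZMod Q)), ‖a n‖ * ‖a n'‖ := by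
  have h1 : ∑ χ ∈ s, ‖∑ n ∈ I, a n * χ (n : ZMod Q)‖ ^ 2 ≤ ∑ χ : DirichletCharacter ℂ Q, ‖∑ n ∈ I, a n * χ (n : ZMod Q)‖ ^ 2 :=
    Finset.sum_le_sum_of_subset_of_nonneg (Finset.subset_univ _) fun _ _ _ => by positivity
  refine h1.trans ?_
  have h2 : ((∑ χ : DirichletCharacter ℂ Q, ‖∑ n ∈ I, a n * χ (n : ZMod Q)‖ ^ 2 : ℝ) : ℂ) =
      ∑ n ∈ I, ∑ n' ∈ I, a n * (starRingEnd ℂ) (a n') * ∑ χ : DirichletCharacter ℂ Q, χ (n : ZMod Q) * (starRingEnd ℂ) (χ (n' : ZMod Q)) := by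
    push_cast
    simp_rw [← Complex.mul_conj', map_sum, Finset.sum_mul_sum, Finset.mul_sum]
    rw [Finset.sum_comm]
    refine Finset.sum_congr rfl fun n _ => ?_
    rw [Finset.sum_comm]
    refine Finset.sum_congr rfl fun n' _ => Finset.sum_congr rfl fun χ _ => ?_
    rw [map_mul]; ring
  have h3 : (∑ χ : DirichletCharacter ℂ Q, ‖∑ n ∈ I, a n * χ (n : ZMod Q)‖ ^ 2 : ℝ) =
     ‖((∑ χ : DirichletCharacter ℂ Q, ‖∑ n ∈ I, a n * χ (n : ZMod Q)‖ ^ 2 : ℝ) : ℂ)‖ := by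
    rw [Complex.norm_real, Real.norm_of_nonneg (Finset.sum_nonneg fun _ _ => by positivity)]
  rw [h3, h2, Finset.mul_sum]
  refine (norm_sum_le _ _).trans (Finset.sum_le_sum fun n _ => ?_)
  rw [Finset.mul_sum, Finset.sum_filter]
  refine (norm_sum_le _ _).trans (Finset.sum_le_sum fun n' _ => ?_)
  rw [norm_mul, norm_mul, RCLike.norm_conj]
  have := orth_bound (n : ZMod Q) (n' : ZMod Q)
  split_ifs at this ⊢ with h
  · calc _ ≤ ‖a n‖ * ‖a n'‖ * Q.totient := by gcongr
      _ = _ := by ring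
  · have h0 := le_antisymm this (norm_nonneg _)
    rw [h0, mul_zero]

lemma card_class_le (U : ℕ) (x : ZMod Q) : ((Finset.Icc 1 U).filter (fun n' : ℕ => x = (n' : ZMod Q))).card ≤ U / Q + 1 := by
  rw [← Finset.card_range (U / Q + 1)]
  refine Finset.card_le_card_of_injOn (fun n => n / Q) ?_ ?_
  · intro n hn
    simp only [Finset.coe_filter, Finset.mem_Icc, Set.mem_ofPred_eq] at hn
    simp only [Finset.coe_range, Set.mem_Iio]
    exact Nat.lt_succ_of_le (Nat.div_le_div_right hn.1.2)
  · intro n hn m hm h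
    simp only [Finset.coe_filter, Finset.mem_Icc, Set.mem_ofPred_eq] at hn hm
    have h1 : (n : ZMod Q) = m := hn.2.symm.trans hm.2
    rw [ZMod.natCast_eq_natCast_iff] at h1
    have h2 : n % Q = m % Q := h1
    simp only at h
    rw [← Nat.div_add_mod n Q, ← Nat.div_add_mod m Q, h, h2]

lemma ls_M (s : Finset (DirichletCharacter ℂ Q)) (U : ℕ) (hU : Q ≤ U) (a : ℕ → ℂ) (ha : ∀ n, ‖a n‖ ≤ 1) :
    ∑ χ ∈ s, ‖∑ n ∈ Finset.Icc 1 U, a n * χ (n : ZMod Q)‖ ^ 2 ≤ 2 * (U : ℝ) ^ 2 := by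
  refine (ls_gen s _ a).trans ?_
  have h1 : ∑ n ∈ Finset.Icc 1 U, ∑ n' ∈ (Finset.Icc 1 U).filter (fun n' : ℕ => (n : ZMod Q) = (n' : ZMod Q)), ‖a n‖ * ‖a n'‖ ≤
     U * ((U : ℝ) / Q + 1) := by
    calc _ ≤ ∑ n ∈ Finset.Icc 1 U, ((U : ℝ) / Q + 1) := by
          refine Finset.sum_le_sum fun n _ => ?_
          calc _ ≤ ∑ n' ∈ (Finset.Icc 1 U).filter (fun n' : ℕ => (n : ZMod Q) = (n' : ZMod Q)), (1 : ℝ) :=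
                Finset.sum_le_sum fun n' _ => by
                  have := ha n; have := ha n'; nlinarith [norm_nonneg (a n), norm_nonneg (a n')]
            _ = (((Finset.Icc 1 U).filter (fun n' : ℕ => (n : ZMod Q) = (n' : ZMod Q))).card : ℝ) := by simp
            _ ≤ ((U / Q + 1 : ℕ) : ℝ) := by exact_mod_cast card_class_le U (n : ZMod Q)
            _ ≤ _ := by push_cast; gcongr; exact Nat.cast_div_le
      _ = _ := by simp; ring
  have hQ : (0 : ℝ) < Q := by exact_mod_cast NeZero.pos Q
  have ht : (Q.totient : ℝ) ≤ Q := by exact_mod_cast Nat.totient_le Q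
  have hU' : (Q : ℝ) ≤ U := by exact_mod_cast hU
  calc _ ≤ (Q : ℝ) * (U * ((U : ℝ) / Q + 1)) := by gcongr
    _ = U ^ 2 + Q * U := by field_simp
    _ ≤ _ := by nlinarith

lemma class_inv_le (U N : ℕ) (hU : Q ≤ U) (x : ZMod Q) :
    ∑ n ∈ (Finset.Ioc U N).filter (fun n : ℕ => x = (n : ZMod Q)), (1 : ℝ) / n ≤ (1 + Real.log N) / Q := by
  have hQ : (0 : ℝ) < Q := by exact_mod_cast NeZero.pos Q
  set F := (Finset.Ioc U N).filter (fun n : ℕ => x = (n : ZMod Q)) with hF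
  have hmem : ∀ n ∈ F, U < n ∧ n ≤ N ∧ x = (n : ZMod Q) := by
    intro n hn; simp only [hF, Finset.mem_filter, Finset.mem_Ioc] at hn; exact ⟨hn.1.1, hn.1.2, hn.2⟩
  have h1 : ∀ n ∈ F, (1 : ℝ) / n ≤ (1 / Q) * ∑ i ∈ Finset.range Q, (1 : ℝ) / ((n - i : ℕ) : ℝ) := by
    intro n hn
    obtain ⟨h1, h2, _⟩ := hmem n hn
    have : ∑ i ∈ Finset.range Q, (1 : ℝ) / n ≤ ∑ i ∈ Finset.range Q, (1 : ℝ) / ((n - i : ℕ) : ℝ) := by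
      refine Finset.sum_le_sum fun i hi => ?_
      have hi' := Finset.mem_range.1 hi
      refine one_div_le_one_div_of_le ?_ ?_
      · have : 0 < n - i := by omega
        exact_mod_cast this
      · exact_mod_cast Nat.sub_le n i
    rw [Finset.sum_const, Finset.card_range, nsmul_eq_mul] at this
    calc (1 : ℝ) / n = (1 / Q) * (Q * (1 / n)) := by field_simp
      _ ≤ _ := by gcongr
  refine (Finset.sum_le_sum h1).trans ?_
  rw [← Finset.mul_sum, ← Finset.sum_product' F (Finset.range Q) (fun n i => (1 : ℝ) / ((n - i : ℕ) : ℝ))]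
  rw [show (1 + Real.log N) / (Q : ℝ) = 1 / Q * (1 + Real.log N) by ring]
  refine mul_le_mul_of_nonneg_left ?_ (by positivity)
  refine le_trans ?_ (harm_le N)
  rw [← Finset.sum_image (s := F ×ˢ Finset.range Q) (g := fun p : ℕ × ℕ => p.1 - p.2) (f := fun m : ℕ => (1 : ℝ) / (m : ℝ))]
  · refine Finset.sum_le_sum_of_subset_of_nonneg ?_ fun _ _ _ => by positivity
    intro m hm
    obtain ⟨⟨n, i⟩, hp, rfl⟩ := Finset.mem_image.1 hm
    simp only [Finset.mem_product, Finset.mem_range] at hp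
    obtain ⟨h1, h2, _⟩ := hmem n hp.1
    simp only [Finset.mem_Icc]; omega
  · rintro ⟨n, i⟩ hp ⟨m, k⟩ hq h
    simp only [Finset.coe_product, Finset.coe_range, Set.mem_prod, Finset.mem_coe, Set.mem_Iio] at hp hq
    simp only at h
    obtain ⟨h1, h2, h3⟩ := hmem n hp.1
    obtain ⟨h4, h5, h6⟩ := hmem m hq.1
    have h7 : (n : ZMod Q) = m := h3.symm.trans h6
    rw [ZMod.natCast_eq_natCast_iff] at h7
    have h8 : i ≡ k [MOD Q] := by
      have e : n + k = m + i := by omega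
      have h9 : n + k ≡ n + i [MOD Q] := by rw [e]; exact h7.symm.add_right i
      exact (Nat.ModEq.add_left_cancel' n h9).symm
    have h10 := Nat.ModEq.eq_of_lt_of_lt h8 hp.2 hq.2
    ext <;> simp only <;> omega

lemma ls_C (s : Finset (DirichletCharacter ℂ Q)) (U N : ℕ) (hU : Q ≤ U) (a : ℕ → ℂ) :
    ∑ χ ∈ s, ‖∑ n ∈ Finset.Ioc U N, a n * χ (n : ZMod Q)‖ ^ 2 ≤ (1 + Real.log N) * ∑ n ∈ Finset.Ioc U N, n * ‖a n‖ ^ 2 := by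
  refine (ls_gen s _ a).trans ?_
  have hQ : (0 : ℝ) < Q := by exact_mod_cast NeZero.pos Q
  have ht : (Q.totient : ℝ) ≤ Q := by exact_mod_cast Nat.totient_le Q
  have hL : 0 ≤ 1 + Real.log N := by have := Real.log_natCast_nonneg N; linarith
  set T : ℝ := ∑ n ∈ Finset.Ioc U N, ∑ n' ∈ (Finset.Ioc U N).filter (fun n' : ℕ => (n : ZMod Q) = (n' : ZMod Q)), n * ‖a n‖ ^ 2 * (1 / n') with hT
  have h1 : ∑ n ∈ Finset.Ioc U N, ∑ n' ∈ (Finset.Ioc U N).filter (fun n' : ℕ => (n : ZMod Q) = (n' : ZMod Q)), ‖a n‖ * ‖a n'‖ ≤ T := by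
    have h2 : T = ∑ n ∈ Finset.Ioc U N, ∑ n' ∈ (Finset.Ioc U N).filter (fun n' : ℕ => (n : ZMod Q) = (n' : ZMod Q)), n' * ‖a n'‖ ^ 2 * (1 / n) := by
      rw [hT]
      simp_rw [Finset.sum_filter]
      rw [Finset.sum_comm]
      refine Finset.sum_congr rfl fun n _ => Finset.sum_congr rfl fun n' _ => ?_
      simp only [eq_comm]
    have h3 : ∑ n ∈ Finset.Ioc U N, ∑ n' ∈ (Finset.Ioc U N).filter (fun n' : ℕ => (n : ZMod Q) = (n' : ZMod Q)), 2 * (‖a n‖ * ‖a n'‖) ≤ T + T := by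
      nth_rewrite 2 [h2]
      rw [hT, ← Finset.sum_add_distrib]
      refine Finset.sum_le_sum fun n hn => ?_
      rw [← Finset.sum_add_distrib]
      refine Finset.sum_le_sum fun n' hn' => ?_
      have hn0 : (0 : ℝ) < n := by
        have := (Finset.mem_Ioc.1 hn).1; exact_mod_cast (by omega : 0 < n)
      have hn0' : (0 : ℝ) < n' := by
        have := (Finset.mem_Ioc.1 (Finset.mem_filter.1 hn').1).1; exact_mod_cast (by omega : 0 < n')
      have : n * ‖a n‖ ^ 2 * (1 / n') + n' * ‖a n'‖ ^ 2 * (1 / n) - 2 * (‖a n‖ * ‖a n'‖) = (n * ‖a n‖ - n' * ‖a n'‖) ^ 2 / (n * n') := by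
        field_simp; ring
      have h5 : 0 ≤ (n * ‖a n‖ - n' * ‖a n'‖) ^ 2 / (n * n') := by positivity
      linarith
    have h6 : ∀ n : ℕ, ∑ n' ∈ (Finset.Ioc U N).filter (fun n' : ℕ => (n : ZMod Q) = (n' : ZMod Q)), 2 * (‖a n‖ * ‖a n'‖) =
        2 * ∑ n' ∈ (Finset.Ioc U N).filter (fun n' : ℕ => (n : ZMod Q) = (n' : ZMod Q)), ‖a n‖ * ‖a n'‖ := fun n => by
      rw [Finset.mul_sum]
    rw [Finset.sum_congr rfl fun n _ => h6 n, ← Finset.mul_sum] at h3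
    linarith
  have h4 : T ≤ (1 + Real.log N) / Q * ∑ n ∈ Finset.Ioc U N, n * ‖a n‖ ^ 2 := by
    rw [hT, Finset.mul_sum]
    refine Finset.sum_le_sum fun n _ => ?_
    rw [← Finset.mul_sum, mul_comm]
    gcongr
    exact class_inv_le U N hU _
  have hS : 0 ≤ ∑ n ∈ Finset.Ioc U N, n * ‖a n‖ ^ 2 := Finset.sum_nonneg fun _ _ => by positivity
  calc _ ≤ (Q : ℝ) * ((1 + Real.log N) / Q * ∑ n ∈ Finset.Ioc U N, n * ‖a n‖ ^ 2) := by
        refine mul_le_mul ht (h1.trans h4) ?_ hQ.le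
        exact Finset.sum_nonneg fun _ _ => Finset.sum_nonneg fun _ _ => by positivity
    _ = _ := by field_simp

end

lemma sum_antidiag_le (N : ℕ) (F : ℕ → ℕ → ℝ) (hF : ∀ a b, 0 ≤ F a b) :
    ∑ n ∈ Finset.Icc 1 N, ∑ p ∈ n.divisorsAntidiagonal, F p.1 p.2 ≤ ∑ a ∈ Finset.Icc 1 N, ∑ b ∈ Finset.Icc 1 N, F a b := by
  rw [← Finset.sum_product' (Finset.Icc 1 N) (Finset.Icc 1 N) F]
  have h : ∀ n ∈ Finset.Icc 1 N, ∑ p ∈ n.divisorsAntidiagonal, F p.1 p.2 =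
      ∑ p ∈ ((Finset.Icc 1 N ×ˢ Finset.Icc 1 N).filter (fun p => p.1 * p.2 ∈ Finset.Icc 1 N)).filter (fun p => p.1 * p.2 = n), F p.1 p.2 := by
    intro n hn
    refine Finset.sum_congr ?_ fun _ _ => rfl
    ext ⟨a, b⟩
    simp only [Nat.mem_divisorsAntidiagonal, Finset.mem_filter, Finset.mem_product, Finset.mem_Icc] at hn ⊢
    constructor
    · rintro ⟨rfl, h0⟩
      have ha : 0 < a := Nat.pos_of_ne_zero (by rintro rfl; simp at h0)
      have hb : 0 < b := Nat.pos_of_ne_zero (by rintro rfl; simp at h0)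
      refine ⟨⟨⟨⟨ha, ?_⟩, hb, ?_⟩, hn⟩, rfl⟩ <;> nlinarith [hn.2]
    · rintro ⟨_, rfl⟩
      exact ⟨rfl, by omega⟩
  rw [Finset.sum_congr rfl h, Finset.sum_fiberwise_of_maps_to (g := fun p : ℕ × ℕ => p.1 * p.2) (fun p hp => (Finset.mem_filter.1 hp).2)]
  exact Finset.sum_le_sum_of_subset_of_nonneg (Finset.filter_subset _ _) fun _ _ _ => hF _ _

lemma card_divisors_mul_le (a b : ℕ) : (a * b).divisors.card ≤ a.divisors.card * b.divisors.card := by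
  classical
  rw [Nat.divisors_mul]; exact Finset.card_mul_le

lemma sum_tau_le (N : ℕ) : ∑ n ∈ Finset.Icc 1 N, (n.divisors.card : ℝ) / n ≤ (1 + Real.log N) ^ 2 := by
  have h : ∀ n ∈ Finset.Icc 1 N, (n.divisors.card : ℝ) / n = ∑ p ∈ n.divisorsAntidiagonal, (1 / (p.1 : ℝ)) * (1 / (p.2 : ℝ)) := by
    intro n _
    rw [Finset.sum_congr rfl (g := fun _ => 1 / (n : ℝ)), Finset.sum_const, nsmul_eq_mul]
    · rw [← Nat.map_div_right_divisors, Finset.card_map]; ring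
    · intro p hp
      rw [← (Nat.mem_divisorsAntidiagonal.1 hp).1]; push_cast; rw [one_div_mul_one_div]
  rw [Finset.sum_congr rfl h]
  refine (sum_antidiag_le N (fun a b => (1 / (a : ℝ)) * (1 / (b : ℝ))) fun _ _ => by positivity).trans ?_
  rw [← Finset.sum_mul_sum, sq]
  have := harm_le N
  exact mul_le_mul this this (Finset.sum_nonneg fun _ _ => by positivity) ((Finset.sum_nonneg fun _ _ => by positivity).trans this)

lemma sum_tau_sq_le (N : ℕ) : ∑ n ∈ Finset.Icc 1 N, (n.divisors.card : ℝ) ^ 2 / n ≤ (1 + Real.log N) ^ 4 := by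
  have h : ∀ n ∈ Finset.Icc 1 N, (n.divisors.card : ℝ) ^ 2 / n ≤
      ∑ p ∈ n.divisorsAntidiagonal, ((p.1.divisors.card : ℝ) / p.1) * ((p.2.divisors.card : ℝ) / p.2) := by
    intro n _
    have : (n.divisors.card : ℝ) ^ 2 / n = ∑ p ∈ n.divisorsAntidiagonal, (n.divisors.card : ℝ) / n := by
      rw [Finset.sum_const, nsmul_eq_mul, ← Nat.map_div_right_divisors, Finset.card_map]; ring
    rw [this]
    refine Finset.sum_le_sum fun p hp => ?_
    have e := (Nat.mem_divisorsAntidiagonal.1 hp).1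
    have h2 : (n.divisors.card : ℝ) ≤ p.1.divisors.card * p.2.divisors.card := by
      rw [← e]; exact_mod_cast card_divisors_mul_le _ _
    have e2 : (n : ℝ) = p.1 * p.2 := by rw [← e]; push_cast; rfl
    rw [div_mul_div_comm, e2]
    gcongr
  refine (Finset.sum_le_sum h).trans ?_
  refine (sum_antidiag_le N (fun a b => ((a.divisors.card : ℝ) / a) * ((b.divisors.card : ℝ) / b)) fun _ _ => by positivity).trans ?_
  rw [← Finset.sum_mul_sum]
  have := sum_tau_le N
  calc _ ≤ (1 + Real.log N) ^ 2 * (1 + Real.log N) ^ 2 :=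
        mul_le_mul this this (Finset.sum_nonneg fun _ _ => by positivity) (by positivity)
    _ = _ := by ring

end

section

/-! ### The mean value theorem for characters with good primes sums -/

open ArithmeticFunction in
/-- von Mangoldt restricted to `n ≤ Y` with least prime factor `> V`. -/
noncomputable def hh (V Y n : ℕ) : ℝ := if n ≤ Y ∧ V < n.minFac then vonMangoldt n else 0

open ArithmeticFunction in
/-- von Mangoldt restricted to `n ≤ Y` with least prime factor `≤ V`. -/
noncomputable def gg (V Y n : ℕ) : ℝ := if n ≤ Y ∧ n.minFac ≤ V then vonMangoldt n else 0

open ArithmeticFunction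

lemma hh_nonneg (V Y n : ℕ) : 0 ≤ hh V Y n := by
  unfold hh; split_ifs
  · exact vonMangoldt_nonneg
  · exact le_rfl

lemma gg_nonneg (V Y n : ℕ) : 0 ≤ gg V Y n := by
  unfold gg; split_ifs
  · exact vonMangoldt_nonneg
  · exact le_rfl

lemma hh_add_gg {V Y n : ℕ} (h : n ≤ Y) : hh V Y n + gg V Y n = vonMangoldt n := by
  unfold hh gg
  by_cases h' : V < n.minFac
  · simp [h, h']
  · simp [h, h', not_lt.1 h']

lemma hh_le_log (V Y n : ℕ) : hh V Y n ≤ Real.log n := by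
  unfold hh; split_ifs
  · exact vonMangoldt_le_log
  · exact Real.log_natCast_nonneg n

lemma hh_le (V Y n : ℕ) : hh V Y n ≤ Real.log Y := by
  unfold hh; split_ifs with h
  · refine vonMangoldt_le_log.trans ?_
    rcases Nat.eq_zero_or_pos n with rfl | hn
    · simp; exact Real.log_natCast_nonneg Y
    · exact Real.log_le_log (by exact_mod_cast hn) (by exact_mod_cast h.1)
  · exact Real.log_natCast_nonneg Y

lemma sum_gg_le (V Y : ℕ) : ∑ n ∈ Finset.Icc 1 Y, gg V Y n ≤ V * Real.log Y := by
  classical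
  have h1 : ∑ n ∈ Finset.Icc 1 Y, gg V Y n ≤ ∑ p ∈ Finset.Icc 1 V, ∑ n ∈ (Finset.Icc 1 Y).filter (fun n => n.minFac = p), vonMangoldt n := by
    rw [Finset.sum_comm' (t' := Finset.Icc 1 Y) (s' := fun n => (Finset.Icc 1 V).filter (fun p => n.minFac = p))]
    · refine Finset.sum_le_sum fun n hn => ?_
      unfold gg
      split_ifs with h
      · rw [Finset.sum_const, nsmul_eq_mul]
        have : 1 ≤ ((Finset.Icc 1 V).filter (fun p => n.minFac = p)).card := by
          rw [Nat.succ_le_iff, Finset.card_pos]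
          exact ⟨n.minFac, by simp [h.2, Nat.minFac_pos n, Nat.succ_le_iff]⟩
        have h2 : (1 : ℝ) ≤ ((Finset.Icc 1 V).filter (fun p => n.minFac = p)).card := by exact_mod_cast this
        nlinarith [vonMangoldt_nonneg (n := n)]
      · exact Finset.sum_nonneg fun _ _ => vonMangoldt_nonneg
    · intro p n
      simp only [Finset.mem_filter]
      tauto
  refine h1.trans ?_
  have h2 : ∀ p ∈ Finset.Icc 1 V, ∑ n ∈ (Finset.Icc 1 Y).filter (fun n => n.minFac = p), vonMangoldt n ≤ Real.log Y := by
    intro p hp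
    have hY0 := Real.log_natCast_nonneg Y
    by_cases hpp : p.Prime
    · have h3 : ∑ n ∈ (Finset.Icc 1 Y).filter (fun n => n.minFac = p), vonMangoldt n ≤
          ∑ n ∈ (Finset.Icc 1 (Nat.log p Y)).image (fun k => p ^ k), vonMangoldt n := by
        rw [← Finset.sum_filter_ne_zero]
        refine Finset.sum_le_sum_of_subset_of_nonneg (fun n hn => ?_) fun _ _ _ => vonMangoldt_nonneg
        obtain ⟨hn, h0⟩ := Finset.mem_filter.1 hn
        simp only [Finset.mem_filter, Finset.mem_Icc] at hn
        rw [Finset.mem_image]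
        have := vonMangoldt_ne_zero_iff.1 h0
        obtain ⟨q, k, hq, hk, rfl⟩ := this
        have hq' := hq.nat_prime
        have : (q ^ k).minFac = q := hq'.pow_minFac hk.ne'
        rw [this] at hn
        obtain rfl := hn.2
        refine ⟨k, ?_, rfl⟩
        rw [Finset.mem_Icc]
        exact ⟨hk, Nat.le_log_of_pow_le hq'.one_lt hn.1.2⟩
      refine h3.trans ?_
      calc _ ≤ ∑ k ∈ Finset.Icc 1 (Nat.log p Y), vonMangoldt (p ^ k) := by
            rw [Finset.sum_image]
            exact fun a _ b _ h => Nat.pow_right_injective hpp.two_le h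
        _ ≤ ∑ k ∈ Finset.Icc 1 (Nat.log p Y), Real.log p := by
            refine Finset.sum_le_sum fun k hk => ?_
            rw [vonMangoldt_apply_pow (by have := (Finset.mem_Icc.1 hk).1; omega), vonMangoldt_apply_prime hpp]
        _ = Real.log (p ^ (Nat.log p Y) : ℕ) := by simp
        _ ≤ Real.log Y := by
            rcases Nat.eq_zero_or_pos Y with rfl | hY
            · simp
            · refine Real.log_le_log (by exact_mod_cast Nat.pow_pos hpp.pos) ?_
              exact_mod_cast Nat.pow_log_le_self p hY.ne'
    · rw [Finset.sum_eq_zero]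
      · exact hY0
      · intro n hn
        simp only [Finset.mem_filter, Finset.mem_Icc] at hn
        by_contra h0
        obtain ⟨q, k, hq, hk, rfl⟩ := vonMangoldt_ne_zero_iff.1 h0
        have hq' := hq.nat_prime
        have : (q ^ k).minFac = q := hq'.pow_minFac hk.ne'
        exact hpp (by rw [← hn.2, this]; exact hq')
  calc _ ≤ ∑ p ∈ Finset.Icc 1 V, Real.log Y := Finset.sum_le_sum h2
    _ = _ := by simp

/-- Truncated Dirichlet convolution. -/
noncomputable def dcv (a b : ℕ → ℂ) (n : ℕ) : ℂ := ∑ p ∈ n.divisorsAntidiagonal, a p.1 * b p.2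

section
variable {Q : ℕ}

/-- Dirichlet polynomial. -/
noncomputable def dp (χ : DirichletCharacter ℂ Q) (N : ℕ) (a : ℕ → ℂ) (t : ℝ) : ℂ :=
  ∑ n ∈ Finset.Icc 1 N, a n * χ (n : ZMod Q) * tw t n

/-- Dirichlet polynomial on the 1-line. -/
noncomputable def dp1 (χ : DirichletCharacter ℂ Q) (N : ℕ) (a : ℕ → ℂ) (t : ℝ) : ℂ :=
  ∑ n ∈ Finset.Icc 1 N, a n * χ (n : ZMod Q) / n * tw t n

lemma dp_mul (χ : DirichletCharacter ℂ Q) (N N' : ℕ) (a b : ℕ → ℂ) (ha : ∀ n, N < n → a n = 0) (hb : ∀ n, N' < n → b n = 0) (t : ℝ) :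
    dp χ N a t * dp χ N' b t = dp χ (N * N') (dcv a b) t := by
  classical
  unfold dp dcv
  rw [Finset.sum_mul_sum, ← Finset.sum_product']
  simp_rw [Finset.sum_mul]
  rw [Finset.sum_sigma']
  symm
  apply Finset.sum_bij_ne_zero (i := fun x _ _ => x.2)
  · rintro ⟨n, ⟨x, y⟩⟩ h h0
    simp only [Finset.mem_sigma, Nat.mem_divisorsAntidiagonal, Finset.mem_Icc, Finset.mem_product] at h h0 ⊢
    have hx : x ≤ N := by
      by_contra hx; exact h0 (by rw [ha x (by omega)]; ring)
    have hy : y ≤ N' := by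
      by_contra hy; exact h0 (by rw [hb y (by omega)]; ring)
    obtain ⟨_, h2, h3⟩ := h
    subst h2
    have := Nat.pos_of_ne_zero h3
    exact ⟨⟨Nat.pos_of_mul_pos_right this, hx⟩, ⟨Nat.pos_of_mul_pos_left this, hy⟩⟩
  · rintro ⟨n, ⟨x, y⟩⟩ h h0 ⟨n', ⟨x', y'⟩⟩ h' h0' e
    simp only [Finset.mem_sigma, Nat.mem_divisorsAntidiagonal] at h h' e
    obtain ⟨rfl, rfl⟩ := Prod.mk.inj e
    obtain ⟨_, rfl, _⟩ := h
    obtain ⟨_, rfl, _⟩ := h'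
    rfl
  · rintro ⟨x, y⟩ h h0
    simp only [Finset.mem_product, Finset.mem_Icc] at h
    refine ⟨⟨x * y, (x, y)⟩, ?_, ?_, rfl⟩
    · simp only [Finset.mem_sigma, Nat.mem_divisorsAntidiagonal, Finset.mem_Icc, ne_eq, true_and]
      exact ⟨⟨Nat.mul_pos h.1.1 h.2.1, Nat.mul_le_mul h.1.2 h.2.2⟩, (Nat.mul_pos h.1.1 h.2.1).ne'⟩
    · have : tw t (x * y) = tw t x * tw t y := tw_mul t (by omega) (by omega)
      simp only [this, Nat.cast_mul, map_mul]
      convert h0 using 1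
      ring
  · rintro ⟨n, ⟨x, y⟩⟩ h h0
    simp only [Finset.mem_sigma, Nat.mem_divisorsAntidiagonal] at h
    obtain ⟨_, rfl, h3⟩ := h
    have hx : x ≠ 0 := by rintro rfl; simp at h3
    have hy : y ≠ 0 := by rintro rfl; simp at h3
    have : tw t (x * y) = tw t x * tw t y := tw_mul t hx hy
    simp only [this, Nat.cast_mul, map_mul]
    ring

lemma chi_norm_le (χ : DirichletCharacter ℂ Q) (n : ZMod Q) : ‖χ n‖ ≤ 1 := DirichletCharacter.norm_le_one χ n

/-- TP for a Dirichlet polynomial whose coefficients vanish below `N0`. -/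
lemma dp_TP (χ : DirichletCharacter ℂ Q) (N N0 : ℕ) (h0 : 0 < N0) (a : ℕ → ℂ) (ha : ∀ n, 1 ≤ n → n < N0 → a n = 0) (B : ℝ)
    (hB : ∑ n ∈ Finset.Icc 1 N, ‖a n‖ ≤ B) : TP (dp χ N a) (dp1 χ N a) N0 B := by
  refine TP.of_fintype ((Finset.Icc 1 N).filter (fun n => N0 ≤ n)) h0 (fun n => a n * χ (n : ZMod Q)) (fun n => n) ?_ ?_ ?_ ?_
  · intro i hi; exact (Finset.mem_filter.1 hi).2
  · refine le_trans ?_ hB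
    refine (Finset.sum_le_sum_of_subset_of_nonneg (Finset.filter_subset _ _) fun _ _ _ => norm_nonneg _).trans ?_
    refine Finset.sum_le_sum fun n _ => ?_
    rw [norm_mul]
    exact mul_le_of_le_one_right (norm_nonneg _) (chi_norm_le _ _)
  · intro t
    unfold dp
    rw [Finset.sum_filter_of_ne]
    intro n hn h
    by_contra h'
    exact h (by rw [ha n (Finset.mem_Icc.1 hn).1 (by omega)]; ring)
  · intro t
    unfold dp1
    rw [Finset.sum_filter_of_ne]
    intro n hn h
    by_contra h'
    exact h (by rw [ha n (Finset.mem_Icc.1 hn).1 (by omega)]; ring)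

end

end

section

noncomputable def aL (Y n : ℕ) : ℂ := if n ≤ Y then 1 else 0
noncomputable def aM (U n : ℕ) : ℂ := if n ≤ U then ((ArithmeticFunction.moebius n : ℤ) : ℂ) else 0
noncomputable def aD (Y n : ℕ) : ℂ := if n ≤ Y then (Real.log n : ℂ) else 0
noncomputable def aH (V Y n : ℕ) : ℂ := (hh V Y n : ℂ)
noncomputable def aG (V Y n : ℕ) : ℂ := (gg V Y n : ℂ)
noncomputable def aC (U Y n : ℕ) : ℂ := dcv (aL Y) (aM U) n - if n = 1 then 1 else 0
noncomputable def aA (Y n : ℕ) : ℂ := if n ≤ Y then (ArithmeticFunction.vonMangoldt n : ℂ) else 0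
noncomputable def aP (Y n : ℕ) : ℂ := dcv (aA Y) (aL Y) n - aD Y n

lemma aH_add_aG (V Y n : ℕ) : aH V Y n + aG V Y n = aA Y n := by
  unfold aH aG aA
  split_ifs with h
  · rw [← hh_add_gg (V := V) h]; push_cast; rfl
  · unfold hh gg; simp [h]

lemma aC_zero {U Y n : ℕ} (hUY : U ≤ Y) (hn : n ≤ U) : aC U Y n = 0 := by
  unfold aC dcv
  have h := ArithmeticFunction.coe_moebius_mul_coe_zeta (R := ℂ)
  have h2 := congrArg (fun f => f n) h
  simp only [ArithmeticFunction.one_apply] at h2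
  rw [mul_comm, ArithmeticFunction.mul_apply] at h2
  rw [← h2, sub_eq_zero]
  refine Finset.sum_congr rfl fun p hp => ?_
  have hp' := Nat.mem_divisorsAntidiagonal.1 hp
  have h1 : p.1 ≤ n := Nat.le_of_dvd (Nat.pos_of_ne_zero hp'.2) ⟨p.2, hp'.1.symm⟩
  have h3 : p.2 ≤ n := Nat.le_of_dvd (Nat.pos_of_ne_zero hp'.2) ⟨p.1, by rw [mul_comm]; exact hp'.1.symm⟩
  have h4 : p.1 ≠ 0 := fun h => hp'.2 (by rw [← hp'.1, h, zero_mul])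
  unfold aL aM
  rw [if_pos (by omega), if_pos (by omega)]
  simp [ArithmeticFunction.natCoe_apply, ArithmeticFunction.zeta_apply, h4, ArithmeticFunction.intCoe_apply]

lemma norm_aL_le (Y n : ℕ) : ‖aL Y n‖ ≤ 1 := by unfold aL; split_ifs <;> simp
lemma norm_aM_le (U n : ℕ) : ‖aM U n‖ ≤ 1 := by
  unfold aM; split_ifs
  · rw [Complex.norm_intCast]
    exact_mod_cast ArithmeticFunction.abs_moebius_le_one
  · simp

lemma norm_aC_le {U Y : ℕ} (hU : 1 ≤ U) (hUY : U ≤ Y) (n : ℕ) : ‖aC U Y n‖ ≤ n.divisors.card := by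
  by_cases hn : n ≤ U
  · rw [aC_zero hUY hn]; simp
  · unfold aC dcv
    rw [if_neg (by omega), sub_zero]
    refine (norm_sum_le _ _).trans ?_
    calc _ ≤ ∑ p ∈ n.divisorsAntidiagonal, (1 : ℝ) := by
          refine Finset.sum_le_sum fun p _ => ?_
          rw [norm_mul]
          exact mul_le_one₀ (norm_aL_le _ _) (norm_nonneg _) (norm_aM_le _ _)
      _ = _ := by rw [← Nat.map_div_right_divisors, Finset.sum_const, Finset.card_map]; simp

lemma aP_zero {Y n : ℕ} (hn : n ≤ Y) : aP Y n = 0 := by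
  unfold aP dcv
  have h2 := congrArg (fun f => f n) ArithmeticFunction.vonMangoldt_mul_zeta
  simp only [ArithmeticFunction.mul_apply, ArithmeticFunction.log_apply] at h2
  unfold aD
  rw [if_pos hn, ← h2, sub_eq_zero]
  push_cast
  refine Finset.sum_congr rfl fun p hp => ?_
  have hp' := Nat.mem_divisorsAntidiagonal.1 hp
  have h1 : p.1 ≤ n := Nat.le_of_dvd (Nat.pos_of_ne_zero hp'.2) ⟨p.2, hp'.1.symm⟩
  have h3 : p.2 ≤ n := Nat.le_of_dvd (Nat.pos_of_ne_zero hp'.2) ⟨p.1, by rw [mul_comm]; exact hp'.1.symm⟩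
  have h4 : p.2 ≠ 0 := fun h => hp'.2 (by rw [← hp'.1, h, mul_zero])
  unfold aL aA
  rw [if_pos (by omega), if_pos (by omega)]
  simp [ArithmeticFunction.natCoe_apply, ArithmeticFunction.zeta_apply, h4]

lemma norm_aP_le (Y n : ℕ) : ‖aP Y n‖ ≤ Real.log n := by
  by_cases hn : n ≤ Y
  · rw [aP_zero hn]; simp [Real.log_natCast_nonneg]
  · unfold aP dcv aD
    rw [if_neg hn, sub_zero]
    refine (norm_sum_le _ _).trans ?_
    have h2 := congrArg (fun f => f n) ArithmeticFunction.vonMangoldt_mul_zeta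
    simp only [ArithmeticFunction.mul_apply, ArithmeticFunction.log_apply] at h2
    rw [← h2]
    refine Finset.sum_le_sum fun p hp => ?_
    have hp' := Nat.mem_divisorsAntidiagonal.1 hp
    have h4 : p.2 ≠ 0 := fun h => hp'.2 (by rw [← hp'.1, h, mul_zero])
    rw [norm_mul]
    have e : (((ArithmeticFunction.zeta : ArithmeticFunction ℕ) : ArithmeticFunction ℝ) p.2) = 1 := by
      simp [ArithmeticFunction.natCoe_apply, ArithmeticFunction.zeta_apply, h4]
    rw [e, mul_one]
    have : ‖aA Y p.1‖ ≤ ArithmeticFunction.vonMangoldt p.1 := by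
      unfold aA; split_ifs
      · rw [Complex.norm_real, Real.norm_of_nonneg ArithmeticFunction.vonMangoldt_nonneg]
      · simp [ArithmeticFunction.vonMangoldt_nonneg]
    nlinarith [norm_aL_le Y p.2, norm_nonneg (aA Y p.1), norm_nonneg (aL Y p.2)]

section
variable {Q : ℕ}

lemma dp_C (χ : DirichletCharacter ℂ Q) {U Y : ℕ} (hU : 1 ≤ U) (hY : 1 ≤ Y) (t : ℝ) :
    dp χ Y (aL Y) t * dp χ U (aM U) t - 1 = dp χ (Y * U) (aC U Y) t := by
  rw [dp_mul _ _ _ _ _ (fun n h => by simp [aL, h]) (fun n h => by simp [aM, h])]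
  unfold dp aC
  simp_rw [sub_mul, Finset.sum_sub_distrib]
  congr 1
  rw [Finset.sum_eq_single 1]
  · simp [tw_one]
  · intro b _ hb; simp [hb]
  · intro h; exfalso; apply h; rw [Finset.mem_Icc]; exact ⟨le_rfl, Nat.mul_pos hY hU⟩

lemma dp_P (χ : DirichletCharacter ℂ Q) {V Y : ℕ} (t : ℝ) :
    (dp χ Y (aH V Y) t + dp χ Y (aG V Y) t) * dp χ Y (aL Y) t - dp χ Y (aD Y) t = dp χ (Y * Y) (aP Y) t := by
  have h1 : dp χ Y (aH V Y) t + dp χ Y (aG V Y) t = dp χ Y (aA Y) t := by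
    unfold dp
    rw [← Finset.sum_add_distrib]
    refine Finset.sum_congr rfl fun n _ => ?_
    rw [← aH_add_aG V]; ring
  rw [h1, dp_mul _ _ _ _ _ (fun n h => by simp [aA, h]) (fun n h => by simp [aL, h])]
  unfold dp aP
  simp_rw [sub_mul, Finset.sum_sub_distrib]
  congr 1
  refine Finset.sum_subset_zero_on_sdiff ?_ ?_ fun _ _ => rfl
  · intro n hn
    simp only [Finset.mem_Icc] at hn ⊢
    exact ⟨hn.1, hn.2.trans (Nat.le_mul_self Y)⟩
  · intro n hn
    simp only [Finset.mem_sdiff, Finset.mem_Icc, not_and, not_le] at hn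
    simp [aD, hn.2 hn.1.1]

/-- ls for C on the 1-line. -/
lemma sum_C1_le [NeZero Q] (s : Finset (DirichletCharacter ℂ Q)) {U Y : ℕ} (hQU : Q ≤ U) (hUY : U ≤ Y) (t : ℝ) :
    ∑ χ ∈ s, ‖dp1 χ (Y * U) (aC U Y) t‖ ^ 2 ≤ (1 + Real.log (Y * U : ℕ)) ^ 5 := by
  have hU : 1 ≤ U := (NeZero.one_le (n := Q)).trans hQU
  have e : ∀ χ : DirichletCharacter ℂ Q, dp1 χ (Y * U) (aC U Y) t = ∑ n ∈ Finset.Ioc U (Y * U), (aC U Y n / n * tw t n) * χ (n : ZMod Q) := by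
    intro χ
    unfold dp1
    symm
    refine Finset.sum_subset_zero_on_sdiff ?_ ?_ fun _ _ => by ring
    · intro n hn
      simp only [Finset.mem_Icc, Finset.mem_Ioc] at hn ⊢
      omega
    · intro n hn
      simp only [Finset.mem_sdiff, Finset.mem_Icc, Finset.mem_Ioc, not_and, not_le] at hn
      have : n ≤ U := by by_contra h; have := hn.2 (by omega); omega
      rw [aC_zero hUY this]; simp
  simp_rw [e]
  refine (ls_C s U (Y * U) hQU _).trans ?_
  have hL : 0 ≤ 1 + Real.log (Y * U : ℕ) := by have := Real.log_natCast_nonneg (Y * U); linarith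
  rw [pow_succ', ]
  refine mul_le_mul_of_nonneg_left ?_ hL
  refine le_trans ?_ (sum_tau_sq_le (Y * U))
  calc _ ≤ ∑ n ∈ Finset.Ioc U (Y * U), (n.divisors.card : ℝ) ^ 2 / n := by
        refine Finset.sum_le_sum fun n hn => ?_
        have hn0 : 0 < n := by have := (Finset.mem_Ioc.1 hn).1; omega
        have hn' : (0 : ℝ) < n := by exact_mod_cast hn0
        rw [norm_mul, norm_tw, mul_one, norm_div, Complex.norm_natCast, div_pow]
        have := norm_aC_le hU hUY n
        rw [show (n : ℝ) * (‖aC U Y n‖ ^ 2 / (n : ℝ) ^ 2) = ‖aC U Y n‖ ^ 2 / n by field_simp]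
        gcongr
    _ ≤ _ := by
        refine Finset.sum_le_sum_of_subset_of_nonneg ?_ fun _ _ _ => by positivity
        intro n hn
        simp only [Finset.mem_Icc, Finset.mem_Ioc] at hn ⊢
        omega

end

end

section

section
variable {Q : ℕ}

lemma two_add_sq_le (t L : ℝ) (hL : 1 ≤ L) : (2 + |t| * L) ^ 2 ≤ 8 * L ^ 2 * Real.exp (t ^ 2 / 4) := by
  have h1 := Real.add_one_le_exp (t ^ 2 / 4)
  have h2 : 2 + |t| * L ≤ (2 + |t|) * L := by nlinarith [abs_nonneg t]
  have h3 : (2 + |t|) ^ 2 ≤ 8 * Real.exp (t ^ 2 / 4) := by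
    have := sq_abs t
    nlinarith [sq_nonneg (2 - |t|)]
  calc _ ≤ ((2 + |t|) * L) ^ 2 := by gcongr
    _ = (2 + |t|) ^ 2 * L ^ 2 := by ring
    _ ≤ 8 * Real.exp (t ^ 2 / 4) * L ^ 2 := by gcongr
    _ = _ := by ring

/-- Pólya–Vinogradov constant. -/
noncomputable def PV (Q : ℕ) : ℝ := Real.sqrt Q * Q.divisors.card * (1 + Real.log Q)

lemma one_le_PV (hQ : 0 < Q) : 1 ≤ PV Q := by
  have h1 : 1 ≤ Real.sqrt Q := by rw [Real.one_le_sqrt]; exact_mod_cast hQ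
  have h2 : (1 : ℝ) ≤ Q.divisors.card := by
    have : 0 < Q.divisors.card := Finset.card_pos.2 ⟨1, by simp; omega⟩
    exact_mod_cast this
  have h3 : 1 ≤ 1 + Real.log Q := by have := Real.log_natCast_nonneg Q; linarith
  unfold PV
  exact one_le_mul_of_one_le_of_one_le (one_le_mul_of_one_le_of_one_le h1 h2) h3

lemma sum_norm_aH (V Y : ℕ) : ∑ n ∈ Finset.Icc 1 Y, ‖aH V Y n‖ ≤ Y * Real.log Y := by
  calc _ ≤ ∑ n ∈ Finset.Icc 1 Y, Real.log Y := by
        refine Finset.sum_le_sum fun n _ => ?_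
        unfold aH
        rw [Complex.norm_real, Real.norm_of_nonneg (hh_nonneg _ _ _)]
        exact hh_le _ _ _
    _ = _ := by simp

lemma norm_H1_le (χ : DirichletCharacter ℂ Q) (V Y : ℕ) (t : ℝ) : ‖dp1 χ Y (aH V Y) t‖ ≤ (1 + Real.log Y) ^ 2 := by
  have h0 := Real.log_natCast_nonneg Y
  unfold dp1
  refine (norm_sum_le _ _).trans ?_
  calc _ ≤ ∑ n ∈ Finset.Icc 1 Y, Real.log Y * (1 / (n : ℝ)) := by
        refine Finset.sum_le_sum fun n _ => ?_
        unfold aH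
        rw [norm_mul, norm_tw, mul_one, norm_div, norm_mul, Complex.norm_real, Real.norm_of_nonneg (hh_nonneg _ _ _), Complex.norm_natCast, ← div_eq_mul_one_div]
        have := chi_norm_le χ (n : ZMod Q)
        have h2 := hh_le V Y n
        have h3 := hh_nonneg V Y n
        gcongr
        nlinarith [norm_nonneg (χ (n : ZMod Q))]
    _ = Real.log Y * ∑ n ∈ Finset.Icc 1 Y, 1 / (n : ℝ) := by rw [Finset.mul_sum]
    _ ≤ Real.log Y * (1 + Real.log Y) := by
        gcongr; exact harm_le Y
    _ ≤ _ := by nlinarith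

/-- The first error. -/
noncomputable def Err (Q U V Y : ℕ) (y T τ : ℝ) : ℝ :=
  2 * (40 * (U : ℝ) ^ 2 * PV Q ^ 2 * (1 + V) * Real.log Y * (1 + Real.log Y) ^ 2)
   + Q * (6 * (Y : ℝ) ^ 3 * (U : ℝ) ^ 2 * Real.log Y * Real.exp (-(y ^ 2) / 2))
   + Real.exp (y + 1 / 2) * (2 * ((1 + Real.log (Y * U : ℕ)) ^ 5 * (1 / T + (1 + Real.log Y) ^ 2 * Real.exp (-(τ ^ 2) / 4))))

theorem AN [NeZero Q] (U V Y : ℕ) (hQU : Q ≤ U) (hUY : U ≤ Y) (s : Finset (DirichletCharacter ℂ Q))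
    (hs : ∀ χ ∈ s, χ ≠ 1) (y T τ : ℝ) (hy0 : 0 ≤ y) (hy : 2 * y ≤ Real.log Y) (hT : 0 < T) (hτ : 0 ≤ τ)
    (hgood : ∀ χ ∈ s, ∀ t : ℝ, |t| ≤ τ → ‖dp1 χ Y (aH V Y) t‖ ≤ 1 / T) :
    ∑ χ ∈ s, ‖∑ n ∈ Finset.Icc 1 Y, (hh V Y n : ℂ) * χ (n : ZMod Q) * gv y n‖ ≤ Err Q U V Y y T τ := by
  have hQ : 0 < Q := NeZero.pos Q
  have hU : 1 ≤ U := (NeZero.one_le (n := Q)).trans hQU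
  have hY : 1 ≤ Y := hU.trans hUY
  have hU' : (1 : ℝ) ≤ U := by exact_mod_cast hU
  have hY' : (1 : ℝ) ≤ Y := by exact_mod_cast hY
  have hlY := Real.log_natCast_nonneg Y
  set LY := 1 + Real.log Y with hLY
  have hLY1 : 1 ≤ LY := by linarith
  set P := PV Q with hP
  have hP1 : 1 ≤ P := one_le_PV hQ
  set E : DirichletCharacter ℂ Q → ℝ → ℂ := fun χ t => dp χ Y (aD Y) t + (-1) * (dp χ Y (aG V Y) t * dp χ Y (aL Y) t) with hE
  set K : DirichletCharacter ℂ Q → ℝ → ℂ := fun χ t => 2 * dp χ U (aM U) t + (-1) * (dp χ Y (aL Y) t * (dp χ U (aM U) t * dp χ U (aM U) t)) with hK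
  have TL : ∀ χ : DirichletCharacter ℂ Q, TP (dp χ Y (aL Y)) (dp1 χ Y (aL Y)) 1 Y := by
    intro χ
    refine dp_TP χ Y 1 one_pos _ (fun n h1 h2 => by omega) _ ?_
    refine (Finset.sum_le_sum fun n _ => norm_aL_le Y n).trans ?_
    simp
  have TM : ∀ χ : DirichletCharacter ℂ Q, TP (dp χ U (aM U)) (dp1 χ U (aM U)) 1 U := by
    intro χ
    refine dp_TP χ U 1 one_pos _ (fun n h1 h2 => by omega) _ ?_
    refine (Finset.sum_le_sum fun n _ => norm_aM_le U n).trans ?_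
    simp
  have TD : ∀ χ : DirichletCharacter ℂ Q, TP (dp χ Y (aD Y)) (dp1 χ Y (aD Y)) 1 (∑ n ∈ Finset.Icc 1 Y, ‖aD Y n‖) := by
    intro χ
    exact dp_TP χ Y 1 one_pos _ (fun n h1 h2 => by omega) _ le_rfl
  have TG : ∀ χ : DirichletCharacter ℂ Q, TP (dp χ Y (aG V Y)) (dp1 χ Y (aG V Y)) 1 (∑ n ∈ Finset.Icc 1 Y, ‖aG V Y n‖) := by
    intro χ
    exact dp_TP χ Y 1 one_pos _ (fun n h1 h2 => by omega) _ le_rfl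
  have TH : ∀ χ : DirichletCharacter ℂ Q, TP (dp χ Y (aH V Y)) (dp1 χ Y (aH V Y)) 1 (Y * Real.log Y) := by
    intro χ
    exact dp_TP χ Y 1 one_pos _ (fun n h1 h2 => by omega) _ (sum_norm_aH V Y)
  have TPP : ∀ χ : DirichletCharacter ℂ Q, TP (dp χ (Y * Y) (aP Y)) (dp1 χ (Y * Y) (aP Y)) Y (Y ^ 2 * (2 * Real.log Y)) := by
    intro χ
    refine dp_TP χ (Y * Y) Y hY _ (fun n h1 h2 => aP_zero h2.le) _ ?_
    calc _ ≤ ∑ n ∈ Finset.Icc 1 (Y * Y), 2 * Real.log Y := by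
          refine Finset.sum_le_sum fun n hn => (norm_aP_le Y n).trans ?_
          rw [Finset.mem_Icc] at hn
          have : Real.log (Y * Y : ℕ) = 2 * Real.log Y := by
            rw [Nat.cast_mul, Real.log_mul (by positivity) (by positivity)]; ring
          rw [← this]
          exact Real.log_le_log (by exact_mod_cast hn.1) (by exact_mod_cast hn.2)
      _ = _ := by rw [Finset.sum_const, nsmul_eq_mul]; simp only [Nat.card_Icc]; push_cast; simp; left; ring
  have TC : ∀ χ : DirichletCharacter ℂ Q, TP (dp χ (Y * U) (aC U Y)) (dp1 χ (Y * U) (aC U Y)) 1 (∑ n ∈ Finset.Icc 1 (Y * U), ‖aC U Y n‖) := by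
    intro χ
    exact dp_TP χ _ 1 one_pos _ (fun n h1 h2 => by omega) _ le_rfl
  have TK := fun χ => (((TM χ).const_mul 2).add (((TL χ).mul ((TM χ).mul (TM χ))).const_mul (-1)))
  have TE := fun χ => ((TD χ).add (((TG χ).mul (TL χ)).const_mul (-1)))
  have TEK := fun χ => (TE χ).mul (TK χ)
  have TPK := fun χ => (TPP χ).mul (TK χ)
  have THC := fun χ => (TH χ).mul ((TC χ).mul (TC χ))
  -- identity
  have hid : ∀ χ ∈ s, ∑ n ∈ Finset.Icc 1 Y, (hh V Y n : ℂ) * χ (n : ZMod Q) * gv y n =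
      gI y (fun t => E χ t * K χ t) + gI y (fun t => dp χ (Y * Y) (aP Y) t * K χ t) +
      gI y (fun t => dp χ Y (aH V Y) t * (dp χ (Y * U) (aC U Y) t * dp χ (Y * U) (aC U Y) t)) := by
    intro χ _
    have h1 := gI_finset_sum (Finset.Icc 1 Y) (fun n => (hh V Y n : ℂ) * χ (n : ZMod Q)) (fun n => n) y
    rw [← h1, ← (TEK χ).gI_add (TPK χ), ← ((TEK χ).add ((TPK χ).mono (by norm_num) (by omega) le_rfl)).gI_add (THC χ)]
    congr 1
    ext t
    have hC := dp_C χ hU hY t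
    have hPP := dp_P χ (V := V) (Y := Y) t
    rw [← hC, ← hPP]
    have : (∑ n ∈ Finset.Icc 1 Y, (hh V Y n : ℂ) * χ (n : ZMod Q) * tw t n) = dp χ Y (aH V Y) t := rfl
    rw [this]
    ring
  have hcard : (s.card : ℝ) ≤ Q := by
    have h1 : s.card ≤ Fintype.card (DirichletCharacter ℂ Q) := Finset.card_le_univ s
    have h2 : Fintype.card (DirichletCharacter ℂ Q) = Q.totient := by
      rw [← Nat.card_eq_fintype_card]
      exact DirichletCharacter.card_eq_totient_of_hasEnoughRootsOfUnity ℂ Q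
    rw [h2] at h1
    exact_mod_cast h1.trans (Nat.totient_le Q)
  have bL : ∀ χ ∈ s, ∀ t, ‖dp χ Y (aL Y) t‖ ≤ P * (2 + |t| * LY) := by
    intro χ hχ t
    have := L_bound (fun n => χ (n : ZMod Q)) P (pv χ (hs χ hχ)) Y hY t
    refine le_trans (le_of_eq ?_) this
    unfold dp aL
    congr 1
    refine Finset.sum_congr rfl fun n hn => ?_
    rw [if_pos (Finset.mem_Icc.1 hn).2, one_mul]
  have bD : ∀ χ ∈ s, ∀ t, ‖dp χ Y (aD Y) t‖ ≤ P * (Real.log Y * (2 + |t| * LY)) := by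
    intro χ hχ t
    have := D_bound (fun n => χ (n : ZMod Q)) P (pv χ (hs χ hχ)) Y hY t
    refine le_trans (le_of_eq ?_) this
    unfold dp aD
    congr 1
    refine Finset.sum_congr rfl fun n hn => ?_
    rw [if_pos (Finset.mem_Icc.1 hn).2]; ring
  have bG : ∀ χ ∈ s, ∀ t, ‖dp χ Y (aG V Y) t‖ ≤ V * Real.log Y := by
    intro χ hχ t
    refine le_trans ?_ (sum_gg_le V Y)
    unfold dp aG
    refine (norm_sum_le _ _).trans (Finset.sum_le_sum fun n _ => ?_)
    rw [norm_mul, norm_tw, mul_one, norm_mul, Complex.norm_real, Real.norm_of_nonneg (gg_nonneg _ _ _)]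
    exact mul_le_of_le_one_right (gg_nonneg _ _ _) (chi_norm_le _ _)
  have bM : ∀ t, ∑ χ ∈ s, ‖dp χ U (aM U) t‖ ^ 2 ≤ 2 * (U : ℝ) ^ 2 := by
    intro t
    have := ls_M s U hQU (fun n => aM U n * tw t n) (fun n => by
      rw [norm_mul, norm_tw, mul_one]; exact norm_aM_le U n)
    refine le_trans (le_of_eq ?_) this
    refine Finset.sum_congr rfl fun χ _ => ?_
    unfold dp
    congr 2
    exact Finset.sum_congr rfl fun n _ => by ring
  have b1 : ∑ χ ∈ s, ‖gI y (fun t => E χ t * K χ t)‖ ≤ 2 * (40 * (U : ℝ) ^ 2 * P ^ 2 * (1 + V) * Real.log Y * LY ^ 2) := by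
    refine sep_bound s (fun χ t => E χ t * K χ t) _ y _ (fun χ _ => TEK χ) fun t => ?_
    set w := 2 + |t| * LY with hw
    have hw1 : 1 ≤ w := by have : 0 ≤ |t| * LY := by positivity
                           linarith
    have hPw : 1 ≤ P * w := one_le_mul_of_one_le_of_one_le hP1 hw1
    have hbE : ∀ χ ∈ s, ‖E χ t‖ ≤ (1 + V) * Real.log Y * (P * w) := by
      intro χ hχ
      have h1 := bL χ hχ t
      have h2 := bD χ hχ t
      have h3 := bG χ hχ t
      calc ‖E χ t‖ ≤ ‖dp χ Y (aD Y) t‖ + ‖(-1) * (dp χ Y (aG V Y) t * dp χ Y (aL Y) t)‖ := norm_add_le _ _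
        _ = ‖dp χ Y (aD Y) t‖ + ‖dp χ Y (aG V Y) t‖ * ‖dp χ Y (aL Y) t‖ := by simp
        _ ≤ P * (Real.log Y * w) + V * Real.log Y * (P * w) := by gcongr
        _ = _ := by ring
    have hbK : ∀ χ ∈ s, ‖K χ t‖ ≤ 1 + ‖dp χ U (aM U) t‖ ^ 2 + (P * w) * ‖dp χ U (aM U) t‖ ^ 2 := by
      intro χ hχ
      have h1 := bL χ hχ t
      calc ‖K χ t‖ ≤ ‖2 * dp χ U (aM U) t‖ + ‖(-1) * (dp χ Y (aL Y) t * (dp χ U (aM U) t * dp χ U (aM U) t))‖ := norm_add_le _ _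
        _ = 2 * ‖dp χ U (aM U) t‖ + ‖dp χ Y (aL Y) t‖ * ‖dp χ U (aM U) t‖ ^ 2 := by simp only [norm_mul, norm_neg, norm_one, one_mul, Complex.norm_ofNat]; ring
        _ ≤ (1 + ‖dp χ U (aM U) t‖ ^ 2) + (P * w) * ‖dp χ U (aM U) t‖ ^ 2 := by
            gcongr
            nlinarith [sq_nonneg (1 - ‖dp χ U (aM U) t‖)]
    have hsK : ∑ χ ∈ s, ‖K χ t‖ ≤ (P * w) * (5 * (U : ℝ) ^ 2) := by
      refine (Finset.sum_le_sum hbK).trans ?_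
      rw [Finset.sum_add_distrib, Finset.sum_add_distrib, ← Finset.mul_sum, Finset.sum_const, nsmul_eq_mul, mul_one]
      have h1 := bM t
      have h2 : (Q : ℝ) ≤ U := by exact_mod_cast hQU
      have h3 : (U : ℝ) ≤ (U : ℝ) ^ 2 := by nlinarith
      set z := ∑ χ ∈ s, ‖dp χ U (aM U) t‖ ^ 2
      have h4 : (P * w) * z ≤ (P * w) * (2 * (U : ℝ) ^ 2) := by gcongr
      have h5 : 3 * (U : ℝ) ^ 2 ≤ (P * w) * (3 * (U : ℝ) ^ 2) := le_mul_of_one_le_left (by positivity) hPw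
      linarith
    calc _ = ∑ χ ∈ s, ‖E χ t‖ * ‖K χ t‖ := by simp_rw [norm_mul]
      _ ≤ ∑ χ ∈ s, (1 + V) * Real.log Y * (P * w) * ‖K χ t‖ :=
          Finset.sum_le_sum fun χ hχ => mul_le_mul_of_nonneg_right (hbE χ hχ) (norm_nonneg _)
      _ = (1 + V) * Real.log Y * (P * w) * ∑ χ ∈ s, ‖K χ t‖ := by rw [Finset.mul_sum]
      _ ≤ (1 + V) * Real.log Y * (P * w) * ((P * w) * (5 * (U : ℝ) ^ 2)) := by gcongr
      _ = 5 * (U : ℝ) ^ 2 * P ^ 2 * (1 + V) * Real.log Y * w ^ 2 := by ring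
      _ ≤ 5 * (U : ℝ) ^ 2 * P ^ 2 * (1 + V) * Real.log Y * (8 * LY ^ 2 * Real.exp (t ^ 2 / 4)) := by
          have := two_add_sq_le t LY hLY1
          gcongr
      _ = _ := by ring
  have b2 : ∀ χ ∈ s, ‖gI y (fun t => dp χ (Y * Y) (aP Y) t * K χ t)‖ ≤ 6 * (Y : ℝ) ^ 3 * (U : ℝ) ^ 2 * Real.log Y * Real.exp (-(y ^ 2) / 2) := by
    intro χ _
    refine ((TPK χ).norm_gI_le y (v := Real.exp (-(y ^ 2) / 2)) ?_).trans ?_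
    · intro n hn
      unfold gv
      have h1 : Real.log Y ≤ Real.log n := Real.log_le_log (by positivity) (by exact_mod_cast (by omega : Y ≤ n))
      rw [Real.exp_le_exp]
      nlinarith
    · refine mul_le_mul_of_nonneg_right ?_ (Real.exp_pos _).le
      have h1 : ‖(2 : ℂ)‖ * U + ‖(-1 : ℂ)‖ * (Y * (U * U)) ≤ 3 * Y * (U : ℝ) ^ 2 := by
        simp
        have : (U : ℝ) ≤ Y * U ^ 2 := by nlinarith [mul_le_mul hY' hU' zero_le_one (by positivity : (0 : ℝ) ≤ Y)]
        nlinarith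
      calc _ ≤ (Y : ℝ) ^ 2 * (2 * Real.log Y) * (3 * Y * (U : ℝ) ^ 2) := by gcongr
        _ = _ := by ring
  have b3 : ∑ χ ∈ s, ‖gI y (fun t => dp χ Y (aH V Y) t * (dp χ (Y * U) (aC U Y) t * dp χ (Y * U) (aC U Y) t))‖ ≤
     Real.exp (y + 1 / 2) * (2 * ((1 + Real.log (Y * U : ℕ)) ^ 5 * (1 / T + LY ^ 2 * Real.exp (-(τ ^ 2) / 4)))) := by
    have h1 : ∀ χ ∈ s, ‖gI y (fun t => dp χ Y (aH V Y) t * (dp χ (Y * U) (aC U Y) t * dp χ (Y * U) (aC U Y) t))‖ =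
        Real.exp (y + 1 / 2) * ‖gI (y + 1) (fun t => dp1 χ Y (aH V Y) t * (dp1 χ (Y * U) (aC U Y) t * dp1 χ (Y * U) (aC U Y) t))‖ := by
      intro χ _
      rw [(THC χ).gI_shift y, norm_mul, Complex.norm_real, Real.norm_of_nonneg (Real.exp_pos _).le]
    rw [Finset.sum_congr rfl h1, ← Finset.mul_sum]
    refine mul_le_mul_of_nonneg_left ?_ (Real.exp_pos _).le
    have TP1 : ∀ (χ : DirichletCharacter ℂ Q) (N : ℕ) (a : ℕ → ℂ), TP (dp1 χ N a) (dp1 χ N (fun n => a n / n)) 1 (∑ n ∈ Finset.Icc 1 N, ‖a n / n‖) := by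
      intro χ N a
      have e : dp1 χ N a = dp χ N (fun n => a n / n) := by
        ext t; unfold dp dp1; exact Finset.sum_congr rfl fun n _ => by ring
      rw [e]
      exact dp_TP χ _ 1 one_pos _ (fun n h1 h2 => by omega) _ le_rfl
    refine sep_bound s (fun χ t => dp1 χ Y (aH V Y) t * (dp1 χ (Y * U) (aC U Y) t * dp1 χ (Y * U) (aC U Y) t)) _ (y + 1) _
      (fun χ _ => (TP1 χ _ _).mul ((TP1 χ _ _).mul (TP1 χ _ _))) fun t => ?_
    have hb : ∀ χ ∈ s, ‖dp1 χ Y (aH V Y) t‖ ≤ (1 / T + LY ^ 2 * Real.exp (-(τ ^ 2) / 4)) * Real.exp (t ^ 2 / 4) := by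
      intro χ hχ
      have e1 : 1 ≤ Real.exp (t ^ 2 / 4) := Real.one_le_exp (by positivity)
      have hT' : 0 < 1 / T := by positivity
      by_cases ht : |t| ≤ τ
      · refine (hgood χ hχ t ht).trans ?_
        have : 0 ≤ LY ^ 2 * Real.exp (-(τ ^ 2) / 4) := by positivity
        nlinarith
      · refine (norm_H1_le χ V Y t).trans ?_
        have e2 : 1 ≤ Real.exp (-(τ ^ 2) / 4) * Real.exp (t ^ 2 / 4) := by
          rw [← Real.exp_add]
          apply Real.one_le_exp
          have : τ ^ 2 ≤ t ^ 2 := by rw [← sq_abs t]; push Not at ht; gcongr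
          linarith
        have : LY ^ 2 ≤ LY ^ 2 * (Real.exp (-(τ ^ 2) / 4) * Real.exp (t ^ 2 / 4)) := le_mul_of_one_le_right (by positivity) e2
        have : 0 ≤ 1 / T * Real.exp (t ^ 2 / 4) := by positivity
        linarith
    set Z := (1 / T + LY ^ 2 * Real.exp (-(τ ^ 2) / 4)) with hZ
    calc _ = ∑ χ ∈ s, ‖dp1 χ Y (aH V Y) t‖ * ‖dp1 χ (Y * U) (aC U Y) t‖ ^ 2 := by
          simp_rw [norm_mul]; exact Finset.sum_congr rfl fun _ _ => by ring
      _ ≤ ∑ χ ∈ s, Z * Real.exp (t ^ 2 / 4) * ‖dp1 χ (Y * U) (aC U Y) t‖ ^ 2 :=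
          Finset.sum_le_sum fun χ hχ => mul_le_mul_of_nonneg_right (hb χ hχ) (by positivity)
      _ = Z * Real.exp (t ^ 2 / 4) * ∑ χ ∈ s, ‖dp1 χ (Y * U) (aC U Y) t‖ ^ 2 := by rw [Finset.mul_sum]
      _ ≤ Z * Real.exp (t ^ 2 / 4) * (1 + Real.log (Y * U : ℕ)) ^ 5 := by
          refine mul_le_mul_of_nonneg_left (sum_C1_le s hQU hUY t) ?_
          positivity
      _ = _ := by ring
  calc _ ≤ ∑ χ ∈ s, (‖gI y (fun t => E χ t * K χ t)‖ + ‖gI y (fun t => dp χ (Y * Y) (aP Y) t * K χ t)‖ +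
      ‖gI y (fun t => dp χ Y (aH V Y) t * (dp χ (Y * U) (aC U Y) t * dp χ (Y * U) (aC U Y) t))‖) := by
        refine Finset.sum_le_sum fun χ hχ => ?_
        rw [hid χ hχ]
        exact norm_add₃_le
    _ ≤ _ := by
        rw [Finset.sum_add_distrib, Finset.sum_add_distrib]
        unfold Err
        gcongr
        refine (Finset.sum_le_sum b2).trans ?_
        rw [Finset.sum_const, nsmul_eq_mul]
        gcongr

end

end

section

/-! ### Duality: few bad characters -/

lemma tw_mul_conj (t t' : ℝ) (n : ℕ) : tw t n * (starRingEnd ℂ) (tw t' n) = tw (t - t') n := by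
  unfold tw
  rw [← Complex.exp_conj, ← Complex.exp_add]
  congr 1
  simp only [map_mul, Complex.conj_I, Complex.conj_ofReal]
  push_cast; ring

lemma dual_core {ι : Type*} [DecidableEq ι] (s : Finset ι) (f : ι → ℕ → ℂ) (t : ι → ℝ) (b : ℕ → ℂ) (A B : ℕ) (hA : 1 ≤ A) (δ W K L : ℝ)
    (hδ0 : 0 ≤ δ) (hK0 : 0 ≤ K)
    (hδ : ∀ i ∈ s, δ ≤ ‖∑ n ∈ Finset.Icc A B, b n / n * f i n * tw (t i) n‖)
    (hW : ∑ n ∈ Finset.Icc A B, ‖b n‖ ^ 2 / n ≤ W)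
    (hL : ∀ i ∈ s, ‖∑ n ∈ Finset.Icc A B, f i n * (starRingEnd ℂ) (f i n) * (tw (t i - t i) n / n)‖ ≤ L)
    (hK : ∀ i ∈ s, ∀ j ∈ s, i ≠ j → ‖∑ n ∈ Finset.Icc A B, f i n * (starRingEnd ℂ) (f j n) * (tw (t i - t j) n / n)‖ ≤ K) :
    ((s.card : ℝ) * δ) ^ 2 ≤ W * (s.card * L + (s.card : ℝ) ^ 2 * K) := by
  set S : ι → ℂ := fun i => ∑ n ∈ Finset.Icc A B, b n / n * f i n * tw (t i) n with hS
  set ε : ι → ℂ := fun i => (starRingEnd ℂ) (S i) / ‖S i‖ with hε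
  have hε1 : ∀ i, ‖ε i‖ ≤ 1 := by
    intro i; simp only [hε, norm_div, RCLike.norm_conj, Complex.norm_real, norm_norm]; exact div_self_le_one _
  have hεS : ∀ i, ε i * S i = ‖S i‖ := by
    intro i
    simp only [hε]
    by_cases h : S i = 0
    · simp [h]
    · have : (‖S i‖ : ℂ) ≠ 0 := by simpa using h
      field_simp
      rw [mul_comm, Complex.mul_conj, Complex.normSq_eq_norm_sq]; push_cast; rfl
  set G : ℕ → ℂ := fun n => ∑ i ∈ s, ε i * f i n * tw (t i) n with hG
  have h1 : (s.card : ℝ) * δ ≤ ∑ n ∈ Finset.Icc A B, (‖b n‖ / Real.sqrt n) * (‖G n‖ / Real.sqrt n) := by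
    calc (s.card : ℝ) * δ ≤ ∑ i ∈ s, ‖S i‖ := by
          rw [← nsmul_eq_mul, ← Finset.sum_const]; exact Finset.sum_le_sum hδ
      _ = ‖((∑ i ∈ s, ‖S i‖ : ℝ) : ℂ)‖ := by
          rw [Complex.norm_real, Real.norm_of_nonneg (Finset.sum_nonneg fun _ _ => norm_nonneg _)]
      _ = ‖∑ n ∈ Finset.Icc A B, b n / n * G n‖ := by
          congr 1
          push_cast
          simp_rw [← hεS]
          simp only [hS, hG]
          simp_rw [Finset.mul_sum]
          rw [Finset.sum_comm]
          exact Finset.sum_congr rfl fun n _ => Finset.sum_congr rfl fun i _ => by ring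
      _ ≤ ∑ n ∈ Finset.Icc A B, ‖b n / n * G n‖ := norm_sum_le _ _
      _ = _ := by
          refine Finset.sum_congr rfl fun n hn => ?_
          have hn0 : (0 : ℝ) < n := by
            have := (Finset.mem_Icc.1 hn).1
            exact_mod_cast (by omega : 0 < n)
          rw [norm_mul, norm_div, Complex.norm_natCast, div_mul_div_comm, Real.mul_self_sqrt hn0.le]; ring
  have h2 : ∑ n ∈ Finset.Icc A B, (‖G n‖ / Real.sqrt n) ^ 2 ≤ s.card * L + (s.card : ℝ) ^ 2 * K := by
    have e : ((∑ n ∈ Finset.Icc A B, (‖G n‖ / Real.sqrt n) ^ 2 : ℝ) : ℂ) =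
       ∑ i ∈ s, ∑ j ∈ s, ε i * (starRingEnd ℂ) (ε j) * ∑ n ∈ Finset.Icc A B, f i n * (starRingEnd ℂ) (f j n) * (tw (t i - t j) n / n) := by
      push_cast
      simp_rw [Finset.mul_sum]
      rw [Finset.sum_congr rfl (fun i _ => Finset.sum_comm), Finset.sum_comm]
      refine Finset.sum_congr rfl fun n _ => ?_
      rw [div_pow, ← Complex.ofReal_pow, ← Complex.ofReal_pow, Real.sq_sqrt (by positivity), ← Complex.normSq_eq_norm_sq, ← Complex.mul_conj]
      simp only [hG, map_sum, map_mul]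
      rw [Finset.sum_mul_sum, Finset.sum_div]
      refine Finset.sum_congr rfl fun i _ => ?_
      rw [Finset.sum_div]
      refine Finset.sum_congr rfl fun j _ => ?_
      rw [← tw_mul_conj]
      push_cast; ring
    have h0 : 0 ≤ ∑ n ∈ Finset.Icc A B, (‖G n‖ / Real.sqrt n) ^ 2 := Finset.sum_nonneg fun _ _ => by positivity
    rw [← Real.norm_of_nonneg h0, ← Complex.norm_real, e]
    refine (norm_sum_le _ _).trans ?_
    have h3 : ∀ i ∈ s, ‖∑ j ∈ s, ε i * (starRingEnd ℂ) (ε j) * ∑ n ∈ Finset.Icc A B, f i n * (starRingEnd ℂ) (f j n) * (tw (t i - t j) n / n)‖ ≤ L + s.card * K := by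
      intro i hi
      refine (norm_sum_le _ _).trans ?_
      have h4 : ∀ j ∈ s, ‖ε i * (starRingEnd ℂ) (ε j) * ∑ n ∈ Finset.Icc A B, f i n * (starRingEnd ℂ) (f j n) * (tw (t i - t j) n / n)‖ ≤ (if i = j then L else 0) + K := by
        intro j hj
        have h5 : ‖ε i * (starRingEnd ℂ) (ε j)‖ ≤ 1 := by
          rw [norm_mul, RCLike.norm_conj]
          exact mul_le_one₀ (hε1 i) (norm_nonneg _) (hε1 j)
        rw [norm_mul]
        refine (mul_le_of_le_one_left (norm_nonneg _) h5).trans ?_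
        split_ifs with hij
        · subst hij; have := hL i hi; linarith
        · have := hK i hi j hj hij; linarith
      refine (Finset.sum_le_sum h4).trans ?_
      rw [Finset.sum_add_distrib, Finset.sum_ite_eq, if_pos hi, Finset.sum_const, nsmul_eq_mul]
    refine (Finset.sum_le_sum h3).trans ?_
    rw [Finset.sum_const, nsmul_eq_mul]
    exact le_of_eq (by ring)
  have h3 : ∑ n ∈ Finset.Icc A B, (‖b n‖ / Real.sqrt n) ^ 2 ≤ W := by
    refine le_trans (le_of_eq (Finset.sum_congr rfl fun n _ => ?_)) hW
    rw [div_pow, Real.sq_sqrt (by positivity)]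
  have h0 : 0 ≤ ∑ n ∈ Finset.Icc A B, (‖b n‖ / Real.sqrt n) ^ 2 := Finset.sum_nonneg fun _ _ => by positivity
  have h0' : 0 ≤ ∑ n ∈ Finset.Icc A B, (‖G n‖ / Real.sqrt n) ^ 2 := Finset.sum_nonneg fun _ _ => by positivity
  calc ((s.card : ℝ) * δ) ^ 2 ≤ (∑ n ∈ Finset.Icc A B, (‖b n‖ / Real.sqrt n) * (‖G n‖ / Real.sqrt n)) ^ 2 := by
        gcongr
    _ ≤ _ := Finset.sum_mul_sq_le_sq_mul_sq _ _ _
    _ ≤ _ := mul_le_mul h3 h2 h0' (h0.trans h3)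

/-- The `k`-th convolution power of `aH`. -/
noncomputable def bH (V Y : ℕ) : ℕ → ℕ → ℂ
  | 0 => fun n => if n = 1 then 1 else 0
  | k + 1 => dcv (aH V Y) (bH V Y k)

lemma norm_aH (V Y n : ℕ) : ‖aH V Y n‖ = hh V Y n := by
  unfold aH; rw [Complex.norm_real, Real.norm_of_nonneg (hh_nonneg _ _ _)]

lemma bH_bound (V Y k n : ℕ) (hn : n ≠ 0) : ‖bH V Y k n‖ ≤ Real.log n ^ k := by
  induction k generalizing n with
  | zero => simp only [bH]; split_ifs <;> simp
  | succ k ih =>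
    simp only [bH, dcv]
    have hl : 0 ≤ Real.log n := Real.log_natCast_nonneg n
    refine (norm_sum_le _ _).trans ?_
    have h2 := congrArg (fun f => f n) ArithmeticFunction.vonMangoldt_mul_zeta
    simp only [ArithmeticFunction.mul_apply, ArithmeticFunction.log_apply] at h2
    calc _ ≤ ∑ p ∈ n.divisorsAntidiagonal, ArithmeticFunction.vonMangoldt p.1 * (((ArithmeticFunction.zeta : ArithmeticFunction ℕ) : ArithmeticFunction ℝ) p.2) * Real.log n ^ k := by
          refine Finset.sum_le_sum fun p hp => ?_
          have hp' := Nat.mem_divisorsAntidiagonal.1 hp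
          have h4 : p.2 ≠ 0 := fun h => hp'.2 (by rw [← hp'.1, h, mul_zero])
          have h3 : p.2 ≤ n := Nat.le_of_dvd (Nat.pos_of_ne_zero hp'.2) ⟨p.1, by rw [mul_comm]; exact hp'.1.symm⟩
          have e : (((ArithmeticFunction.zeta : ArithmeticFunction ℕ) : ArithmeticFunction ℝ) p.2) = 1 := by
            simp [ArithmeticFunction.natCoe_apply, ArithmeticFunction.zeta_apply, h4]
          rw [e, mul_one, norm_mul, norm_aH]
          have h5 : hh V Y p.1 ≤ ArithmeticFunction.vonMangoldt p.1 := by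
            unfold hh; split_ifs
            · exact le_rfl
            · exact ArithmeticFunction.vonMangoldt_nonneg
          have h6 : ‖bH V Y k p.2‖ ≤ Real.log n ^ k := by
            refine (ih p.2 h4).trans ?_
            have : Real.log p.2 ≤ Real.log n := Real.log_le_log (by positivity) (by exact_mod_cast h3)
            have := Real.log_natCast_nonneg p.2
            gcongr
          exact mul_le_mul h5 h6 (norm_nonneg _) ArithmeticFunction.vonMangoldt_nonneg
      _ = _ := by rw [← Finset.sum_mul, h2]; ring

lemma hh_supp {V Y n : ℕ} (h : hh V Y n ≠ 0) : V < n ∧ n ≤ Y ∧ V < n.minFac := by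
  unfold hh at h
  split_ifs at h with h1
  · refine ⟨lt_of_lt_of_le h1.2 (Nat.minFac_le ?_), h1⟩
    rcases Nat.eq_zero_or_pos n with rfl | hn
    · simp at h
    · exact hn
  · exact absurd rfl h

lemma bH_supp {V Y k n : ℕ} (h : bH V Y k n ≠ 0) : V ^ k ≤ n ∧ n ≤ Y ^ k := by
  induction k generalizing n with
  | zero => simp only [bH] at h; split_ifs at h with h1
            · subst h1; simp
            · simp at h
  | succ k ih =>
    simp only [bH, dcv] at h
    obtain ⟨p, hp, hp0⟩ := Finset.exists_ne_zero_of_sum_ne_zero h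
    have h1 := left_ne_zero_of_mul hp0
    have h2 := ih (right_ne_zero_of_mul hp0)
    have h3 : hh V Y p.1 ≠ 0 := by intro h; apply h1; simp [aH, h]
    have h4 := hh_supp h3
    rw [← (Nat.mem_divisorsAntidiagonal.1 hp).1]
    rw [pow_succ', pow_succ']
    exact ⟨Nat.mul_le_mul h4.1.le h2.1, Nat.mul_le_mul h4.2.1 h2.2⟩

lemma dp1_eq {Q : ℕ} (χ : DirichletCharacter ℂ Q) (N : ℕ) (a : ℕ → ℂ) (t : ℝ) : dp1 χ N a t = dp χ N (fun n => a n / n) t := by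
  unfold dp dp1; exact Finset.sum_congr rfl fun n _ => by ring

lemma dcv_div (a b : ℕ → ℂ) (n : ℕ) : dcv (fun n => a n / n) (fun n => b n / n) n = dcv a b n / n := by
  unfold dcv
  rw [Finset.sum_div]
  refine Finset.sum_congr rfl fun p hp => ?_
  rw [div_mul_div_comm, ← Nat.cast_mul, (Nat.mem_divisorsAntidiagonal.1 hp).1]

lemma dp1_pow {Q : ℕ} (χ : DirichletCharacter ℂ Q) (V Y k : ℕ) (t : ℝ) :
    dp1 χ Y (aH V Y) t ^ k = dp1 χ (Y ^ k) (bH V Y k) t := by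
  induction k with
  | zero => simp [dp1, bH, tw_one]
  | succ k ih =>
    rw [pow_succ', ih, dp1_eq, dp1_eq, dp_mul, dp1_eq]
    · rw [pow_succ']
      unfold dp
      refine Finset.sum_congr rfl fun n _ => ?_
      rw [dcv_div]; rfl
    · intro n hn
      have : hh V Y n = 0 := by by_contra h; have := (hh_supp h).2.1; omega
      simp [aH, this]
    · intro n hn
      have : bH V Y k n = 0 := by by_contra h; have := (bH_supp h).2; omega
      simp [this]

end

section

/-- Bad primitive characters. -/
def BadSet (V Y Qm : ℕ) (T τ : ℝ) : Set (Σ d : ℕ, DirichletCharacter ℂ d) :=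
  {x | 0 < x.1 ∧ x.1 ≤ Qm ∧ x.2.IsPrimitive ∧ ∃ t : ℝ, |t| ≤ τ ∧ 1 / T < ‖dp1 x.2 Y (aH V Y) t‖}

lemma PV_le (Q : ℕ) (hQ : 0 < Q) : PV Q ≤ (Q : ℝ) ^ 3 := by
  have hQ' : (1 : ℝ) ≤ Q := by exact_mod_cast hQ
  have h1 : Real.sqrt Q ≤ Q := by rw [Real.sqrt_le_left (by positivity)]; nlinarith
  have h2 : (Q.divisors.card : ℝ) ≤ Q := by exact_mod_cast Nat.card_divisors_le_self Q
  have h3 : 1 + Real.log Q ≤ Q := by have := Real.log_le_sub_one_of_pos (by positivity : (0 : ℝ) < Q); linarith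
  have h4 : 0 ≤ 1 + Real.log Q := by have := Real.log_natCast_nonneg Q; linarith
  unfold PV
  calc _ ≤ (Q : ℝ) * Q * Q := by gcongr
    _ = _ := by ring

open DirichletCharacter in
lemma orth_primitive (x x' : Σ d : ℕ, DirichletCharacter ℂ d) (hne : x ≠ x') (h0 : 0 < x.1) (h0' : 0 < x'.1)
    (hp : x.2.IsPrimitive) (hp' : x'.2.IsPrimitive) (N : ℕ) :
    ‖∑ n ∈ Finset.range N, x.2 (n : ZMod x.1) * (starRingEnd ℂ) (x'.2 (n : ZMod x'.1))‖ ≤ PV (x.1 * x'.1) := by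
  obtain ⟨d, ψ⟩ := x
  obtain ⟨d', ψ'⟩ := x'
  simp only at *
  haveI : NeZero (d * d') := ⟨(Nat.mul_pos h0 h0').ne'⟩
  haveI : NeZero d := ⟨h0.ne'⟩
  haveI : NeZero d' := ⟨h0'.ne'⟩
  have hd : d ∣ d * d' := Nat.dvd_mul_right _ _
  have hd' : d' ∣ d * d' := Nat.dvd_mul_left _ _
  set θ : DirichletCharacter ℂ (d * d') := changeLevel hd ψ * (changeLevel hd' ψ')⁻¹ with hθ
  have hθ1 : θ ≠ 1 := by
    intro h
    rw [hθ, mul_inv_eq_one] at h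
    have hc := congrArg conductor h
    rw [conductor_changeLevel, conductor_changeLevel, hp, hp'] at hc
    subst hc
    exact hne (by rw [changeLevel_injective hd h])
  have := pv θ hθ1 N
  refine le_trans (le_of_eq ?_) this
  congr 1
  refine Finset.sum_congr rfl fun n _ => ?_
  by_cases hn : IsUnit ((n : ℕ) : ZMod (d * d'))
  · have h1 : changeLevel hd ψ (n : ZMod (d * d')) = ψ n := by
      have := changeLevel_eq_cast_of_dvd ψ hd hn.unit
      simpa [ZMod.cast_natCast hd] using this
    have h2 : changeLevel hd' ψ' (n : ZMod (d * d')) = ψ' n := by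
      have := changeLevel_eq_cast_of_dvd ψ' hd' hn.unit
      simpa [ZMod.cast_natCast hd'] using this
    rw [hθ, MulChar.mul_apply, h1, ← MulChar.star_eq_inv, MulChar.star_apply, h2]; rfl
  · rw [MulChar.map_nonunit θ hn]
    have hc : ¬ (Nat.Coprime n d ∧ Nat.Coprime n d') := by
      rw [← Nat.coprime_mul_iff_right, ← ZMod.isUnit_iff_coprime]; exact hn
    by_cases hnd : Nat.Coprime n d
    · have : ¬ IsUnit ((n : ℕ) : ZMod d') := by rw [ZMod.isUnit_iff_coprime]; exact fun h => hc ⟨hnd, h⟩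
      rw [MulChar.map_nonunit ψ' this]; simp
    · have : ¬ IsUnit ((n : ℕ) : ZMod d) := by rw [ZMod.isUnit_iff_coprime]; exact hnd
      rw [MulChar.map_nonunit ψ this]; simp

/-- Bound for the number of bad characters. -/
noncomputable def RB (Y g : ℕ) (T : ℝ) : ℝ := 2 * ((g * Real.log Y) ^ (2 * g) * (1 + g * Real.log Y)) * (1 + g * Real.log Y) * T ^ (2 * g)

theorem bad_card (V Y Qm g : ℕ) (T τ : ℝ) (hV : 1 ≤ V) (hVY : V ≤ Y) (hT : 0 < T) (hτ : 0 ≤ τ)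
    (hcond : 2 * ((g * Real.log Y) ^ (2 * g) * (1 + g * Real.log Y)) * ((Qm : ℝ) ^ 6 * (3 + 2 * τ) / (V : ℝ) ^ g) ≤ ((1 / T) ^ g) ^ 2)
    (s : Finset (Σ d : ℕ, DirichletCharacter ℂ d)) (hs : ∀ x ∈ s, x ∈ BadSet V Y Qm T τ) :
    (s.card : ℝ) ≤ RB Y g T := by
  classical
  have hlY := Real.log_natCast_nonneg Y
  have hYg : Real.log (Y ^ g : ℕ) = g * Real.log Y := by push_cast; rw [Real.log_pow]
  have hch : ∀ x : Σ d : ℕ, DirichletCharacter ℂ d, ∃ t : ℝ, x ∈ s → (|t| ≤ τ ∧ 1 / T < ‖dp1 x.2 Y (aH V Y) t‖) := by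
    intro x
    by_cases hx : x ∈ s
    · obtain ⟨t, ht⟩ := (hs x hx).2.2.2
      exact ⟨t, fun _ => ht⟩
    · exact ⟨0, fun h => absurd h hx⟩
  choose t ht using hch
  set L := 1 + g * Real.log Y with hL
  set W := (g * Real.log Y) ^ (2 * g) * L with hW
  set K := (Qm : ℝ) ^ 6 * (3 + 2 * τ) / (V : ℝ) ^ g with hK
  set δ := (1 / T) ^ g with hδ
  have hδ0 : 0 < δ := by positivity
  have hVg : 1 ≤ V ^ g := Nat.one_le_pow _ _ hV
  have hharm : ∑ n ∈ Finset.Icc (V ^ g) (Y ^ g), (1 : ℝ) / n ≤ L := by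
    rw [hL, ← hYg]
    refine le_trans ?_ (harm_le _)
    refine Finset.sum_le_sum_of_subset_of_nonneg ?_ fun _ _ _ => by positivity
    exact Finset.Icc_subset_Icc_left hVg
  have hK0 : 0 ≤ K := by positivity
  have key := dual_core s (fun x n => x.2 (n : ZMod x.1)) t (bH V Y g) (V ^ g) (Y ^ g) hVg δ W K L hδ0.le hK0 ?_ ?_ ?_ ?_
  · rcases s.eq_empty_or_nonempty with rfl | hne
    · simp [RB]; positivity
    · have hpos : (0 : ℝ) < s.card := by exact_mod_cast hne.card_pos
      have h1 : 2 * W * K ≤ δ ^ 2 := hcond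
      set R := (s.card : ℝ)
      have h2 : R * (R * δ ^ 2) ≤ R * (2 * W * L) := by
        have : R ^ 2 * (2 * W * K) ≤ R ^ 2 * δ ^ 2 := by gcongr
        nlinarith
      have h3 : R * δ ^ 2 ≤ 2 * W * L := le_of_mul_le_mul_left h2 hpos
      have h4 : δ ^ 2 * T ^ (2 * g) = 1 := by
        rw [hδ, ← pow_mul, mul_comm g 2, ← mul_pow, one_div, inv_mul_cancel₀ hT.ne', one_pow]
      calc R = R * δ ^ 2 * T ^ (2 * g) := by rw [mul_assoc, h4, mul_one]
        _ ≤ 2 * W * L * T ^ (2 * g) := by gcongr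
        _ = RB Y g T := rfl
  · intro x hx
    have h := ht x hx
    have h1 : δ ≤ ‖dp1 x.2 Y (aH V Y) (t x) ^ g‖ := by
      rw [norm_pow]; exact pow_le_pow_left₀ (by positivity) h.2.le _
    rw [dp1_pow] at h1
    refine h1.trans (le_of_eq ?_)
    unfold dp1
    congr 1
    symm
    refine Finset.sum_subset_zero_on_sdiff (Finset.Icc_subset_Icc_left hVg) ?_ fun _ _ => by ring
    intro n hn
    simp only [Finset.mem_sdiff, Finset.mem_Icc, not_and, not_le] at hn
    have : bH V Y g n = 0 := by
      by_contra h0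
      have := bH_supp h0
      have := hn.2 this.1
      omega
    simp [this]
  · calc _ ≤ ∑ n ∈ Finset.Icc (V ^ g) (Y ^ g), (g * Real.log Y) ^ (2 * g) * (1 / (n : ℝ)) := by
          refine Finset.sum_le_sum fun n hn => ?_
          rw [Finset.mem_Icc] at hn
          have hn0 : 0 < n := by omega
          have h1 := bH_bound V Y g n hn0.ne'
          have h2 : Real.log n ≤ g * Real.log Y := by
            rw [← hYg]; exact Real.log_le_log (by exact_mod_cast hn0) (by exact_mod_cast hn.2)
          have h3 := Real.log_natCast_nonneg n
          rw [div_eq_mul_one_div, mul_comm 2 g, pow_mul]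
          gcongr
          exact h1.trans (by gcongr)
      _ ≤ W := by
          rw [← Finset.mul_sum, hW]
          gcongr
  · intro x hx
    refine (norm_sum_le _ _).trans (le_trans ?_ hharm)
    refine Finset.sum_le_sum fun n _ => ?_
    rw [norm_mul, norm_mul, norm_div, norm_tw, RCLike.norm_conj, Complex.norm_natCast]
    refine mul_le_of_le_one_left (by positivity) ?_
    exact mul_le_one₀ (chi_norm_le _ _) (norm_nonneg _) (chi_norm_le _ _)
  · intro x hx x' hx' hne
    have hb := hs x hx
    have hb' := hs x' hx'
    have h1 := one_bound (fun n => x.2 (n : ZMod x.1) * (starRingEnd ℂ) (x'.2 (n : ZMod x'.1))) _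
      (orth_primitive x x' hne hb.1 hb'.1 hb.2.2.1 hb'.2.2.1) (V ^ g) (Y ^ g) hVg (Nat.pow_le_pow_left hVY g) (t x - t x')
    refine h1.trans ?_
    have h2 : PV (x.1 * x'.1) ≤ (Qm : ℝ) ^ 6 := by
      refine (PV_le _ (Nat.mul_pos hb.1 hb'.1)).trans ?_
      have : ((x.1 * x'.1 : ℕ) : ℝ) ≤ (Qm : ℝ) ^ 2 := by
        have := Nat.mul_le_mul hb.2.1 hb'.2.1
        rw [sq]; exact_mod_cast this
      calc _ ≤ ((Qm : ℝ) ^ 2) ^ 3 := by gcongr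
        _ = _ := by ring
    have h3 : |t x - t x'| ≤ 2 * τ := by
      have := abs_sub (t x) (t x'); have := (ht x hx).1; have := (ht x' hx').1; linarith
    rw [hK, mul_div_assoc]
    push_cast
    gcongr

lemma bad_finite {V Y Qm : ℕ} {T τ : ℝ} : (BadSet V Y Qm T τ).Finite := by
  have : (⋃ d ∈ Finset.Icc 1 Qm, Set.range (fun ψ : DirichletCharacter ℂ d => (⟨d, ψ⟩ : Σ d : ℕ, DirichletCharacter ℂ d))).Finite := by
    refine Set.Finite.biUnion (Finset.finite_toSet _) fun d hd => ?_
    haveI : NeZero d := ⟨by have := (Finset.mem_Icc.1 hd).1; omega⟩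
    exact Set.finite_range _
  refine this.subset fun x hx => ?_
  simp only [Set.mem_iUnion]
  exact ⟨x.1, Finset.mem_Icc.2 ⟨hx.1, hx.2.1⟩, x.2, rfl⟩

end

section

section
open DirichletCharacter
variable {Q : ℕ}

lemma changeLevel_nat {M : ℕ} (hM : M ∣ Q) (ψ : DirichletCharacter ℂ M) (n : ℕ) (hn : Nat.Coprime n Q) :
    changeLevel hM ψ (n : ZMod Q) = ψ (n : ZMod M) := by
  have := changeLevel_eq_cast_of_dvd' ψ hM (a := (n : ℤ)) (Nat.isCoprime_iff_coprime.2 hn)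
  simpa using this

lemma prim_nat (χ : DirichletCharacter ℂ Q) (n : ℕ) (hn : Nat.Coprime n Q) :
    χ.primitiveCharacter (n : ZMod χ.conductor) = χ (n : ZMod Q) := by
  have := primitiveCharacter_apply_of_isCoprime χ (a := (n : ℤ)) (Nat.isCoprime_iff_coprime.2 hn)
  simpa using this

lemma hh_coprime {V Y n : ℕ} (hV : ∀ p, p.Prime → p ∣ Q → p ≤ V) (h : hh V Y n ≠ 0) : Nat.Coprime n Q := by
  have h1 := (hh_supp h).2.2
  rw [Nat.coprime_iff_gcd_eq_one]
  by_contra h2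
  obtain ⟨p, hp, hpd⟩ := Nat.exists_prime_and_dvd h2
  have := hV p hp (hpd.trans (Nat.gcd_dvd_right _ _))
  have := Nat.minFac_le_of_dvd hp.two_le (hpd.trans (Nat.gcd_dvd_left n Q))
  omega

lemma dp1_prim {V Y : ℕ} (hV : ∀ p, p.Prime → p ∣ Q → p ≤ V) (χ : DirichletCharacter ℂ Q) (t : ℝ) :
    dp1 χ.primitiveCharacter Y (aH V Y) t = dp1 χ Y (aH V Y) t := by
  unfold dp1
  refine Finset.sum_congr rfl fun n _ => ?_
  by_cases h : hh V Y n = 0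
  · simp [aH, h]
  · rw [prim_nat χ n (hh_coprime hV h)]

lemma sum_hh_gv_le (V Y : ℕ) (y : ℝ) : ∑ n ∈ Finset.Icc 1 Y, hh V Y n * gv y n ≤ Real.exp (y + 1 / 2) * (1 + Real.log Y) ^ 2 := by
  have h0 := Real.log_natCast_nonneg Y
  calc _ ≤ ∑ n ∈ Finset.Icc 1 Y, Real.log Y * Real.exp (y + 1 / 2) * (1 / (n : ℝ)) := by
        refine Finset.sum_le_sum fun n hn => ?_
        have hn0 : n ≠ 0 := by have := (Finset.mem_Icc.1 hn).1; omega
        rw [gv_shift y hn0]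
        have h1 := gv_le_one (y + 1) n
        have h2 := gv_pos (y + 1) n
        have h3 := hh_le V Y n
        have h4 := hh_nonneg V Y n
        calc _ ≤ Real.log Y * (Real.exp (y + 1 / 2) / n * 1) := by gcongr
          _ = _ := by ring
    _ = Real.log Y * Real.exp (y + 1 / 2) * ∑ n ∈ Finset.Icc 1 Y, (1 / (n : ℝ)) := by rw [Finset.mul_sum]
    _ ≤ Real.log Y * Real.exp (y + 1 / 2) * (1 + Real.log Y) := by gcongr; exact harm_le Y
    _ ≤ _ := by
        have := Real.exp_pos (y + 1 / 2)
        have h5 : Real.log Y * (1 + Real.log Y) ≤ (1 + Real.log Y) ^ 2 := by nlinarith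
        calc _ = Real.exp (y + 1 / 2) * (Real.log Y * (1 + Real.log Y)) := by ring
          _ ≤ _ := by gcongr

/-- weight attached to the multipliers -/
noncomputable def SS {w : ℕ} (k : Fin w → ℕ) (χ : DirichletCharacter ℂ Q) : ℂ := ∏ i, ((1 + χ (k i : ZMod Q)) / 2)

noncomputable def Psi (V Y : ℕ) (y : ℝ) (χ : DirichletCharacter ℂ Q) : ℂ :=
  ∑ n ∈ Finset.Icc 1 Y, (hh V Y n : ℂ) * χ (n : ZMod Q) * gv y n

lemma norm_Psi_le (V Y : ℕ) (y : ℝ) (χ : DirichletCharacter ℂ Q) : ‖Psi V Y y χ‖ ≤ Real.exp (y + 1 / 2) * (1 + Real.log Y) ^ 2 := by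
  refine le_trans ?_ (sum_hh_gv_le V Y y)
  unfold Psi
  refine (norm_sum_le _ _).trans (Finset.sum_le_sum fun n _ => ?_)
  rw [norm_mul, norm_mul, Complex.norm_real, Complex.norm_real, Real.norm_of_nonneg (hh_nonneg _ _ _), Real.norm_of_nonneg (gv_pos _ _).le]
  exact mul_le_mul_of_nonneg_right (mul_le_of_le_one_right (hh_nonneg _ _ _) (chi_norm_le _ _)) (gv_pos _ _).le

lemma SS_expand {w : ℕ} (k : Fin w → ℕ) (χ : DirichletCharacter ℂ Q) :
    SS k χ = (1 / 2 ^ w) * ∑ J : Finset (Fin w), χ ((∏ i ∈ J, k i : ℕ) : ZMod Q) := by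
  unfold SS
  rw [Finset.prod_div_distrib, Finset.prod_one_add, Finset.powerset_univ]
  simp only [Finset.prod_const, Finset.card_univ, Fintype.card_fin]
  rw [div_eq_mul_one_div, mul_comm]
  congr 1
  refine Finset.sum_congr rfl fun J _ => ?_
  push_cast
  rw [map_prod]

/-- orthogonality -/
lemma orth_SS [NeZero Q] {w : ℕ} (k : Fin w → ℕ) (V Y : ℕ) (y : ℝ) (c : ℕ) (hc : Nat.Coprime c Q) :
    ∑ χ : DirichletCharacter ℂ Q, χ (c : ZMod Q)⁻¹ * SS k χ * Psi V Y y χ =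
      ((Q.totient / 2 ^ w * ∑ J : Finset (Fin w), ∑ n ∈ (Finset.Icc 1 Y).filter (fun n : ℕ => (c : ZMod Q) = (((∏ i ∈ J, k i) * n : ℕ) : ZMod Q)),
        hh V Y n * gv y n : ℝ) : ℂ) := by
  have hu : IsUnit (c : ZMod Q) := (ZMod.isUnit_iff_coprime c Q).2 hc
  push_cast
  simp_rw [SS_expand, Psi]
  have e : ∀ χ : DirichletCharacter ℂ Q, χ (c : ZMod Q)⁻¹ * (1 / 2 ^ w * ∑ J : Finset (Fin w), χ ((∏ i ∈ J, k i : ℕ) : ZMod Q)) *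
      (∑ n ∈ Finset.Icc 1 Y, (hh V Y n : ℂ) * χ (n : ZMod Q) * gv y n) =
      ∑ J : Finset (Fin w), ∑ n ∈ Finset.Icc 1 Y, 1 / 2 ^ w * (hh V Y n : ℂ) * gv y n * (χ (c : ZMod Q)⁻¹ * χ (((∏ i ∈ J, k i) * n : ℕ) : ZMod Q)) := by
    intro χ
    rw [mul_assoc, mul_assoc, Finset.sum_mul_sum, Finset.mul_sum, Finset.mul_sum]
    refine Finset.sum_congr rfl fun J _ => ?_
    rw [Finset.mul_sum, Finset.mul_sum]
    refine Finset.sum_congr rfl fun n _ => ?_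
    rw [Nat.cast_mul, map_mul]; ring
  simp_rw [e]
  rw [Finset.sum_comm, Finset.mul_sum]
  refine Finset.sum_congr rfl fun J _ => ?_
  rw [Finset.sum_comm, Finset.mul_sum, Finset.sum_filter]
  refine Finset.sum_congr rfl fun n _ => ?_
  rw [← Finset.mul_sum, sum_char_inv_mul_char_eq ℂ hu]
  push_cast
  split_ifs
  · ring
  · ring

/-- Main term: characters coming from `M`. -/
lemma main_M [NeZero Q] {M : ℕ} [NeZero M] (hM : M ∣ Q) {w : ℕ} (k : Fin w → ℕ) (hk : ∀ i, (k i : ZMod M) = 1) (hkQ : ∀ i, Nat.Coprime (k i) Q)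
    (V Y : ℕ) (hV : ∀ p, p.Prime → p ∣ Q → p ≤ V) (y : ℝ) (c e : ℕ) (hc : Nat.Coprime c Q) (hce : (c : ZMod M) = e) :
    ∑ ψ : DirichletCharacter ℂ M, (changeLevel hM ψ) (c : ZMod Q)⁻¹ * SS k (changeLevel hM ψ) * Psi V Y y (changeLevel hM ψ) =
     ((M.totient * ∑ n ∈ (Finset.Icc 1 Y).filter (fun n : ℕ => (e : ZMod M) = (n : ZMod M)), hh V Y n * gv y n : ℝ) : ℂ) := by
  have hu : IsUnit (c : ZMod Q) := (ZMod.isUnit_iff_coprime c Q).2 hc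
  have heM : IsUnit (e : ZMod M) := by
    rw [← hce]; exact (ZMod.isUnit_iff_coprime c M).2 (hc.coprime_dvd_right hM)
  set ci : ℕ := ((c : ZMod Q)⁻¹).val with hci
  have hciQ : (ci : ZMod Q) = (c : ZMod Q)⁻¹ := ZMod.natCast_zmod_val _
  have hcc : ((ci * c : ℕ) : ZMod Q) = 1 := by
    rw [Nat.cast_mul, hciQ]; exact ZMod.inv_mul_of_unit _ hu
  have hccM : ((ci * c : ℕ) : ZMod M) = 1 := by
    have := congrArg (ZMod.castHom hM (ZMod M)) hcc
    rw [map_natCast, map_one] at this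
    exact this
  have hcic : Nat.Coprime ci Q := by
    rw [← ZMod.isUnit_iff_coprime]
    rw [Nat.cast_mul] at hcc
    exact IsUnit.of_mul_eq_one _ hcc
  have hciM : (ci : ZMod M) = (e : ZMod M)⁻¹ := by
    rw [Nat.cast_mul, hce] at hccM
    calc (ci : ZMod M) = ci * (e * (e : ZMod M)⁻¹) := by rw [ZMod.mul_inv_of_unit _ heM, mul_one]
      _ = _ := by rw [← mul_assoc, hccM, one_mul]
  have e1 : ∀ ψ : DirichletCharacter ℂ M, (changeLevel hM ψ) (c : ZMod Q)⁻¹ * SS k (changeLevel hM ψ) * Psi V Y y (changeLevel hM ψ) =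
      ∑ n ∈ Finset.Icc 1 Y, (hh V Y n : ℂ) * gv y n * (ψ (e : ZMod M)⁻¹ * ψ (n : ZMod M)) := by
    intro ψ
    rw [← hciQ, changeLevel_nat hM ψ ci hcic, hciM]
    have : SS k (changeLevel hM ψ) = 1 := by
      unfold SS
      refine Finset.prod_eq_one fun i _ => ?_
      rw [changeLevel_nat hM ψ _ (hkQ i), hk i, map_one]; norm_num
    rw [this, mul_one]
    unfold Psi
    rw [Finset.mul_sum]
    refine Finset.sum_congr rfl fun n _ => ?_
    by_cases h : hh V Y n = 0
    · simp [h]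
    · rw [changeLevel_nat hM ψ n (hh_coprime hV h)]; ring
  simp_rw [e1]
  rw [Finset.sum_comm]
  push_cast
  rw [Finset.mul_sum, Finset.sum_filter]
  refine Finset.sum_congr rfl fun n _ => ?_
  rw [← Finset.mul_sum, sum_char_inv_mul_char_eq ℂ heM]
  split_ifs
  · ring
  · ring

theorem prime_ap [NeZero Q] {M : ℕ} [NeZero M] (hM : M ∣ Q) (U V Y : ℕ) (hQU : Q ≤ U) (hUY : U ≤ Y)
    (y T τ : ℝ) (hy0 : 0 ≤ y) (hy : 2 * y ≤ Real.log Y) (hT : 0 < T) (hτ : 0 ≤ τ)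
    {w : ℕ} (k : Fin w → ℕ) (hk : ∀ i, (k i : ZMod M) = 1) (hkQ : ∀ i, Nat.Coprime (k i) Q)
    (hV : ∀ p, p.Prime → p ∣ Q → p ≤ V) (c e : ℕ) (hc : Nat.Coprime c Q) (hce : (c : ZMod M) = e)
    (R η : ℝ) (hη0 : 0 ≤ η)
    (hR : ∀ s : Finset (Σ d : ℕ, DirichletCharacter ℂ d), (∀ x ∈ s, x ∈ BadSet V Y U T τ) → (s.card : ℝ) ≤ R)
    (hη : ∀ χ : DirichletCharacter ℂ Q, ¬ χ.FactorsThrough M →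
      (⟨χ.conductor, χ.primitiveCharacter⟩ : Σ d : ℕ, DirichletCharacter ℂ d) ∈ BadSet V Y U T τ → ‖SS k χ‖ ≤ η) :
    ∃ J : Finset (Fin w), ((M.totient : ℝ) * ∑ n ∈ (Finset.Icc 1 Y).filter (fun n : ℕ => (e : ZMod M) = (n : ZMod M)), hh V Y n * gv y n
        - Err Q U V Y y T τ - R * η * (Real.exp (y + 1 / 2) * (1 + Real.log Y) ^ 2)) / Q.totient
      ≤ ∑ n ∈ (Finset.Icc 1 Y).filter (fun n : ℕ => (c : ZMod Q) = (((∏ i ∈ J, k i) * n : ℕ) : ZMod Q)), hh V Y n * gv y n := by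
  classical
  by_contra hcon
  push Not at hcon
  set Bd := ((M.totient : ℝ) * ∑ n ∈ (Finset.Icc 1 Y).filter (fun n : ℕ => (e : ZMod M) = (n : ZMod M)), hh V Y n * gv y n
        - Err Q U V Y y T τ - R * η * (Real.exp (y + 1 / 2) * (1 + Real.log Y) ^ 2)) with hBd
  have hQt : (0 : ℝ) < Q.totient := by exact_mod_cast Nat.totient_pos.2 (NeZero.pos Q)
  have h1 := orth_SS k V Y y c hc
  have h2 := main_M hM k hk hkQ V Y hV y c e hc hce
  have hSS1 : ∀ χ : DirichletCharacter ℂ Q, ‖SS k χ‖ ≤ 1 := by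
    intro χ
    unfold SS
    rw [norm_prod]
    refine Finset.prod_le_one (fun _ _ => norm_nonneg _) fun i _ => ?_
    rw [norm_div]
    have := norm_add_le (1 : ℂ) (χ (k i : ZMod Q))
    have h3 := chi_norm_le χ (k i : ZMod Q)
    simp at this ⊢
    linarith
  -- split
  set F : DirichletCharacter ℂ Q → ℂ := fun χ => χ (c : ZMod Q)⁻¹ * SS k χ * Psi V Y y χ with hF
  have hFn : ∀ χ, ‖F χ‖ ≤ ‖SS k χ‖ * ‖Psi V Y y χ‖ := by
    intro χ
    simp only [hF]
    rw [norm_mul, norm_mul]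
    have := chi_norm_le χ (c : ZMod Q)⁻¹
    refine mul_le_mul_of_nonneg_right ?_ (norm_nonneg _)
    exact mul_le_of_le_one_left (norm_nonneg _) this
  set A := (Finset.univ : Finset (DirichletCharacter ℂ Q)).filter (fun χ => χ.FactorsThrough M) with hA
  set Bs := (Finset.univ : Finset (DirichletCharacter ℂ Q)).filter (fun χ => ¬ χ.FactorsThrough M) with hBs
  have hs1 : ∑ χ ∈ A, F χ + ∑ χ ∈ Bs, F χ = ∑ χ, F χ := Finset.sum_filter_add_sum_filter_not _ _ _
  have hA2 : ∑ χ ∈ A, F χ = ∑ ψ : DirichletCharacter ℂ M, F (changeLevel hM ψ) := by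
    have : A = Finset.univ.image (fun ψ : DirichletCharacter ℂ M => changeLevel hM ψ) := by
      ext χ
      simp only [hA, Finset.mem_filter, Finset.mem_univ, true_and, Finset.mem_image]
      constructor
      · rintro ⟨hd, ψ, rfl⟩; exact ⟨ψ, rfl⟩
      · rintro ⟨ψ, rfl⟩; exact ⟨hM, ψ, rfl⟩
    rw [this, Finset.sum_image]
    exact fun a _ b _ h => changeLevel_injective hM h
  set isBad : DirichletCharacter ℂ Q → Prop := fun χ => (⟨χ.conductor, χ.primitiveCharacter⟩ : Σ d : ℕ, DirichletCharacter ℂ d) ∈ BadSet V Y U T τ with hib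
  have hs2 : ∑ χ ∈ Bs.filter isBad, F χ + ∑ χ ∈ Bs.filter (fun χ => ¬ isBad χ), F χ = ∑ χ ∈ Bs, F χ := Finset.sum_filter_add_sum_filter_not _ _ _
  have hgood : ‖∑ χ ∈ Bs.filter (fun χ => ¬ isBad χ), F χ‖ ≤ Err Q U V Y y T τ := by
    have := AN U V Y hQU hUY (Bs.filter (fun χ => ¬ isBad χ)) ?_ y T τ hy0 hy hT hτ ?_
    · refine (norm_sum_le _ _).trans (le_trans (Finset.sum_le_sum fun χ _ => ?_) this)
      refine (hFn χ).trans ?_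
      exact mul_le_of_le_one_left (norm_nonneg _) (hSS1 χ)
    · rintro χ hχ rfl
      have h3 := (Finset.mem_filter.1 (Finset.mem_filter.1 hχ).1).2
      exact h3 ⟨hM, 1, (map_one _).symm⟩
    · intro χ hχ t ht
      have h3 := (Finset.mem_filter.1 hχ).2
      by_contra h4
      push Not at h4
      refine h3 ⟨Nat.pos_of_ne_zero (conductor_ne_zero χ), ?_, χ.primitiveCharacter_isPrimitive, t, ht, ?_⟩
      · exact (Nat.le_of_dvd (NeZero.pos Q) χ.conductor_dvd_level).trans hQU
      · simp only []
        rw [dp1_prim hV]; exact h4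
  have hbad : ‖∑ χ ∈ Bs.filter isBad, F χ‖ ≤ R * η * (Real.exp (y + 1 / 2) * (1 + Real.log Y) ^ 2) := by
    have hcard : ((Bs.filter isBad).card : ℝ) ≤ R := by
      have h3 := hR ((Bs.filter isBad).image (fun χ => ⟨χ.conductor, χ.primitiveCharacter⟩)) ?_
      · rwa [Finset.card_image_of_injective] at h3
        intro χ χ' h
        have hcl : ∀ (x x' : Σ d : ℕ, DirichletCharacter ℂ d) (hx : x.1 ∣ Q) (hx' : x'.1 ∣ Q), x = x' → changeLevel hx x.2 = changeLevel hx' x'.2 := by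
          rintro x x' hx hx' rfl; rfl
        have := hcl ⟨χ.conductor, χ.primitiveCharacter⟩ ⟨χ'.conductor, χ'.primitiveCharacter⟩ χ.conductor_dvd_level χ'.conductor_dvd_level h
        simp only [changeLevel_primitiveCharacter] at this
        exact this
      · intro x hx
        obtain ⟨χ, hχ, rfl⟩ := Finset.mem_image.1 hx
        exact (Finset.mem_filter.1 hχ).2
    refine (norm_sum_le _ _).trans ?_
    calc _ ≤ ∑ χ ∈ Bs.filter isBad, η * (Real.exp (y + 1 / 2) * (1 + Real.log Y) ^ 2) := by
          refine Finset.sum_le_sum fun χ hχ => (hFn χ).trans ?_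
          have h3 := Finset.mem_filter.1 hχ
          exact mul_le_mul (hη χ (Finset.mem_filter.1 h3.1).2 h3.2) (norm_Psi_le V Y y χ) (norm_nonneg _) hη0
      _ ≤ _ := by
          rw [Finset.sum_const, nsmul_eq_mul, mul_assoc]
          gcongr
  -- conclude
  set Main := (M.totient * ∑ n ∈ (Finset.Icc 1 Y).filter (fun n : ℕ => (e : ZMod M) = (n : ZMod M)), hh V Y n * gv y n : ℝ) with hMain
  set Tot := (Q.totient / 2 ^ w * ∑ J : Finset (Fin w), ∑ n ∈ (Finset.Icc 1 Y).filter (fun n : ℕ => (c : ZMod Q) = (((∏ i ∈ J, k i) * n : ℕ) : ZMod Q)),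
        hh V Y n * gv y n : ℝ) with hTot
  have hlt : Tot < Bd := by
    have h3 : ∑ J : Finset (Fin w), ∑ n ∈ (Finset.Icc 1 Y).filter (fun n : ℕ => (c : ZMod Q) = (((∏ i ∈ J, k i) * n : ℕ) : ZMod Q)),
        hh V Y n * gv y n < ∑ J : Finset (Fin w), Bd / Q.totient := Finset.sum_lt_sum_of_nonempty ⟨∅, Finset.mem_univ _⟩ fun J _ => hcon J
    rw [Finset.sum_const, nsmul_eq_mul] at h3
    have h4 : (Finset.univ : Finset (Finset (Fin w))).card = 2 ^ w := by simp
    rw [h4] at h3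
    calc Tot < Q.totient / 2 ^ w * (((2 ^ w : ℕ) : ℝ) * (Bd / Q.totient)) := by
          rw [hTot]; exact mul_lt_mul_of_pos_left h3 (by positivity)
      _ = Bd := by push_cast; field_simp
  have h5 : (Main : ℂ) - Tot = - (∑ χ ∈ Bs.filter isBad, F χ + ∑ χ ∈ Bs.filter (fun χ => ¬ isBad χ), F χ) := by
    rw [hs2]
    have h6 : (Main : ℂ) = ∑ χ ∈ A, F χ := by rw [hA2]; exact h2.symm
    have h7 : (Tot : ℂ) = ∑ χ, F χ := h1.symm
    rw [h6, h7, ← hs1]; ring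
  have h6 : Main - Tot ≤ ‖(Main : ℂ) - Tot‖ := by
    rw [← Complex.ofReal_sub, Complex.norm_real]; exact Real.le_norm_self _
  rw [h5, norm_neg] at h6
  have h7 := norm_add_le (∑ χ ∈ Bs.filter isBad, F χ) (∑ χ ∈ Bs.filter (fun χ => ¬ isBad χ), F χ)
  linarith

end

end

section

lemma greedy {ι α : Type*} (N : Finset α) (B : Finset ι) (a : α → ι → ℝ)
    (ha : ∀ n ∈ N, ∀ i ∈ B, 0 ≤ a n i) (ρ : ℝ) (hρ : 0 ≤ ρ) (hN : N.Nonempty)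
    (hav : ∀ i ∈ B, ∑ n ∈ N, a n i ≤ ρ * N.card) (w : ℕ) :
    ∃ k : Fin w → α, (∀ j, k j ∈ N) ∧ ∑ i ∈ B, ∏ j, a (k j) i ≤ B.card * ρ ^ w := by
  induction w with
  | zero => exact ⟨fun j => j.elim0, fun j => j.elim0, by simp⟩
  | succ w ih =>
    obtain ⟨k, hk, hs⟩ := ih
    have h1 : ∑ n ∈ N, ∑ i ∈ B, a n i * ∏ j, a (k j) i ≤ ∑ n ∈ N, (B.card : ℝ) * ρ ^ (w + 1) := by
      rw [Finset.sum_comm, Finset.sum_const, nsmul_eq_mul]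
      calc _ = ∑ i ∈ B, (∑ n ∈ N, a n i) * ∏ j, a (k j) i := by
            refine Finset.sum_congr rfl fun i _ => ?_
            rw [Finset.sum_mul]
        _ ≤ ∑ i ∈ B, (ρ * N.card) * ∏ j, a (k j) i := by
            refine Finset.sum_le_sum fun i hi => mul_le_mul_of_nonneg_right (hav i hi) ?_
            exact Finset.prod_nonneg fun j _ => ha _ (hk j) i hi
        _ = (ρ * N.card) * ∑ i ∈ B, ∏ j, a (k j) i := by rw [Finset.mul_sum]
        _ ≤ (ρ * N.card) * (B.card * ρ ^ w) := by gcongr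
        _ = _ := by ring
    obtain ⟨n, hn, hn2⟩ := Finset.exists_le_of_sum_le hN h1
    refine ⟨Fin.cons n k, fun j => ?_, ?_⟩
    · refine Fin.cases ?_ (fun j => ?_) j
      · simpa using hn
      · simpa using hk j
    · simpa [Fin.prod_univ_succ] using hn2

/-- the complete character sum over `1 + M n` vanishes -/
lemma char_sum_zero {d M : ℕ} [NeZero d] (f : DirichletCharacter ℂ d) (hf : f.IsPrimitive) (hd : ¬ d ∣ M) :
    ∑ y : ZMod d, f (1 + (M : ZMod d) * y) = 0 := by
  have hg : Nat.gcd d M ∣ d := Nat.gcd_dvd_left _ _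
  have hnf : ¬ f.FactorsThrough (Nat.gcd d M) := by
    intro h
    have h1 : f.conductor ∣ Nat.gcd d M := f.conductor_dvd_of_mem_conductorSet h
    rw [hf] at h1
    exact hd (h1.trans (Nat.gcd_dvd_right _ _))
  rw [DirichletCharacter.factorsThrough_iff_ker_unitsMap hg] at hnf
  obtain ⟨b, hb, hb2⟩ := SetLike.not_le_iff_exists.1 hnf
  have hfb : f (b : ZMod d) ≠ 1 := by
    intro h
    apply hb2
    rw [MonoidHom.mem_ker]
    ext
    simpa using h
  have hbg : (ZMod.castHom hg (ZMod (Nat.gcd d M))) (b : ZMod d) = 1 := by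
    rw [MonoidHom.mem_ker] at hb
    have := congrArg Units.val hb
    simpa [ZMod.unitsMap] using this
  -- b = 1 + M t
  obtain ⟨t, ht⟩ : ∃ t : ZMod d, (b : ZMod d) = 1 + M * t := by
    have h1 : (((b : ZMod d).val : ℤ) : ZMod (Nat.gcd d M)) = ((1 : ℤ) : ZMod (Nat.gcd d M)) := by
      rw [← ZMod.natCast_zmod_val (b : ZMod d), map_natCast] at hbg
      simpa using hbg
    rw [ZMod.intCast_eq_intCast_iff_dvd_sub] at h1
    obtain ⟨s, hs⟩ := h1
    have hbz := Nat.gcd_eq_gcd_ab d M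
    refine ⟨((-(Nat.gcdB d M * s) : ℤ) : ZMod d), ?_⟩
    have h2 : ((b : ZMod d).val : ℤ) = 1 - (d * Nat.gcdA d M + M * Nat.gcdB d M) * s := by
      rw [← hbz]; linarith
    have h3 : (((b : ZMod d).val : ℤ) : ZMod d) = b := by simp
    rw [← h3, h2]
    push_cast
    simp
    ring
  have hbij : Function.Bijective (fun y : ZMod d => t + b * y) := by
    rw [← Finite.injective_iff_bijective]
    intro x y h
    simp only at h
    exact b.isUnit.mul_left_cancel (add_left_cancel h)
  have h1 : ∑ y : ZMod d, f (1 + (M : ZMod d) * y) = f b * ∑ y : ZMod d, f (1 + (M : ZMod d) * y) := by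
    conv_lhs => rw [← Function.Bijective.sum_comp hbij]
    rw [Finset.mul_sum]
    refine Finset.sum_congr rfl fun y _ => ?_
    rw [← map_mul]
    congr 1
    rw [show (b : ZMod d) * (1 + M * y) = b + M * (b * y) by ring]
    nth_rewrite 2 [ht]
    ring
  have h2 : (f b - 1) * ∑ y : ZMod d, f (1 + (M : ZMod d) * y) = 0 := by
    rw [sub_mul, one_mul, ← h1, sub_self]
  rcases mul_eq_zero.1 h2 with h | h
  · exact absurd (sub_eq_zero.1 h) hfb
  · exact h

lemma sum_range_zmod {d : ℕ} [NeZero d] (F : ZMod d → ℂ) : ∑ i ∈ Finset.range d, F (i : ZMod d) = ∑ y : ZMod d, F y := by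
  refine Finset.sum_bij' (fun i _ => (i : ZMod d)) (fun y _ => y.val) ?_ ?_ ?_ ?_ ?_
  · intros; simp
  · intro y _; simpa using ZMod.val_lt y
  · intro i hi; simpa using ZMod.val_cast_of_lt (Finset.mem_range.1 hi)
  · intro y _; simp
  · intros; rfl

lemma char_sum_le {d M : ℕ} [NeZero d] (f : DirichletCharacter ℂ d) (hf : f.IsPrimitive) (hd : ¬ d ∣ M) (N : ℕ) :
    ‖∑ n ∈ Finset.range N, f ((1 + M * n : ℕ) : ZMod d)‖ ≤ d := by
  induction N using Nat.strong_induction_on with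
  | _ N ih =>
    by_cases h : N < d
    · refine (norm_sum_le _ _).trans ?_
      calc _ ≤ ∑ n ∈ Finset.range N, (1 : ℝ) := Finset.sum_le_sum fun n _ => chi_norm_le _ _
        _ ≤ d := by simp; exact h.le
    · push Not at h
      have h1 := ih (N - d) (by have := NeZero.pos d; omega)
      have h2 : N = (N - d) + d := by omega
      rw [h2, Finset.sum_range_add]
      have h3 : ∑ x ∈ Finset.range d, f ((1 + M * ((N - d) + x) : ℕ) : ZMod d) = 0 := by
        have := sum_range_zmod (d := d) (fun y => f (1 + (M : ZMod d) * (((N - d : ℕ) : ZMod d) + y)))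
        push_cast at this ⊢
        rw [this, ← char_sum_zero f hf hd]
        exact Equiv.sum_comp (Equiv.addLeft ((N - d : ℕ) : ZMod d)) (fun y => f (1 + (M : ZMod d) * y))
      rw [h3, add_zero]
      exact h1

lemma char_avg {d M D0 : ℕ} [NeZero d] (f : DirichletCharacter ℂ d) (hf : f.IsPrimitive) (hd : ¬ d ∣ M) (hdD : d ≤ D0) :
    ∑ n ∈ Finset.range (4 * D0), ‖(1 + f ((1 + M * n : ℕ) : ZMod d)) / 2‖ ^ 2 ≤ 5 / 8 * (Finset.range (4 * D0)).card := by
  have h1 := char_sum_le f hf hd (4 * D0)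
  have h2 : ∀ z : ℂ, ‖z‖ ≤ 1 → ‖(1 + z) / 2‖ ^ 2 ≤ 1 / 2 + z.re / 2 := by
    intro z hz
    have h3 : ‖z‖ ^ 2 ≤ 1 := by nlinarith [norm_nonneg z]
    rw [norm_div, div_pow, ← Complex.normSq_eq_norm_sq, Complex.normSq_add]
    rw [← Complex.normSq_eq_norm_sq] at h3
    simp
    linarith
  calc _ ≤ ∑ n ∈ Finset.range (4 * D0), (1 / 2 + (f ((1 + M * n : ℕ) : ZMod d)).re / 2) :=
        Finset.sum_le_sum fun n _ => h2 _ (chi_norm_le _ _)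
    _ = 2 * D0 + (∑ n ∈ Finset.range (4 * D0), f ((1 + M * n : ℕ) : ZMod d)).re / 2 := by
        rw [Finset.sum_add_distrib, Complex.re_sum, Finset.sum_div]; simp; ring
    _ ≤ 2 * D0 + d / 2 := by
        have := (Complex.re_le_norm _).trans h1
        linarith
    _ ≤ _ := by
        have : (d : ℝ) ≤ D0 := by exact_mod_cast hdD
        simp; linarith

lemma gcd_prod_dvd {ι : Type*} (s : Finset ι) (x : ι → ℕ) (a : ℕ) : Nat.gcd a (∏ i ∈ s, x i) ∣ ∏ i ∈ s, Nat.gcd a (x i) := by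
  classical
  induction s using Finset.induction_on with
  | empty => simp
  | insert i s hi ih =>
    rw [Finset.prod_insert hi, Finset.prod_insert hi]
    exact (Nat.gcd_mul_right_dvd_mul_gcd _ _ _).trans (mul_dvd_mul_left _ ih)

lemma prod_le_lcm {ι : Type*} (s : Finset ι) (x : ι → ℕ) (H : ℕ) (hH : 1 ≤ H) (hx : ∀ i ∈ s, 0 < x i)
    (h : ∀ i ∈ s, ∀ j ∈ s, i ≠ j → Nat.gcd (x i) (x j) ≤ H) : ∏ i ∈ s, x i ≤ s.lcm x * H ^ (s.card * s.card) := by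
  classical
  induction s using Finset.induction_on with
  | empty => simp
  | insert i s hi ih =>
    have ih' := ih (fun j hj => hx j (Finset.mem_insert_of_mem hj)) (fun a ha b hb => h a (Finset.mem_insert_of_mem ha) b (Finset.mem_insert_of_mem hb))
    rw [Finset.prod_insert hi, Finset.lcm_insert, Finset.card_insert_of_notMem hi]
    have h1 : Nat.gcd (x i) (s.lcm x) ≤ H ^ s.card := by
      have hd : s.lcm x ∣ ∏ j ∈ s, x j := Finset.lcm_dvd fun j hj => Finset.dvd_prod_of_mem x hj
      have h2 : Nat.gcd (x i) (s.lcm x) ∣ ∏ j ∈ s, Nat.gcd (x i) (x j) :=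
        (Nat.gcd_dvd_gcd_of_dvd_right _ hd).trans (gcd_prod_dvd s x (x i))
      refine (Nat.le_of_dvd (Finset.prod_pos fun j _ => Nat.gcd_pos_of_pos_left _ (hx i (Finset.mem_insert_self _ _))) h2).trans ?_
      exact Finset.prod_le_pow_card _ _ _ fun j hj => h i (Finset.mem_insert_self _ _) j (Finset.mem_insert_of_mem hj) (by rintro rfl; exact hi hj)
    calc x i * ∏ j ∈ s, x j ≤ x i * (s.lcm x * H ^ (s.card * s.card)) := by gcongr
      _ = (Nat.gcd (x i) (s.lcm x) * Nat.lcm (x i) (s.lcm x)) * H ^ (s.card * s.card) := by rw [Nat.gcd_mul_lcm]; ring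
      _ ≤ (H ^ s.card * Nat.lcm (x i) (s.lcm x)) * H ^ (s.card * s.card) := by gcongr
      _ = Nat.lcm (x i) (s.lcm x) * H ^ (s.card + s.card * s.card) := by rw [pow_add]; ring
      _ ≤ Nat.lcm (x i) (s.lcm x) * H ^ ((s.card + 1) * (s.card + 1)) := by
          gcongr
          nlinarith

lemma bad_h {W d U H D1 n : ℕ} (hd : 0 < d) (hdU : d ≤ U) (hn : U * H ^ (n * n) < D1 ^ n) (hH : 1 ≤ H) (hW : 0 < W) :
    ((Finset.range H).filter (fun h => D1 ≤ Nat.gcd d (W * (h + 2) - 1))).card ≤ n := by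
  by_contra hcon
  push Not at hcon
  obtain ⟨s, hs, hsc⟩ := Finset.exists_subset_card_eq hcon.le
  have h1 := prod_le_lcm s (fun h => Nat.gcd d (W * (h + 2) - 1)) H hH (fun i _ => Nat.gcd_pos_of_pos_left _ hd) ?_
  · have h2 : D1 ^ n ≤ ∏ h ∈ s, Nat.gcd d (W * (h + 2) - 1) := by
      rw [← hsc]
      exact Finset.pow_card_le_prod _ _ _ fun h hh => (Finset.mem_filter.1 (hs hh)).2
    have h3 : s.lcm (fun h => Nat.gcd d (W * (h + 2) - 1)) ≤ U :=
      (Nat.le_of_dvd hd (Finset.lcm_dvd fun h _ => Nat.gcd_dvd_left _ _)).trans hdU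
    rw [hsc] at h1
    have := Nat.mul_le_mul_right (H ^ (n * n)) h3
    omega
  · have key : ∀ i ∈ s, ∀ j ∈ s, i < j → Nat.gcd (Nat.gcd d (W * (i + 2) - 1)) (Nat.gcd d (W * (j + 2) - 1)) ≤ H := by
      intro i hi j hj hij
      have hjH : j < H := Finset.mem_range.1 (Finset.mem_filter.1 (hs hj)).1
      set G := Nat.gcd (Nat.gcd d (W * (i + 2) - 1)) (Nat.gcd d (W * (j + 2) - 1)) with hG
      have g1 : G ∣ W * (i + 2) - 1 := (Nat.gcd_dvd_left _ _).trans (Nat.gcd_dvd_right _ _)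
      have g2 : G ∣ W * (j + 2) - 1 := (Nat.gcd_dvd_right _ _).trans (Nat.gcd_dvd_right _ _)
      have e1 : 1 ≤ W * (i + 2) := Nat.mul_pos hW (by omega)
      have g3 : G ∣ W * (j - i) := by
        have := Nat.dvd_sub g2 g1
        have e2 : W * (j + 2) - 1 - (W * (i + 2) - 1) = W * (j - i) := by
          obtain ⟨k, rfl⟩ : ∃ k, j = i + k := ⟨j - i, by omega⟩
          have : W * (i + k + 2) = W * (i + 2) + W * k := by ring
          rw [show i + k - i = k by omega]
          omega
        rwa [e2] at this
      have g4 : Nat.Coprime G W := by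
        have : Nat.Coprime (W * (i + 2) - 1) W := by
          rw [Nat.coprime_iff_gcd_eq_one]
          have a1 := Nat.gcd_dvd_left (W * (i + 2) - 1) W
          have a2 := (Nat.gcd_dvd_right (W * (i + 2) - 1) W).mul_right (i + 2)
          have := (Nat.dvd_sub a2 a1)
          rw [show W * (i + 2) - (W * (i + 2) - 1) = 1 by omega] at this
          exact Nat.dvd_one.1 this
        exact this.coprime_dvd_left g1
      have g5 := g4.dvd_of_dvd_mul_left g3
      have := Nat.le_of_dvd (by omega) g5
      omega
    intro i hi j hj hij
    rcases lt_or_gt_of_ne hij with h | h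
    · exact key i hi j hj h
    · rw [Nat.gcd_comm]; exact key j hj i hi h

lemma card_primeFactors_le_log (n : ℕ) : n.primeFactors.card ≤ Nat.log 2 n := by
  rcases Nat.eq_zero_or_pos n with rfl | hn
  · simp
  apply Nat.le_log_of_pow_le (by norm_num)
  calc 2 ^ n.primeFactors.card ≤ ∏ p ∈ n.primeFactors, p :=
        Finset.pow_card_le_prod _ _ _ fun p hp => (Nat.prime_of_mem_primeFactors hp).two_le
    _ ≤ n := Nat.le_of_dvd hn (Nat.prod_primeFactors_dvd n)

/-- hitting sets -/
lemma hitting {ι : Type*} (S : Finset ℕ) (B : Finset ι) (F : ι → Finset ℕ) (c0 r : ℕ) (hF : ∀ i ∈ B, F i ⊆ S ∧ c0 ≤ (F i).card)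
    (hr : 2 * r ≤ S.card) (hB : (B.card : ℝ) < Real.exp ((c0 : ℝ) / 2)) :
    ∃ P ⊆ S, P.card = r ∧ ∀ i ∈ B, ∃ p ∈ F i, p ∉ P := by
  classical
  rcases S.eq_empty_or_nonempty with hS | hS
  · subst hS
    refine ⟨∅, by simp, by simp at hr; simp [hr], fun i hi => ?_⟩
    exfalso
    have h1 := hF i hi
    have h2 : F i = ∅ := Finset.subset_empty.1 h1.1
    rw [h2] at h1
    simp at h1
    subst h1
    simp at hB
    subst hB
    simp at hi
  have hs0 : (0 : ℝ) < S.card := by exact_mod_cast hS.card_pos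
  by_cases hB0 : B = ∅
  · subst hB0
    obtain ⟨P, hP, hPc⟩ := Finset.exists_subset_card_eq (show r ≤ S.card by omega)
    exact ⟨P, hP, hPc, by simp⟩
  obtain ⟨i0, hi0⟩ := Finset.nonempty_iff_ne_empty.2 hB0
  have hc0S : (c0 : ℝ) ≤ S.card := by
    exact_mod_cast (hF i0 hi0).2.trans (Finset.card_le_card (hF i0 hi0).1)
  set ρ : ℝ := 1 - c0 / S.card with hρ
  have hρ0 : 0 ≤ ρ := by
    rw [hρ, sub_nonneg, div_le_one hs0]; exact hc0S
  obtain ⟨k, hk, hks⟩ := greedy S B (fun p i => if p ∈ F i then (0 : ℝ) else 1)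
    (fun n _ i _ => by positivity) ρ hρ0 hS (by
      intro i hi
      rw [Finset.sum_ite]
      simp only [Finset.sum_const_zero, zero_add, Finset.sum_const, nsmul_eq_mul, mul_one]
      have h1 : (S.filter (fun p => p ∉ F i)) = S \ F i := by ext; simp
      rw [h1, Finset.card_sdiff_of_subset (hF i hi).1, Nat.cast_sub (Finset.card_le_card (hF i hi).1), hρ, sub_mul, div_mul_cancel₀ _ hs0.ne']
      have : (c0 : ℝ) ≤ (F i).card := by exact_mod_cast (hF i hi).2
      linarith) (S.card - r)
  set Tset := Finset.univ.image k with hTset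
  have hTc : Tset.card ≤ S.card - r := by
    refine Finset.card_image_le.trans ?_
    simp
  have hTS : Tset ⊆ S := by
    intro p hp
    obtain ⟨j, _, rfl⟩ := Finset.mem_image.1 hp
    exact hk j
  obtain ⟨P, hP, hPc⟩ := Finset.exists_subset_card_eq (show r ≤ (S \ Tset).card by
    rw [Finset.card_sdiff_of_subset hTS]; omega)
  refine ⟨P, hP.trans Finset.sdiff_subset, hPc, fun i hi => ?_⟩
  by_contra hcon
  push Not at hcon
  have h1 : ∏ j, (if k j ∈ F i then (0 : ℝ) else 1) = 1 := by
    refine Finset.prod_eq_one fun j _ => ?_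
    rw [if_neg]
    intro h
    have := hP (hcon _ h)
    rw [Finset.mem_sdiff] at this
    exact this.2 (Finset.mem_image_of_mem k (Finset.mem_univ j))
  have h2 : (1 : ℝ) ≤ ∑ i ∈ B, ∏ j, (if k j ∈ F i then (0 : ℝ) else 1) := by
    refine h1.symm.le.trans ?_
    exact Finset.single_le_sum (f := fun i => ∏ j, (if k j ∈ F i then (0 : ℝ) else 1)) (fun i _ => Finset.prod_nonneg fun j _ => by positivity) hi
  have h3 : ρ ^ (S.card - r) ≤ Real.exp (-((c0 : ℝ) / 2)) := by
    have h4 : ρ ≤ Real.exp (-(c0 / S.card)) := by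
      have := Real.add_one_le_exp (-((c0 : ℝ) / S.card))
      rw [hρ]; linarith
    calc ρ ^ (S.card - r) ≤ (Real.exp (-(c0 / S.card))) ^ (S.card - r) := by gcongr
      _ = Real.exp (((S.card - r : ℕ) : ℝ) * -(c0 / S.card)) := by rw [Real.exp_nat_mul]
      _ ≤ _ := by
        rw [Real.exp_le_exp]
        have h5 : (S.card : ℝ) / 2 ≤ ((S.card - r : ℕ) : ℝ) := by
          have : S.card ≤ 2 * (S.card - r) := by omega
          have : (S.card : ℝ) ≤ 2 * ((S.card - r : ℕ) : ℝ) := by exact_mod_cast this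
          linarith
        have h6 : (0 : ℝ) ≤ c0 / S.card := by positivity
        have h7 : (c0 : ℝ) / 2 = S.card / 2 * (c0 / S.card) := by field_simp
        nlinarith
  have h4 : (B.card : ℝ) * Real.exp (-((c0 : ℝ) / 2)) < 1 := by
    rw [Real.exp_neg, ← div_eq_mul_inv, div_lt_one (Real.exp_pos _)]; exact hB
  have h5 : (B.card : ℝ) * ρ ^ (S.card - r) ≤ (B.card : ℝ) * Real.exp (-((c0 : ℝ) / 2)) := by gcongr
  linarith

theorem selection {M g U D0 w n H D1 Z c0 r : ℕ} (hM : 0 < M) (hg : 0 < g) (hD0 : 0 < D0) (hH1 : 1 ≤ H)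
    (B : Finset (Σ d : ℕ, DirichletCharacter ℂ d)) (hB : ∀ x ∈ B, 0 < x.1 ∧ x.1 ≤ U ∧ x.2.IsPrimitive)
    (h2 : B.card * n < H) (h3 : U * H ^ (n * n) < D1 ^ n) (h4 : M * D1 * Z ^ c0 ≤ D0) (hZ : 0 < Z)
    (h5 : Nat.log 2 (g * M * (1 + M * (4 * D0)) ^ w) + Nat.log 2 (g * M * (1 + M * (4 * D0)) ^ w * (H + 1)) + 2 * r
      ≤ ((Finset.Icc 1 Z).filter Nat.Prime).card)
    (h6 : (B.card : ℝ) < Real.exp ((c0 : ℝ) / 2)) :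
    ∃ (k : Fin w → ℕ) (u0 : ℕ) (P : Finset ℕ), (∀ i, (k i : ZMod M) = 1) ∧ (∀ i, 0 < k i) ∧
      g * M * ∏ i, k i ≤ g * M * (1 + M * (4 * D0)) ^ w ∧ 0 < u0 ∧ u0 ≤ g * M * (1 + M * (4 * D0)) ^ w * (H + 1) ∧
      (g * M * ∏ i, k i) ∣ u0 + 1 ∧ P.card = r ∧ (∀ p ∈ P, p.Prime ∧ p ≤ Z ∧ ¬ p ∣ g * M * ∏ i, k i ∧ ¬ p ∣ u0) ∧
      ∀ x ∈ B, x.1 ∣ M * u0 * ∏ p ∈ P, p → ¬ x.1 ∣ M →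
        ∏ i, ‖(1 + x.2 (k i : ZMod x.1)) / 2‖ ^ 2 ≤ B.card * (5 / 8 : ℝ) ^ w := by
  classical
  set B1 := B.filter (fun x => x.1 ≤ D0 ∧ ¬ x.1 ∣ M) with hB1
  obtain ⟨n1, hn1, hn1s⟩ := greedy (Finset.range (4 * D0)) B1 (fun n x => ‖(1 + x.2 ((1 + M * n : ℕ) : ZMod x.1)) / 2‖ ^ 2)
    (fun _ _ _ _ => by positivity) (5 / 8) (by norm_num) ⟨0, by simp [hD0]⟩ (by
      intro x hx
      obtain ⟨hx1, hx2, hx3⟩ := Finset.mem_filter.1 hx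
      have : NeZero x.1 := ⟨(hB x hx1).1.ne'⟩
      exact char_avg x.2 (hB x hx1).2.2 hx3 hx2) w
  set k : Fin w → ℕ := fun i => 1 + M * n1 i with hk
  have hk0 : ∀ i, 0 < k i := fun i => by simp only [hk]; omega
  set Wm := g * M * (1 + M * (4 * D0)) ^ w with hWm
  set W := g * M * ∏ i, k i with hW
  have hW0 : 0 < W := Nat.mul_pos (Nat.mul_pos hg hM) (Finset.prod_pos fun i _ => hk0 i)
  have hWW : W ≤ Wm := by
    rw [hW, hWm]
    refine Nat.mul_le_mul_left _ ?_
    calc ∏ i, k i ≤ ∏ i : Fin w, (1 + M * (4 * D0)) := by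
          refine Finset.prod_le_prod' fun i _ => ?_
          have := Finset.mem_range.1 (hn1 i)
          simp only [hk]
          gcongr
      _ = _ := by simp
  -- choose h
  obtain ⟨h, hhH, hh2⟩ : ∃ h ∈ Finset.range H, ∀ x ∈ B, Nat.gcd x.1 (W * (h + 2) - 1) < D1 := by
    by_contra hcon
    push Not at hcon
    have : Finset.range H ⊆ B.biUnion (fun x => (Finset.range H).filter (fun h => D1 ≤ Nat.gcd x.1 (W * (h + 2) - 1))) := by
      intro h hh
      obtain ⟨x, hx, hx2⟩ := hcon h hh
      exact Finset.mem_biUnion.2 ⟨x, hx, Finset.mem_filter.2 ⟨hh, hx2⟩⟩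
    have h7 := (Finset.card_le_card this).trans (Finset.card_biUnion_le_card_mul B _ n
      fun x hx => bad_h (hB x hx).1 (hB x hx).2.1 h3 hH1 hW0)
    rw [Finset.card_range] at h7
    omega
  set u0 := W * (h + 2) - 1 with hu0
  have hW2 : W * 2 ≤ W * (h + 2) := Nat.mul_le_mul_left _ (by omega)
  have hu0p : 0 < u0 := by omega
  have hu0W : u0 + 1 = W * (h + 2) := by omega
  have hu0le : u0 ≤ Wm * (H + 1) := by
    have := Finset.mem_range.1 hhH
    have : W * (h + 2) ≤ Wm * (H + 1) := Nat.mul_le_mul hWW (by omega)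
    omega
  -- primes
  set S := ((Finset.Icc 1 Z).filter Nat.Prime) \ (W.primeFactors ∪ u0.primeFactors) with hS
  have hSc : 2 * r ≤ S.card := by
    have a1 := Finset.le_card_sdiff (W.primeFactors ∪ u0.primeFactors) ((Finset.Icc 1 Z).filter Nat.Prime)
    have a2 := Finset.card_union_le W.primeFactors u0.primeFactors
    have a3 := (card_primeFactors_le_log W).trans (Nat.log_mono_right hWW)
    have a4 := (card_primeFactors_le_log u0).trans (Nat.log_mono_right hu0le)
    rw [← hS] at a1
    omega
  have hSp : ∀ p ∈ S, p.Prime ∧ p ≤ Z ∧ ¬ p ∣ W ∧ ¬ p ∣ u0 := by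
    intro p hp
    obtain ⟨b1, b2⟩ := Finset.mem_sdiff.1 hp
    obtain ⟨b3, b4⟩ := Finset.mem_filter.1 b1
    rw [Finset.mem_union, not_or] at b2
    refine ⟨b4, (Finset.mem_Icc.1 b3).2, fun h => b2.1 (Nat.mem_primeFactors.2 ⟨b4, h, hW0.ne'⟩), fun h => b2.2 (Nat.mem_primeFactors.2 ⟨b4, h, hu0p.ne'⟩)⟩
  set B2 := B.filter (fun x => c0 ≤ (S ∩ x.1.primeFactors).card) with hB2
  obtain ⟨P, hPS, hPc, hPh⟩ := hitting S B2 (fun x => S ∩ x.1.primeFactors) c0 r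
    (fun x hx => ⟨Finset.inter_subset_left, (Finset.mem_filter.1 hx).2⟩) hSc
    (lt_of_le_of_lt (by exact_mod_cast Finset.card_le_card (Finset.filter_subset _ _)) h6)
  have hPprod : ∀ p, p.Prime → p ∣ ∏ p ∈ P, p → p ∈ P := by
    intro p hp hd
    obtain ⟨q, hq, hpq⟩ := (Prime.dvd_finsetProd_iff hp.prime _).1 hd
    have := (Nat.prime_dvd_prime_iff_eq hp (hSp q (hPS hq)).1).1 hpq
    exact this ▸ hq
  refine ⟨k, u0, P, fun i => ?_, hk0, hWW, hu0p, hu0le, ⟨_, hu0W⟩, hPc, fun p hp => hSp p (hPS hp), ?_⟩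
  · simp [hk]
  intro x hx hxd hxM
  have hx0 := (hB x hx).1
  by_cases hxD : x.1 ≤ D0
  · have hx1 : x ∈ B1 := Finset.mem_filter.2 ⟨hx, hxD, hxM⟩
    calc _ ≤ ∑ x ∈ B1, ∏ i, ‖(1 + x.2 (k i : ZMod x.1)) / 2‖ ^ 2 :=
          Finset.single_le_sum (f := fun x : (Σ d : ℕ, DirichletCharacter ℂ d) => ∏ i, ‖(1 + x.2 (k i : ZMod x.1)) / 2‖ ^ 2)
            (fun _ _ => Finset.prod_nonneg fun _ _ => by positivity) hx1
      _ ≤ B1.card * (5 / 8 : ℝ) ^ w := hn1s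
      _ ≤ _ := by
          have := Finset.card_le_card (Finset.filter_subset (fun x => x.1 ≤ D0 ∧ ¬ x.1 ∣ M) B)
          gcongr
  · exfalso
    push Not at hxD
    by_cases hc : c0 ≤ (S ∩ x.1.primeFactors).card
    · obtain ⟨p, hp, hpP⟩ := hPh x (Finset.mem_filter.2 ⟨hx, hc⟩)
      obtain ⟨hp1, hp2⟩ := Finset.mem_inter.1 hp
      obtain ⟨c1, c2, c3, c4⟩ := hSp p hp1
      have c5 := (Nat.dvd_of_mem_primeFactors hp2).trans hxd
      rcases (c1.dvd_mul).1 c5 with c6 | c6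
      · rcases (c1.dvd_mul).1 c6 with c7 | c7
        · exact c3 (by rw [hW]; exact ((c7.mul_left g).mul_right _))
        · exact c4 c7
      · exact hpP (hPprod p c1 c6)
    · push Not at hc
      have d1 : x.1 ∣ Nat.gcd x.1 M * Nat.gcd x.1 u0 * Nat.gcd x.1 (∏ p ∈ P, p) := by
        have e1 := Nat.gcd_mul_right_dvd_mul_gcd x.1 (M * u0) (∏ p ∈ P, p)
        rw [Nat.gcd_eq_left hxd] at e1
        exact e1.trans (mul_dvd_mul_right (Nat.gcd_mul_right_dvd_mul_gcd x.1 M u0) _)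
      have d2 : Nat.gcd x.1 (∏ p ∈ P, p) ≤ Z ^ c0 := by
        have f1 : Nat.gcd x.1 (∏ p ∈ P, p) ∣ ∏ p ∈ P, Nat.gcd x.1 p := gcd_prod_dvd P (fun p => p) x.1
        have f2 : ∏ p ∈ P, Nat.gcd x.1 p ≤ Z ^ c0 := by
          have f3 : ∏ p ∈ P, Nat.gcd x.1 p = ∏ p ∈ P.filter (fun p => p ∣ x.1), Nat.gcd x.1 p := by
            rw [Finset.prod_filter]
            refine Finset.prod_congr rfl fun p hp => ?_
            split_ifs with hdv
            · rfl
            · exact ((Nat.Prime.coprime_iff_not_dvd (hSp p (hPS hp)).1).2 hdv).symm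
          rw [f3]
          calc _ ≤ Z ^ (P.filter (fun p => p ∣ x.1)).card := by
                refine Finset.prod_le_pow_card _ _ _ fun p hp => ?_
                have hpP := (Finset.mem_filter.1 hp).1
                have g1 := hSp p (hPS hpP)
                exact (Nat.gcd_le_right _ g1.1.pos).trans g1.2.1
            _ ≤ Z ^ c0 := by
                apply Nat.pow_le_pow_right hZ
                refine (Finset.card_le_card ?_).trans hc.le
                intro p hp
                obtain ⟨g0, g1⟩ := Finset.mem_filter.1 hp
                exact Finset.mem_inter.2 ⟨hPS g0, Nat.mem_primeFactors.2 ⟨(hSp p (hPS g0)).1, g1, hx0.ne'⟩⟩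
        exact (Nat.le_of_dvd (Finset.prod_pos fun p _ => Nat.gcd_pos_of_pos_left _ hx0) f1).trans f2
      have d3 := Nat.le_of_dvd (Nat.mul_pos (Nat.mul_pos (Nat.gcd_pos_of_pos_left _ hx0) (Nat.gcd_pos_of_pos_left _ hx0)) (Nat.gcd_pos_of_pos_left _ hx0)) d1
      have d4 : Nat.gcd x.1 M * Nat.gcd x.1 u0 * Nat.gcd x.1 (∏ p ∈ P, p) ≤ M * D1 * Z ^ c0 := by
        have := (hh2 x hx).le
        have := Nat.gcd_le_right x.1 hM
        gcongr
      omega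

end

section

open ArithmeticFunction.vonMangoldt in
lemma lambda_ap {M : ℕ} [NeZero M] (a : ZMod M) (ha : IsUnit a) :
    ∃ c : ℝ, 0 < c ∧ ∀ J : ℕ, ∃ j ≥ J, c * Real.exp j ≤
      ∑ n ∈ Finset.Ioc ⌊Real.exp j⌋₊ ⌊Real.exp ((j : ℝ) + 1)⌋₊, residueClass a n := by
  obtain ⟨C, hC⟩ := LSeries_residueClass_lower_bound ha
  have hφ : (0 : ℝ) < (M.totient : ℝ)⁻¹ := inv_pos.2 (by exact_mod_cast Nat.totient_pos.2 (NeZero.pos M))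
  set c : ℝ := (M.totient : ℝ)⁻¹ / 4 with hc
  have hc0 : 0 < c := by positivity
  refine ⟨c, hc0, ?_⟩
  by_contra hcon
  push Not at hcon
  obtain ⟨J, hJ⟩ := hcon
  set C0 : ℝ := ∑ n ∈ Finset.Ioc 0 ⌊Real.exp J⌋₊, residueClass a n with hC0
  have key : ∀ x : ℝ, x ∈ Set.Ioc (1 : ℝ) 2 → ∑' n, residueClass a n / (n : ℝ) ^ x ≤ C0 + 2 * c / (x - 1) := by
    intro x hx
    have hs : 0 < x - 1 := by have := hx.1; linarith
    have hs1 : x - 1 ≤ 1 := by have := hx.2; linarith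
    set ρ := Real.exp (-(x - 1)) with hρ
    have hρ0 : 0 < ρ := Real.exp_pos _
    have hρ1 : ρ ≤ 1 - (x - 1) / 2 := by
      have h1 : (1 + (x - 1)) ≤ Real.exp (x - 1) := by have := Real.add_one_le_exp (x - 1); linarith
      rw [hρ, Real.exp_neg]
      calc (Real.exp (x - 1))⁻¹ ≤ (1 + (x - 1))⁻¹ := by gcongr
        _ ≤ _ := by
          rw [inv_le_iff_one_le_mul₀ (by linarith)]
          nlinarith
    have step : ∀ K : ℕ, ∑ n ∈ Finset.Ioc 0 ⌊Real.exp ((J : ℝ) + K)⌋₊, residueClass a n / (n : ℝ) ^ x ≤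
        C0 + ∑ i ∈ Finset.range K, c * ρ ^ i := by
      intro K
      induction K with
      | zero =>
        simp only [Nat.cast_zero, add_zero, Finset.range_zero, Finset.sum_empty]
        refine Finset.sum_le_sum fun n hn => ?_
        have : (1 : ℝ) ≤ n := by exact_mod_cast (Finset.mem_Ioc.1 hn).1
        exact div_le_self (residueClass_nonneg a n) (Real.one_le_rpow this (by linarith))
      | succ K ih =>
        have hle : ⌊Real.exp ((J : ℝ) + K)⌋₊ ≤ ⌊Real.exp ((J : ℝ) + (K + 1 : ℕ))⌋₊ := by
          apply Nat.floor_le_floor; apply Real.exp_le_exp.2; push_cast; linarith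
        rw [← Finset.sum_Ioc_consecutive _ (Nat.zero_le _) hle, Finset.sum_range_succ, ← add_assoc]
        refine add_le_add ih ?_
        have h1 := hJ (J + K) (by omega)
        have h2 : Real.exp ((J : ℝ) + (K + 1 : ℕ)) = Real.exp (((J + K : ℕ) : ℝ) + 1) := by congr 1; push_cast; ring
        have h3 : ((J : ℝ) + K) = ((J + K : ℕ) : ℝ) := by push_cast; ring
        rw [h2, h3]
        set y : ℝ := ((J + K : ℕ) : ℝ) with hy
        have hKy : (K : ℝ) ≤ y := by rw [hy]; push_cast; have : (0 : ℝ) ≤ J := by positivity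
                                     linarith
        calc _ ≤ ∑ n ∈ Finset.Ioc ⌊Real.exp y⌋₊ ⌊Real.exp (y + 1)⌋₊, residueClass a n * Real.exp (-(y * x)) := by
              refine Finset.sum_le_sum fun n hn => ?_
              have h4 : Real.exp y ≤ n := ((Nat.floor_lt (Real.exp_pos _).le).1 (Finset.mem_Ioc.1 hn).1).le
              rw [div_eq_mul_inv]
              refine mul_le_mul_of_nonneg_left ?_ (residueClass_nonneg a n)
              rw [Real.exp_neg, Real.exp_mul]
              gcongr
              linarith
          _ = (∑ n ∈ Finset.Ioc ⌊Real.exp y⌋₊ ⌊Real.exp (y + 1)⌋₊, residueClass a n) * Real.exp (-(y * x)) := by rw [Finset.sum_mul]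
          _ ≤ (c * Real.exp y) * Real.exp (-(y * x)) := by gcongr
          _ = c * Real.exp (-(y * (x - 1))) := by rw [mul_assoc, ← Real.exp_add]; congr 2; ring
          _ ≤ c * ρ ^ K := by
              rw [hρ, ← Real.exp_nat_mul]
              gcongr
              nlinarith
    refine Real.tsum_le_of_sum_range_le (fun n => div_nonneg (residueClass_nonneg a n) (by positivity)) fun N => ?_
    have hN : N ≤ ⌊Real.exp ((J : ℝ) + N)⌋₊ := by
      apply Nat.le_floor
      have := Real.add_one_le_exp ((J : ℝ) + N)
      have : (0 : ℝ) ≤ J := by positivity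
      linarith
    have h5 : ∑ n ∈ Finset.range N, residueClass a n / (n : ℝ) ^ x ≤ ∑ n ∈ Finset.Ioc 0 ⌊Real.exp ((J : ℝ) + N)⌋₊, residueClass a n / (n : ℝ) ^ x := by
      calc _ ≤ ∑ n ∈ insert 0 (Finset.Ioc 0 ⌊Real.exp ((J : ℝ) + N)⌋₊), residueClass a n / (n : ℝ) ^ x := by
            refine Finset.sum_le_sum_of_subset_of_nonneg ?_ fun n _ _ => div_nonneg (residueClass_nonneg a n) (by positivity)
            intro n hn
            have := Finset.mem_range.1 hn
            rw [Finset.mem_insert, Finset.mem_Ioc]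
            omega
        _ = _ := by
            rw [Finset.sum_insert (by simp)]
            rw [residueClass_apply_zero]; simp
    refine h5.trans ((step N).trans ?_)
    gcongr
    rw [← Finset.mul_sum]
    have h6 : ∑ i ∈ Finset.range N, ρ ^ i ≤ 1 / (1 - ρ) := by
      have hr : ρ < 1 := by linarith
      have := geom_sum_mul_neg ρ N
      rw [le_div_iff₀ (by linarith), this]
      have := pow_pos hρ0 N
      linarith
    calc c * ∑ i ∈ Finset.range N, ρ ^ i ≤ c * (1 / (1 - ρ)) := by gcongr
      _ ≤ c * (1 / ((x - 1) / 2)) := by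
          gcongr
          linarith
      _ = _ := by field_simp
  have h7 : ∀ x ∈ Set.Ioc (1 : ℝ) 2, (M.totient : ℝ)⁻¹ / 2 ≤ (C + C0) * (x - 1) := by
    intro x hx
    have h8 := (hC hx).trans (key x hx)
    have hs : 0 < x - 1 := by have := hx.1; linarith
    have h9 : (M.totient : ℝ)⁻¹ / (x - 1) - 2 * c / (x - 1) = ((M.totient : ℝ)⁻¹ / 2) / (x - 1) := by
      rw [hc]; field_simp; norm_num
    have h10 : ((M.totient : ℝ)⁻¹ / 2) / (x - 1) ≤ C + C0 := by rw [← h9]; linarith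
    rwa [div_le_iff₀ hs] at h10
  set D := |C + C0| + 1 with hD
  have hD0 : 0 < D := by positivity
  have h11 := h7 (1 + min 1 ((M.totient : ℝ)⁻¹ / 4 / D)) ⟨by
    have : 0 < min 1 ((M.totient : ℝ)⁻¹ / 4 / D) := lt_min one_pos (by positivity)
    linarith, by
    have := min_le_left 1 ((M.totient : ℝ)⁻¹ / 4 / D)
    linarith⟩
  have h12 : (C + C0) * (1 + min 1 ((M.totient : ℝ)⁻¹ / 4 / D) - 1) ≤ D * ((M.totient : ℝ)⁻¹ / 4 / D) := by
    rw [add_sub_cancel_left]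
    apply mul_le_mul
    · rw [hD]; linarith [le_abs_self (C + C0)]
    · exact min_le_right _ _
    · exact (lt_min one_pos (by positivity)).le
    · exact hD0.le
  rw [mul_div_cancel₀ _ hD0.ne'] at h12
  linarith

open ArithmeticFunction.vonMangoldt in
lemma main_lower {M : ℕ} [NeZero M] (e V Y j : ℕ) (c : ℝ) (hY : Real.exp ((j : ℝ) + 1) ≤ Y)
    (h : c * Real.exp j ≤ ∑ n ∈ Finset.Ioc ⌊Real.exp j⌋₊ ⌊Real.exp ((j : ℝ) + 1)⌋₊, residueClass (e : ZMod M) n) :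
    (c * Real.exp j - V * Real.log Y) / 2 ≤
      ∑ n ∈ (Finset.Icc 1 Y).filter (fun n : ℕ => (e : ZMod M) = (n : ZMod M)), hh V Y n * gv j n := by
  classical
  set Bk := Finset.Ioc ⌊Real.exp j⌋₊ ⌊Real.exp ((j : ℝ) + 1)⌋₊ with hBk
  have hYn : ⌊Real.exp ((j : ℝ) + 1)⌋₊ ≤ Y := by
    have := Nat.floor_le_floor hY
    simpa using this
  have hsub : Bk ⊆ Finset.Icc 1 Y := by
    intro n hn
    rw [hBk, Finset.mem_Ioc] at hn
    rw [Finset.mem_Icc]; omega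
  set Ef := Bk.filter (fun n : ℕ => (e : ZMod M) = (n : ZMod M)) with hEf
  have h1 : ∑ n ∈ Bk, residueClass (e : ZMod M) n ≤ ∑ n ∈ Ef, hh V Y n + V * Real.log Y := by
    have h2 : ∑ n ∈ Bk, residueClass (e : ZMod M) n = ∑ n ∈ Ef, ArithmeticFunction.vonMangoldt n := by
      rw [hEf, Finset.sum_filter]
      refine Finset.sum_congr rfl fun n _ => ?_
      simp only [residueClass, Set.indicator_apply, Set.mem_ofPred_eq]
      simp only [eq_comm]
    have h3 : ∑ n ∈ Ef, ArithmeticFunction.vonMangoldt n = ∑ n ∈ Ef, hh V Y n + ∑ n ∈ Ef, gg V Y n := by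
      rw [← Finset.sum_add_distrib]
      refine Finset.sum_congr rfl fun n hn => ?_
      exact (hh_add_gg (Finset.mem_Icc.1 (hsub (Finset.mem_filter.1 hn).1)).2).symm
    have h4 : ∑ n ∈ Ef, gg V Y n ≤ V * Real.log Y :=
      (Finset.sum_le_sum_of_subset_of_nonneg ((Finset.filter_subset _ _).trans hsub) fun _ _ _ => gg_nonneg _ _ _).trans (sum_gg_le V Y)
    rw [h2, h3]; linarith
  have h5 : (∑ n ∈ Ef, hh V Y n) / 2 ≤ ∑ n ∈ Ef, hh V Y n * gv j n := by
    rw [Finset.sum_div]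
    refine Finset.sum_le_sum fun n hn => ?_
    have hn1 := Finset.mem_Ioc.1 (Finset.mem_filter.1 hn).1
    have h6 : Real.exp j < n := (Nat.floor_lt (Real.exp_pos _).le).1 hn1.1
    have h7 : (n : ℝ) ≤ Real.exp (j + 1) := (Nat.le_floor_iff (Real.exp_pos _).le).1 hn1.2
    have hn0 : (0 : ℝ) < n := (Real.exp_pos _).trans h6
    have h8 : (j : ℝ) ≤ Real.log n := by rw [Real.le_log_iff_exp_le hn0]; exact h6.le
    have h9 : Real.log n ≤ j + 1 := by rw [Real.log_le_iff_le_exp hn0]; exact h7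
    have h10 : (1 : ℝ) / 2 ≤ gv j n := by
      unfold gv
      have := Real.add_one_le_exp (-(Real.log n - j) ^ 2 / 2)
      nlinarith
    have := hh_nonneg V Y n
    nlinarith
  have h6 : ∑ n ∈ Ef, hh V Y n * gv j n ≤ ∑ n ∈ (Finset.Icc 1 Y).filter (fun n : ℕ => (e : ZMod M) = (n : ZMod M)), hh V Y n * gv j n :=
    Finset.sum_le_sum_of_subset_of_nonneg (Finset.filter_subset_filter _ hsub) fun n _ _ => mul_nonneg (hh_nonneg _ _ _) (gv_pos _ _).le
  linarith

/-- extraction of a prime from a lower bound for the weighted sum -/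
lemma extract_prime (V Y j : ℕ) (hj : 1 ≤ j) (cond : ℕ → Prop) [DecidablePred cond]
    (h : 2 * Real.exp (0.505 * j) * (1.01 * j) + Y * Real.log Y * Real.exp (-(j : ℝ) ^ 2 / 20000) <
      ∑ n ∈ (Finset.Icc 1 Y).filter cond, hh V Y n * gv j n) :
    ∃ p, p.Prime ∧ V < p ∧ Real.log p ≤ 1.01 * j ∧ cond p := by
  classical
  by_contra hcon
  push Not at hcon
  refine absurd h (not_lt.2 ?_)
  set x : ℝ := Real.exp (1.01 * j) with hx
  have hj' : (1 : ℝ) ≤ j := by exact_mod_cast hj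
  have hx1 : 1 ≤ x := by rw [hx]; exact Real.one_le_exp (by positivity)
  have hlY := Real.log_natCast_nonneg Y
  set lam : ℕ → ℝ := fun n => if n.Prime then 0 else ArithmeticFunction.vonMangoldt n with hlam
  have hlam0 : ∀ n, 0 ≤ lam n := by
    intro n; simp only [hlam]; split_ifs
    · exact le_rfl
    · exact ArithmeticFunction.vonMangoldt_nonneg
  have hnp : ∑ n ∈ Finset.Ioc 0 ⌊x⌋₊, lam n ≤ 2 * Real.exp (0.505 * j) * (1.01 * j) := by
    have h1 := Chebyshev.abs_psi_sub_theta_le_sqrt_mul_log hx1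
    have h2 : ∑ n ∈ Finset.Ioc 0 ⌊x⌋₊, lam n = Chebyshev.psi x - Chebyshev.theta x := by
      rw [Chebyshev.psi, Chebyshev.theta, Finset.sum_filter, ← Finset.sum_sub_distrib]
      refine Finset.sum_congr rfl fun n _ => ?_
      simp only [hlam]
      split_ifs with hp
      · rw [ArithmeticFunction.vonMangoldt_apply_prime hp]; ring
      · ring
    have h3 : Real.sqrt x = Real.exp (0.505 * j) := by
      rw [hx, Real.sqrt_eq_iff_mul_self_eq (Real.exp_pos _).le (Real.exp_pos _).le, ← Real.exp_add]; congr 1; ring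
    have h4 : Real.log x = 1.01 * j := by rw [hx, Real.log_exp]
    rw [h3, h4] at h1
    rw [h2]
    exact (le_abs_self _).trans h1
  have hterm : ∀ n ∈ (Finset.Icc 1 Y).filter cond, hh V Y n * gv j n ≤
      (if n ≤ ⌊x⌋₊ then lam n else 0) + Real.log Y * Real.exp (-(j : ℝ) ^ 2 / 20000) := by
    intro n hn
    obtain ⟨hn1, hn2⟩ := Finset.mem_filter.1 hn
    have hn0 : (0 : ℝ) < n := by exact_mod_cast (Finset.mem_Icc.1 hn1).1
    have hE : 0 ≤ Real.log Y * Real.exp (-(j : ℝ) ^ 2 / 20000) := by positivity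
    have hlog : n ≤ ⌊x⌋₊ ↔ Real.log n ≤ 1.01 * j := by
      rw [Nat.le_floor_iff (by positivity), hx, ← Real.log_le_iff_le_exp hn0]
    by_cases hh0 : hh V Y n = 0
    · rw [hh0, zero_mul]
      have := hlam0 n
      split_ifs <;> linarith
    · by_cases hxn : n ≤ ⌊x⌋₊
      · rw [if_pos hxn]
        have hnpr : ¬ n.Prime := fun hp => hcon n hp (hh_supp hh0).1 (hlog.1 hxn) hn2
        have e1 : hh V Y n * gv j n ≤ hh V Y n := mul_le_of_le_one_right (hh_nonneg _ _ _) (gv_le_one _ _)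
        have e2 : hh V Y n ≤ lam n := by
          simp only [hlam]; rw [if_neg hnpr]
          have := hh_add_gg (V := V) (Finset.mem_Icc.1 hn1).2
          have := gg_nonneg V Y n
          linarith
        linarith
      · rw [if_neg hxn, zero_add]
        rw [hlog, not_le] at hxn
        refine mul_le_mul (hh_le _ _ _) ?_ (gv_pos _ _).le hlY
        unfold gv
        apply Real.exp_le_exp.2
        nlinarith
  refine (Finset.sum_le_sum hterm).trans ?_
  rw [Finset.sum_add_distrib]
  refine add_le_add ?_ ?_
  · refine le_trans ?_ hnp
    rw [← Finset.sum_filter]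
    refine Finset.sum_le_sum_of_subset_of_nonneg ?_ fun n _ _ => hlam0 n
    intro n hn
    obtain ⟨a1, a2⟩ := Finset.mem_filter.1 hn
    have := Finset.mem_Icc.1 (Finset.mem_filter.1 a1).1
    rw [Finset.mem_Ioc]; omega
  · rw [Finset.sum_const, nsmul_eq_mul, ← mul_assoc]
    have : ((Finset.filter cond (Finset.Icc 1 Y)).card : ℝ) ≤ Y := by
      have := Finset.card_le_card (Finset.filter_subset cond (Finset.Icc 1 Y))
      rw [Nat.card_Icc] at this
      exact_mod_cast this
    gcongr

end

section

/-- disjoint pairs of subsets with congruent products -/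
def DP (P : Finset ℕ) (W : ℕ) : Finset (Finset ℕ × Finset ℕ) :=
  (P.powerset ×ˢ P.powerset).filter (fun x => Disjoint x.1 x.2 ∧ ((∏ p ∈ x.1, p : ℕ) : ZMod W) = ((∏ p ∈ x.2, p : ℕ) : ZMod W))

lemma small_subsets (P : Finset ℕ) (ρ : ℕ) (hP : P.card = 5 * ρ) :
    ((P.powerset.filter (fun S => S.card ≤ 2 * ρ)).card : ℝ) ≤ (243 / 8 : ℝ) ^ ρ := by
  have h1 : ∑ S ∈ P.powerset, (1 / 2 : ℝ) ^ S.card = (3 / 2) ^ (5 * ρ) := by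
    have := Finset.prod_one_add (f := fun _ : ℕ => (1 / 2 : ℝ)) P
    simp only [Finset.prod_const, hP] at this
    rw [← this]; norm_num
  have h2 : ((P.powerset.filter (fun S => S.card ≤ 2 * ρ)).card : ℝ) * (1 / 2) ^ (2 * ρ) ≤ (3 / 2) ^ (5 * ρ) := by
    rw [← h1, ← nsmul_eq_mul, ← Finset.sum_const]
    calc _ ≤ ∑ S ∈ P.powerset.filter (fun S => S.card ≤ 2 * ρ), (1 / 2 : ℝ) ^ S.card := by
          refine Finset.sum_le_sum fun S hS => ?_
          exact pow_le_pow_of_le_one (by norm_num) (by norm_num) (Finset.mem_filter.1 hS).2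
      _ ≤ _ := Finset.sum_le_sum_of_subset_of_nonneg (Finset.filter_subset _ _) fun _ _ _ => by positivity
  have h3 : ((243 / 8 : ℝ)) ^ ρ * (1 / 2) ^ (2 * ρ) = (3 / 2) ^ (5 * ρ) := by
    rw [pow_mul, pow_mul, ← mul_pow]; norm_num
  rw [← h3] at h2
  exact le_of_mul_le_mul_right h2 (by positivity)

lemma pairs_count (P : Finset ℕ) (ρ W : ℕ) (hW : 0 < W) (hP : P.card = 5 * ρ) (hcop : ∀ p ∈ P, Nat.Coprime p W) :
    (1024 : ℝ) ^ ρ ≤ W * (972 ^ ρ + 8 ^ ρ * (DP P W).card) := by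
  classical
  have : NeZero W := ⟨hW.ne'⟩
  set F : Finset ℕ → ZMod W := fun A => ((∏ p ∈ A, p : ℕ) : ZMod W) with hF
  have hFu : ∀ A ⊆ P, IsUnit (F A) := by
    intro A hA
    simp only [hF]
    rw [ZMod.isUnit_iff_coprime]
    exact Nat.Coprime.prod_left fun p hp => hcop p (hA hp)
  have hFm : ∀ A B : Finset ℕ, Disjoint A B → F (A ∪ B) = F A * F B := by
    intro A B h
    simp only [hF]
    rw [Finset.prod_union h, Nat.cast_mul]
  set E := (P.powerset ×ˢ P.powerset).filter (fun x => F x.1 = F x.2) with hE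
  have hE1 : (1024 : ℝ) ^ ρ ≤ W * E.card := by
    have h1 : E.card = ∑ c : ZMod W, ((P.powerset.filter (fun A => F A = c)).card) ^ 2 := by
      rw [Finset.card_eq_sum_card_fiberwise (f := fun x => F x.1) (t := Finset.univ) (fun _ _ => by simp)]
      refine Finset.sum_congr rfl fun c _ => ?_
      rw [sq, ← Finset.card_product]
      congr 1
      ext ⟨A, B⟩
      simp only [hE, Finset.mem_filter, Finset.mem_product]
      constructor
      · rintro ⟨⟨⟨a, b⟩, c⟩, d⟩; exact ⟨⟨a, d⟩, b, c ▸ d⟩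
      · rintro ⟨⟨a, b⟩, c, d⟩; exact ⟨⟨⟨a, c⟩, b.trans d.symm⟩, b⟩
    have h2 : ∑ c : ZMod W, (P.powerset.filter (fun A => F A = c)).card = 2 ^ (5 * ρ) := by
      rw [← hP, ← Finset.card_powerset]
      exact (Finset.card_eq_sum_card_fiberwise (f := F) (t := Finset.univ) (fun _ _ => by simp)).symm
    have h3 := sq_sum_le_card_mul_sum_sq (s := (Finset.univ : Finset (ZMod W))) (f := fun c => (((P.powerset.filter (fun A => F A = c)).card : ℕ) : ℝ))
    rw [Finset.card_univ, ZMod.card] at h3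
    have h4 : ((E.card : ℕ) : ℝ) = ∑ c : ZMod W, (((P.powerset.filter (fun A => F A = c)).card : ℕ) : ℝ) ^ 2 := by
      rw [h1]; push_cast; rfl
    rw [← h4, ← Nat.cast_sum, h2] at h3
    refine le_trans (le_of_eq ?_) h3
    push_cast
    rw [← pow_mul, mul_right_comm, pow_mul]; norm_num
  have hfib : ∀ x : Finset ℕ × Finset ℕ, x.1 ∪ x.2 = (x.1 \ x.2) ∪ (x.2 \ x.1) ∪ (x.1 ∩ x.2) := by
    intro x; ext p; simp only [Finset.mem_union, Finset.mem_sdiff, Finset.mem_inter]; tauto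
  set sd : Finset ℕ × Finset ℕ → Finset ℕ := fun x => (x.1 \ x.2) ∪ (x.2 \ x.1) with hsd
  have hsmall : ((E.filter (fun x => (sd x).card ≤ 2 * ρ)).card : ℝ) ≤ 972 ^ ρ := by
    have h1 : (E.filter (fun x => (sd x).card ≤ 2 * ρ)).card ≤ (P.powerset ×ˢ (P.powerset.filter (fun S => S.card ≤ 2 * ρ))).card := by
      refine Finset.card_le_card_of_injOn (fun x => (x.1, sd x)) ?_ ?_
      · intro x hx
        obtain ⟨h1, h2⟩ := Finset.mem_filter.1 hx
        have h3 := Finset.mem_product.1 (Finset.mem_filter.1 h1).1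
        rw [Finset.mem_powerset, Finset.mem_powerset] at h3
        simp only [Finset.coe_product, Set.mem_prod, Finset.mem_coe, Finset.mem_powerset, Finset.mem_filter]
        exact ⟨h3.1, Finset.union_subset (Finset.sdiff_subset.trans h3.1) (Finset.sdiff_subset.trans h3.2), h2⟩
      · rintro ⟨A, B⟩ _ ⟨A', B'⟩ _ h
        simp only [Prod.mk.injEq, hsd] at h
        obtain ⟨rfl, h⟩ := h
        congr 1
        ext p
        have := congrArg (fun s => p ∈ s) h
        simp only [Finset.mem_union, Finset.mem_sdiff, eq_iff_iff] at this
        tauto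
    rw [Finset.card_product, Finset.card_powerset, hP] at h1
    have h2 := small_subsets P ρ hP
    calc _ ≤ ((2 ^ (5 * ρ) * (P.powerset.filter (fun S => S.card ≤ 2 * ρ)).card : ℕ) : ℝ) := by exact_mod_cast h1
      _ = (2 : ℝ) ^ (5 * ρ) * (P.powerset.filter (fun S => S.card ≤ 2 * ρ)).card := by push_cast; rfl
      _ ≤ 2 ^ (5 * ρ) * (243 / 8 : ℝ) ^ ρ := by gcongr
      _ = 972 ^ ρ := by rw [pow_mul, ← mul_pow]; norm_num
  have hbig : (E.filter (fun x => ¬ (sd x).card ≤ 2 * ρ)).card ≤ 8 ^ ρ * (DP P W).card := by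
    set G : Finset ℕ × Finset ℕ → Finset ℕ × Finset ℕ := fun x => (x.1 \ x.2, x.2 \ x.1) with hG
    have h1 := Finset.card_le_mul_card_image (f := G) (E.filter (fun x => ¬ (sd x).card ≤ 2 * ρ)) (8 ^ ρ) ?_
    · refine h1.trans (Nat.mul_le_mul_left _ (Finset.card_le_card ?_))
      intro y hy
      obtain ⟨x, hx, rfl⟩ := Finset.mem_image.1 hy
      obtain ⟨hx1, hx2⟩ := Finset.mem_filter.1 (Finset.mem_filter.1 hx).1
      have h3 := Finset.mem_product.1 hx1
      rw [Finset.mem_powerset, Finset.mem_powerset] at h3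
      simp only [DP, Finset.mem_filter, Finset.mem_product, Finset.mem_powerset, hG]
      refine ⟨⟨Finset.sdiff_subset.trans h3.1, Finset.sdiff_subset.trans h3.2⟩, ?_, ?_⟩
      · exact disjoint_sdiff_sdiff
      · have e1 : F x.1 = F (x.1 \ x.2) * F (x.1 ∩ x.2) := by
          rw [← hFm _ _ (Finset.disjoint_sdiff_inter _ _), Finset.sdiff_union_inter]
        have e2 : F x.2 = F (x.2 \ x.1) * F (x.1 ∩ x.2) := by
          rw [Finset.inter_comm, ← hFm _ _ (Finset.disjoint_sdiff_inter _ _), Finset.sdiff_union_inter]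
        rw [e1, e2] at hx2
        exact (hFu (x.1 ∩ x.2) (Finset.inter_subset_left.trans h3.1)).mul_right_cancel hx2
    · intro y hy
      obtain ⟨x, hx, rfl⟩ := Finset.mem_image.1 hy
      have hx3 := (Finset.mem_filter.1 hx).2
      have hx4 := Finset.mem_product.1 (Finset.mem_filter.1 (Finset.mem_filter.1 hx).1).1
      rw [Finset.mem_powerset, Finset.mem_powerset] at hx4
      have hsub : sd x ⊆ P := Finset.union_subset (Finset.sdiff_subset.trans hx4.1) (Finset.sdiff_subset.trans hx4.2)
      have h2 : ((E.filter (fun x => ¬ (sd x).card ≤ 2 * ρ)).filter (fun z => G z = G x)).card ≤ ((P \ sd x).powerset).card := by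
        refine Finset.card_le_card_of_injOn (fun z => z.1 ∩ z.2) ?_ ?_
        · intro z hz
          obtain ⟨hz1, hz2⟩ := Finset.mem_filter.1 hz
          have hz4 := Finset.mem_product.1 (Finset.mem_filter.1 (Finset.mem_filter.1 hz1).1).1
          rw [Finset.mem_powerset, Finset.mem_powerset] at hz4
          have hsz : sd z = sd x := by
            simp only [hG, Prod.mk.injEq] at hz2
            simp only [hsd, hz2.1, hz2.2]
          rw [← hsz]
          simp only [Finset.mem_coe, Finset.mem_powerset]
          intro p hp
          rw [Finset.mem_inter] at hp
          refine Finset.mem_sdiff.2 ⟨hz4.1 hp.1, ?_⟩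
          simp only [hsd, Finset.mem_union, Finset.mem_sdiff]
          tauto
        · rintro ⟨A, B⟩ hz ⟨A', B'⟩ hz' h
          have h5 := (Finset.mem_filter.1 hz).2.trans (Finset.mem_filter.1 hz').2.symm
          simp only [hG, Prod.mk.injEq] at h5
          simp only at h
          have e1 : A = A' := by
            rw [← Finset.sdiff_union_inter A B, ← Finset.sdiff_union_inter A' B', h5.1, h]
          have e2 : B = B' := by
            rw [← Finset.sdiff_union_inter B A, ← Finset.sdiff_union_inter B' A', h5.2, Finset.inter_comm B A, Finset.inter_comm B' A', h]
          rw [e1, e2]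
      refine h2.trans ?_
      rw [Finset.card_powerset, Finset.card_sdiff_of_subset hsub, hP]
      calc 2 ^ (5 * ρ - (sd x).card) ≤ 2 ^ (3 * ρ) := Nat.pow_le_pow_right (by norm_num) (by omega)
        _ = 8 ^ ρ := by rw [pow_mul]; norm_num
  have hsplit := Finset.card_filter_add_card_filter_not (s := E) (fun x => (sd x).card ≤ 2 * ρ)
  have hbig' : ((E.filter (fun x => ¬ (sd x).card ≤ 2 * ρ)).card : ℝ) ≤ 8 ^ ρ * (DP P W).card := by exact_mod_cast hbig
  have hs' : ((E.filter (fun x => (sd x).card ≤ 2 * ρ)).card : ℝ) + ((E.filter (fun x => ¬ (sd x).card ≤ 2 * ρ)).card : ℝ) = E.card := by exact_mod_cast hsplit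
  refine hE1.trans ?_
  gcongr
  linarith

lemma sols_finite (m p : ℕ) (hm : 0 < m) (hp : 0 < p) :
    {a : Fin 3 → ℕ | (∀ i, 0 < a i) ∧ Monotone a ∧ (m : ℚ) / p = ∑ i, (1 : ℚ) / a i}.Finite := by
  refine Set.Finite.subset (Set.finite_Icc (0 : Fin 3 → ℕ) (fun _ => 100 * p ^ 4)) ?_
  rintro a ⟨h0, hmon, h⟩
  refine ⟨fun i => Nat.zero_le _, ?_⟩
  have a0 := h0 0
  have a1 := h0 1
  have a2 := h0 2
  have m01 : a 0 ≤ a 1 := hmon (by decide)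
  have m12 : a 1 ≤ a 2 := hmon (by decide)
  rw [Fin.sum_univ_three] at h
  set x := a 0
  set y := a 1
  set z := a 2
  have hN : m * (x * y * z) = p * (y * z + x * z + x * y) := by
    have hx : (x : ℚ) ≠ 0 := by positivity
    have hy : (y : ℚ) ≠ 0 := by positivity
    have hz : (z : ℚ) ≠ 0 := by positivity
    have hp' : (p : ℚ) ≠ 0 := by positivity
    field_simp at h
    have : (m : ℚ) * (x * y * z) = p * (y * z + x * z + x * y) := by linarith
    exact_mod_cast this
  have hx : x ≤ 3 * p := by
    have e1 : x * (y * z) ≤ m * (x * y * z) := by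
      rw [← mul_assoc]; exact Nat.le_mul_of_pos_left _ hm
    have e2 : p * (y * z + x * z + x * y) ≤ p * (3 * (y * z)) := by
      gcongr
      nlinarith
    have e3 : x * (y * z) ≤ (3 * p) * (y * z) := by rw [hN] at e1; nlinarith
    exact Nat.le_of_mul_le_mul_right e3 (by positivity)
  have hN' : (m : ℤ) * (x * y * z) = p * (y * z + x * z + x * y) := by exact_mod_cast hN
  have hpx : (0 : ℤ) < p := by exact_mod_cast hp
  have hx0 : (0 : ℤ) < x := by exact_mod_cast a0
  have hy0 : (0 : ℤ) < y := by exact_mod_cast a1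
  have hz0 : (0 : ℤ) < z := by exact_mod_cast a2
  have hyz : (y : ℤ) ≤ z := by exact_mod_cast m12
  have hy : (y : ℤ) ≤ 2 * p * x := by
    have e1 : ((m : ℤ) * x - p) * (y * z) = p * x * (y + z) := by linarith
    have e2 : 0 < (m : ℤ) * x - p := by
      have : 0 < ((m : ℤ) * x - p) * (y * z) := by rw [e1]; positivity
      exact pos_of_mul_pos_left this (by positivity)
    have e3 : (1 : ℤ) * (y * z) ≤ ((m : ℤ) * x - p) * (y * z) := by
      apply mul_le_mul_of_nonneg_right _ (by positivity); omega
    have e4 : (p : ℤ) * x * (y + z) ≤ p * x * (2 * z) := by gcongr; linarith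
    have e5 : (y : ℤ) * z ≤ (2 * p * x) * z := by linarith
    exact le_of_mul_le_mul_right e5 hz0
  have hz : (z : ℤ) ≤ p * x * y := by
    have e1 : ((m : ℤ) * x * y - p * y - p * x) * z = p * x * y := by linarith
    have e2 : 0 < ((m : ℤ) * x * y - p * y - p * x) := by
      have : 0 < ((m : ℤ) * x * y - p * y - p * x) * z := by rw [e1]; positivity
      exact pos_of_mul_pos_left this (by positivity)
    nlinarith
  have hy' : y ≤ 2 * p * x := by exact_mod_cast hy
  have hz' : z ≤ p * x * y := by exact_mod_cast hz
  have b1 : y ≤ 6 * p ^ 2 := by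
    calc y ≤ 2 * p * x := hy'
      _ ≤ 2 * p * (3 * p) := by gcongr
      _ = _ := by ring
  have b2 : z ≤ 18 * p ^ 4 := by
    calc z ≤ p * x * y := hz'
      _ ≤ p * (3 * p) * (6 * p ^ 2) := by gcongr
      _ = _ := by ring
  have hall : z ≤ 100 * p ^ 4 := by omega
  intro i
  exact (hmon (Fin.le_last i)).trans hall

theorem numSols_ge {m p A W u0 zz : ℕ} (hm : 0 < m) (hp : 0 < p) (hA : 0 < A) (hW : 0 < W) (hu0 : 0 < u0) (hAW : A ∣ W)
    (P : Finset ℕ) (hP : ∀ q ∈ P, q.Prime) (hzz : m * zz = 1 + p * A) (hdiv : u0 * ∏ q ∈ P, q ∣ zz) (huW : W ∣ u0 + 1) :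
    (DP P W).card ≤ 6 * numSols 3 m p := by
  classical
  set S := {a : Fin 3 → ℕ // (∀ i, 0 < a i) ∧ Monotone a ∧ (m : ℚ) / p = ∑ i, (1 : ℚ) / a i} with hS
  have hfin : Finite S := (sols_finite m p hm hp).to_subtype
  have hzz0 : 0 < zz := by
    rcases Nat.eq_zero_or_pos zz with h | h
    · subst h; omega
    · exact h
  set t : Finset ℕ × Finset ℕ → (Fin 3 → ℕ) := fun x =>
    ![p * zz, (u0 * (∏ q ∈ x.1, q) + ∏ q ∈ x.2, q) / A * (zz / (u0 * ∏ q ∈ x.1, q)), (u0 * (∏ q ∈ x.1, q) + ∏ q ∈ x.2, q) / A * (zz / ∏ q ∈ x.2, q)] with ht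
  have hpos : ∀ s ⊆ P, 0 < ∏ q ∈ s, q := fun s hs => Finset.prod_pos fun q hq => (hP q (hs hq)).pos
  have facts : ∀ x ∈ DP P W, x.1 ⊆ P ∧ x.2 ⊆ P ∧ Disjoint x.1 x.2 ∧ ∃ w a' b' : ℕ, 0 < w ∧ 0 < a' ∧ 0 < b' ∧ A * w = u0 * (∏ q ∈ x.1, q) + ∏ q ∈ x.2, q ∧
      zz = (u0 * ∏ q ∈ x.1, q) * a' ∧ zz = (∏ q ∈ x.2, q) * b' ∧ t x = ![p * zz, w * a', w * b'] := by
    intro x hx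
    simp only [DP, Finset.mem_filter, Finset.mem_product, Finset.mem_powerset] at hx
    obtain ⟨⟨h1, h2⟩, h3, h4⟩ := hx
    refine ⟨h1, h2, h3, ?_⟩
    have p1 := hpos _ h1
    have p2 := hpos _ h2
    obtain ⟨w, hw⟩ : A ∣ u0 * (∏ q ∈ x.1, q) + ∏ q ∈ x.2, q := by
      refine hAW.trans ?_
      rw [← ZMod.natCast_eq_zero_iff]
      rw [← ZMod.natCast_eq_zero_iff] at huW
      rw [Nat.cast_add, Nat.cast_mul, ← h4]
      push_cast at huW ⊢
      calc _ = ((u0 : ZMod W) + 1) * ∏ q ∈ x.1, (q : ZMod W) := by ring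
        _ = 0 := by rw [huW, zero_mul]
    obtain ⟨a', ha'⟩ : u0 * (∏ q ∈ x.1, q) ∣ zz := (mul_dvd_mul_left u0 (Finset.prod_dvd_prod_of_subset _ _ _ h1)).trans hdiv
    obtain ⟨b', hb'⟩ : (∏ q ∈ x.2, q) ∣ zz := ((Finset.prod_dvd_prod_of_subset _ _ _ h2).mul_left u0).trans hdiv
    have pu : 0 < u0 * (∏ q ∈ x.1, q) := Nat.mul_pos hu0 p1
    refine ⟨w, a', b', ?_, ?_, ?_, hw.symm, ha', hb', ?_⟩
    · rcases Nat.eq_zero_or_pos w with h | h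
      · subst h; omega
      · exact h
    · rcases Nat.eq_zero_or_pos a' with h | h
      · subst h; omega
      · exact h
    · rcases Nat.eq_zero_or_pos b' with h | h
      · subst h; omega
      · exact h
    · simp only [ht]
      rw [hw, Nat.mul_div_cancel_left _ hA]
      congr 2
      · nth_rewrite 1 [ha']; rw [Nat.mul_div_cancel_left _ pu]
      · nth_rewrite 1 [hb']; rw [Nat.mul_div_cancel_left _ p2]
  have tpos : ∀ x ∈ DP P W, ∀ i, 0 < t x i := by
    intro x hx i
    obtain ⟨_, _, _, w, a', b', hw, ha, hb, _, _, _, h⟩ := facts x hx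
    rw [h]
    fin_cases i
    · exact Nat.mul_pos hp hzz0
    · exact Nat.mul_pos hw ha
    · exact Nat.mul_pos hw hb
  have tsum : ∀ x ∈ DP P W, (m : ℚ) / p = ∑ i, (1 : ℚ) / (t x i : ℕ) := by
    intro x hx
    obtain ⟨_, _, _, w, a', b', hw, ha, hb, e1, e2, e3, h⟩ := facts x hx
    rw [h, Fin.sum_univ_three]
    simp only [Matrix.cons_val_zero, Matrix.cons_val_one, Matrix.cons_val]
    set u := u0 * ∏ q ∈ x.1, q
    set v := ∏ q ∈ x.2, q
    have hw' : (w : ℚ) ≠ 0 := by positivity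
    have ha' : (a' : ℚ) ≠ 0 := by positivity
    have hb' : (b' : ℚ) ≠ 0 := by positivity
    have hp' : (p : ℚ) ≠ 0 := by positivity
    have hz' : (zz : ℚ) ≠ 0 := by positivity
    have q1 : (A : ℚ) * w = u + v := by exact_mod_cast e1
    have q2 : (zz : ℚ) = u * a' := by exact_mod_cast e2
    have q3 : (zz : ℚ) = v * b' := by exact_mod_cast e3
    have q4 : (m : ℚ) * zz = 1 + p * A := by exact_mod_cast hzz
    have r1 : (m : ℚ) / p = 1 / (p * zz) + A / zz := by
      field_simp; linarith
    have r2 : (1 : ℚ) / (w * a') = u / (w * zz) := by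
      rw [div_eq_div_iff (by positivity) (by positivity), q2]; ring
    have r3 : (1 : ℚ) / (w * b') = v / (w * zz) := by
      rw [div_eq_div_iff (by positivity) (by positivity), q3]; ring
    push_cast
    rw [r1, r2, r3, add_assoc, ← add_div, ← q1]
    congr 1
    field_simp
  have tinj : ∀ x ∈ DP P W, ∀ y ∈ DP P W, t x = t y → x = y := by
    intro x hx y hy hxy
    obtain ⟨x1, x2, xd, w, a', b', hw, ha, hb, e1, e2, e3, h⟩ := facts x hx
    obtain ⟨y1, y2, yd, w', a2, b2, hw', ha2, hb2, f1, f2, f3, h'⟩ := facts y hy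
    rw [h, h'] at hxy
    have g1 := congrFun hxy 1
    have g2 := congrFun hxy 2
    simp only [Matrix.cons_val_one, Matrix.cons_val, Matrix.cons_val_zero] at g1 g2
    set a := ∏ q ∈ x.1, q with hadef
    set b := ∏ q ∈ x.2, q with hbdef
    set c := ∏ q ∈ y.1, q with hcdef
    set d := ∏ q ∈ y.2, q with hddef
    -- b * c = a * d
    have cop : ∀ s s' : Finset ℕ, s ⊆ P → s' ⊆ P → Disjoint s s' → Nat.Coprime (∏ q ∈ s, q) (∏ q ∈ s', q) := by
      intro s s' hs hs' hd
      refine Nat.Coprime.prod_left fun p1 h1 => Nat.Coprime.prod_right fun p2 h2 => ?_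
      rw [Nat.coprime_primes (hP _ (hs h1)) (hP _ (hs' h2))]
      rintro rfl
      exact Finset.disjoint_left.1 hd h1 h2
    have hset : ∀ s s' : Finset ℕ, s ⊆ P → s' ⊆ P → ∏ q ∈ s, q = ∏ q ∈ s', q → s = s' := by
      intro s s' hs hs' he
      have k1 := Nat.primeFactors_prod (s := s) (fun q hq => hP q (hs hq))
      have k2 := Nat.primeFactors_prod (s := s') (fun q hq => hP q (hs' hq))
      rw [← k1, ← k2, he]
    have key : b * c = d * a := by
      -- w a' = w' a2, w b' = w' b2 ; u0 a a' = zz = b b' ; u0 c a2 = d b2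
      have k1 : (w * a') * (w' * b2) = (w * b') * (w' * a2) := by rw [g1, g2]; ring
      have k2 : a' * b2 = b' * a2 := by
        have : (w * w') * (a' * b2) = (w * w') * (b' * a2) := by linarith
        exact Nat.eq_of_mul_eq_mul_left (Nat.mul_pos hw hw') this
      have k3 : u0 * a * a' = b * b' := by rw [← e2, ← e3]
      have k4 : u0 * c * a2 = d * b2 := by rw [← f2, ← f3]
      have k5 : (u0 * a' * a2 * b2 : ℕ) * (b * c) = (u0 * a' * a2 * b2) * (d * a) := by
        calc (u0 * a' * a2 * b2 : ℕ) * (b * c) = (u0 * c * a2) * b * (a' * b2) := by ring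
          _ = (d * b2) * b * (b' * a2) := by rw [k4, k2]
          _ = (b * b') * (d * b2 * a2) := by ring
          _ = (u0 * a * a') * (d * b2 * a2) := by rw [k3]
          _ = _ := by ring
      exact Nat.eq_of_mul_eq_mul_left (by positivity) k5
    have c1 : Nat.Coprime a b := cop _ _ x1 x2 xd
    have c2 : Nat.Coprime c d := cop _ _ y1 y2 yd
    have d1 : a = c := by
      apply Nat.dvd_antisymm
      · exact c1.dvd_of_dvd_mul_left (Dvd.intro_left _ key.symm)
      · exact c2.dvd_of_dvd_mul_left (Dvd.intro_left _ key)
    have d2 : b = d := by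
      rw [d1] at key
      have hc0 : 0 < c := hpos _ y1
      rw [mul_comm b, mul_comm d] at key
      rw [mul_comm c b, mul_comm c d] at key
      exact Nat.eq_of_mul_eq_mul_right hc0 key
    exact Prod.ext (hset _ _ x1 y1 d1) (hset _ _ x2 y2 d2)
  -- injection
  let Φ : {x // x ∈ DP P W} → S × Equiv.Perm (Fin 3) := fun x =>
    (⟨t x.1 ∘ Tuple.sort (t x.1), fun i => tpos x.1 x.2 _, Tuple.monotone_sort _, by
      rw [tsum x.1 x.2]
      exact (Equiv.sum_comp (Tuple.sort (t x.1)) (fun i => (1 : ℚ) / (t x.1 i : ℕ))).symm⟩, Tuple.sort (t x.1))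
  have hΦ : Function.Injective Φ := by
    intro x y h
    have h1 : t x.1 ∘ Tuple.sort (t x.1) = t y.1 ∘ Tuple.sort (t y.1) := congrArg (fun z : S × Equiv.Perm (Fin 3) => z.1.1) h
    have h2 : Tuple.sort (t x.1) = Tuple.sort (t y.1) := congrArg Prod.snd h
    clear h
    apply Subtype.ext
    apply tinj _ x.2 _ y.2
    rw [← h2] at h1
    funext i
    have h3 := congrFun h1 ((Tuple.sort (t x.1)).symm i)
    simp only [Function.comp_apply, Equiv.apply_symm_apply] at h3
    exact h3
  have hc := Nat.card_le_card_of_injective Φ hΦ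
  rw [Nat.card_prod, Nat.card_eq_fintype_card, Fintype.card_coe, Nat.card_eq_fintype_card (α := Equiv.Perm (Fin 3)), Fintype.card_perm] at hc
  have : (Fintype.card (Fin 3)).factorial = 6 := by simp [Nat.factorial]
  rw [this, mul_comm] at hc
  exact hc

end

section

lemma exists_neg_inv (g N : ℕ) (hN : 0 < N) (h : Nat.Coprime g N) : ∃ b, N ∣ b * g + 1 := by
  have : NeZero N := ⟨hN.ne'⟩
  refine ⟨(-(g : ZMod N)⁻¹).val, ?_⟩
  rw [← ZMod.natCast_eq_zero_iff]
  push_cast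
  rw [ZMod.natCast_zmod_val, neg_mul, mul_comm, ZMod.coe_mul_inv_eq_one g h]
  ring

lemma card_divisors_prod_le (P : Finset ℕ) (hP : ∀ p ∈ P, p.Prime) : (∏ p ∈ P, p).divisors.card ≤ 2 ^ P.card := by
  classical
  induction P using Finset.induction_on with
  | empty => simp
  | insert a s ha ih =>
    rw [Finset.prod_insert ha, Finset.card_insert_of_notMem ha, pow_succ, mul_comm]
    refine (card_divisors_mul_le _ _).trans ?_
    have h1 := ih fun p hp => hP p (Finset.mem_insert_of_mem hp)
    have h2 : a.divisors.card = 2 := by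
      rw [(hP a (Finset.mem_insert_self _ _)).divisors, Finset.card_pair]
      exact (hP a (Finset.mem_insert_self _ _)).one_lt.ne
    rw [h2]
    exact Nat.mul_le_mul_right 2 h1

/-- upper bound for the error term, with `Sx` bounding the smooth part -/
noncomputable def ErrB (U V Y : ℕ) (D y T τ : ℝ) : ℝ :=
  2 * (40 * (U : ℝ) ^ 2 * (U * D ^ 2 * (1 + Real.log U) ^ 2) * (1 + V) * Real.log Y * (1 + Real.log Y) ^ 2)
   + U * (6 * (Y : ℝ) ^ 3 * (U : ℝ) ^ 2 * Real.log Y * Real.exp (-(y ^ 2) / 2))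
   + Real.exp (y + 1 / 2) * (2 * ((1 + Real.log (Y * U : ℕ)) ^ 5 * (1 / T + (1 + Real.log Y) ^ 2 * Real.exp (-(τ ^ 2) / 4))))

lemma Err_le {Q U V Y : ℕ} {D y T τ : ℝ} (hQ : 0 < Q) (hQU : Q ≤ U) (hD : (Q.divisors.card : ℝ) ≤ D) :
    Err Q U V Y y T τ ≤ ErrB U V Y D y T τ := by
  have hlY := Real.log_natCast_nonneg Y
  have hlQ := Real.log_natCast_nonneg Q
  have hQ' : (0 : ℝ) < Q := by exact_mod_cast hQ
  have hQU' : (Q : ℝ) ≤ U := by exact_mod_cast hQU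
  have hll : Real.log Q ≤ Real.log U := Real.log_le_log hQ' hQU'
  have h1 : PV Q ^ 2 ≤ U * D ^ 2 * (1 + Real.log U) ^ 2 := by
    unfold PV
    rw [mul_pow, mul_pow, Real.sq_sqrt hQ'.le]
    gcongr
  unfold Err ErrB
  gcongr

/-- arithmetic conclusion -/
lemma arith_end {m M g w : ℕ} (hm : 0 < m) (hM : 0 < M) (hmM : m ∣ M) (hg : 0 < g) {e c p u0 ρ : ℕ}
    (hge : m ∣ g * e + 1) (k : Fin w → ℕ) (hk0 : ∀ i, 0 < k i) (hk : ∀ i, (k i : ZMod M) = 1)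
    (hu0 : 0 < u0) (huW : (g * M * ∏ i, k i) ∣ u0 + 1) (P : Finset ℕ) (hPc : P.card = 5 * ρ)
    (hP : ∀ p ∈ P, p.Prime) (hcop : Nat.Coprime (g * M * ∏ i, k i) (u0 * ∏ q ∈ P, q))
    (hce : (c : ZMod M) = e) (hcg : u0 * ∏ q ∈ P, q ∣ c * g + 1) (J : Finset (Fin w)) (hp : 0 < p)
    (hcp : (c : ZMod (M * u0 * ∏ q ∈ P, q)) = (((∏ i ∈ J, k i) * p : ℕ) : ZMod (M * u0 * ∏ q ∈ P, q)))
    (Wm : ℝ) (hWm : ((g * M * ∏ i, k i : ℕ) : ℝ) ≤ Wm) (hWρ : 2 * Wm * 972 ^ ρ ≤ 1024 ^ ρ) :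
    (p : ZMod M) = e ∧ (128 : ℝ) ^ ρ ≤ 12 * Wm * numSols 3 m p := by
  set W := g * M * ∏ i, k i with hW
  set N := u0 * ∏ q ∈ P, q with hN
  have hkp : 0 < ∏ i, k i := Finset.prod_pos fun i _ => hk0 i
  have hW0 : 0 < W := by positivity
  have hcp' : c ≡ (∏ i ∈ J, k i) * p [MOD (M * u0 * ∏ q ∈ P, q)] := (ZMod.natCast_eq_natCast_iff _ _ _).1 hcp
  have hcpM : c ≡ (∏ i ∈ J, k i) * p [MOD M] := hcp'.of_dvd ⟨u0 * ∏ q ∈ P, q, by ring⟩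
  have hcpN : c ≡ (∏ i ∈ J, k i) * p [MOD N] := hcp'.of_dvd ⟨M, by rw [hN]; ring⟩
  have hJ1 : ((∏ i ∈ J, k i : ℕ) : ZMod M) = 1 := by
    push_cast
    exact Finset.prod_eq_one fun i _ => hk i
  have hpe : (p : ZMod M) = e := by
    have := (ZMod.natCast_eq_natCast_iff _ _ _).2 hcpM
    rw [Nat.cast_mul, hJ1, one_mul] at this
    rw [← this, hce]
  refine ⟨hpe, ?_⟩
  set A := (∏ i ∈ J, k i) * g with hA
  have hA0 : 0 < A := Nat.mul_pos (Finset.prod_pos fun i _ => hk0 i) hg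
  have hAW : A ∣ W := by
    have h1 : (∏ i ∈ J, k i) ∣ ∏ i, k i := Finset.prod_dvd_prod_of_subset _ _ _ (Finset.subset_univ _)
    obtain ⟨t, ht⟩ := h1
    exact ⟨M * t, by rw [hW, ht, hA]; ring⟩
  have hdm : m ∣ 1 + p * A := by
    have hpe' : p ≡ e [MOD M] := (ZMod.natCast_eq_natCast_iff _ _ _).1 hpe
    have hJ' : (∏ i ∈ J, k i) ≡ 1 [MOD M] := (ZMod.natCast_eq_natCast_iff _ _ _).1 (by rw [hJ1, Nat.cast_one])
    have h2 : 1 + p * A ≡ 1 + e * (1 * g) [MOD M] := (Nat.ModEq.refl 1).add (hpe'.mul (hJ'.mul_right g))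
    refine ((h2.of_dvd hmM).dvd_iff (dvd_refl m)).2 ?_
    convert hge using 1; ring
  have hdN : N ∣ 1 + p * A := by
    have h2 : c * g + 1 ≡ (∏ i ∈ J, k i) * p * g + 1 [MOD N] := (hcpN.mul_right g).add_right 1
    have := (h2.dvd_iff (dvd_refl N)).1 hcg
    convert this using 1; rw [hA]; ring
  have hmN : Nat.Coprime m N := hcop.coprime_dvd_left (hmM.trans ⟨g * ∏ i, k i, by rw [hW]; ring⟩)
  obtain ⟨t, ht⟩ := hmN.mul_dvd_of_dvd_of_dvd hdm hdN
  have h3 := numSols_ge (m := m) (p := p) (A := A) (W := W) (u0 := u0) (zz := N * t) hm hp hA0 hW0 hu0 hAW P hP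
    (by rw [ht]; ring) ⟨t, rfl⟩ huW
  have h4 := pairs_count P ρ W hW0 hPc fun q hq =>
    (hcop.coprime_dvd_right ((Finset.dvd_prod_of_mem _ hq).trans ⟨u0, by rw [hN]; ring⟩)).symm
  have h3' : ((DP P W).card : ℝ) ≤ 6 * numSols 3 m p := by exact_mod_cast h3
  have h5 : (1024 : ℝ) ^ ρ ≤ Wm * (972 ^ ρ + 8 ^ ρ * (6 * numSols 3 m p)) := by
    have hWm0 : (0 : ℝ) ≤ Wm := le_trans (by positivity) hWm
    refine h4.trans ?_
    gcongr
  have h6 : (1024 : ℝ) ^ ρ = 128 ^ ρ * 8 ^ ρ := by rw [← mul_pow]; norm_num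
  have h7 : (0 : ℝ) < 8 ^ ρ := by positivity
  have h8 : (128 : ℝ) ^ ρ * 8 ^ ρ ≤ 12 * Wm * numSols 3 m p * 8 ^ ρ := by
    rw [← h6]; nlinarith
  exact le_of_mul_le_mul_right h8 h7

/-- nonasymptotic assembly -/
theorem assembly {m M g e : ℕ} (hm : 0 < m) (hM : 0 < M) (hmM : m ∣ M) (hg : 0 < g) (heM : Nat.Coprime e M)
    (hge : m ∣ g * e + 1) (U V Y j D0 w n H D1 Z c0 ρ Wm : ℕ) (T c R : ℝ)
    (hWm : Wm = g * M * (1 + M * (4 * D0)) ^ w)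
    (hj : 1 ≤ j) (hD0 : 0 < D0) (hH1 : 1 ≤ H) (hZ : 0 < Z) (hT : 0 < T)
    (hV1 : 1 ≤ V) (hVY : V ≤ Y) (hUY : U ≤ Y) (hy : 2 * (j : ℝ) ≤ Real.log Y) (hY : Real.exp ((j : ℝ) + 1) ≤ Y)
    (hcond : 2 * (((300 : ℕ) * Real.log Y) ^ (2 * 300) * (1 + (300 : ℕ) * Real.log Y)) * ((U : ℝ) ^ 6 * (3 + 2 * (j : ℝ)) / (V : ℝ) ^ 300) ≤ ((1 / T) ^ 300) ^ 2)
    (hR : RB Y 300 T ≤ R) (hRn : R * n < H) (h3 : U * H ^ (n * n) < D1 ^ n) (h4 : M * D1 * Z ^ c0 ≤ D0)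
    (h5 : Nat.log 2 Wm + Nat.log 2 (Wm * (H + 1)) + 2 * (5 * ρ) ≤ ((Finset.Icc 1 Z).filter Nat.Prime).card)
    (h6 : R < Real.exp ((c0 : ℝ) / 2))
    (hQU : M * (Wm * (H + 1)) * Z ^ (5 * ρ) ≤ U) (hSV : M * (Wm * (H + 1)) ≤ V) (hZV : Z ≤ V)
    (hsum : c * Real.exp j ≤ ∑ n ∈ Finset.Ioc ⌊Real.exp j⌋₊ ⌊Real.exp ((j : ℝ) + 1)⌋₊, ArithmeticFunction.vonMangoldt.residueClass (e : ZMod M) n)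
    (hmain : U * (2 * Real.exp (0.505 * j) * (1.01 * j) + Y * Real.log Y * Real.exp (-(j : ℝ) ^ 2 / 20000)) <
      (c * Real.exp j - V * Real.log Y) / 2 - ErrB U V Y ((M * (Wm * (H + 1)) * 2 ^ (5 * ρ) : ℕ) : ℝ) j T j
       - R * Real.sqrt (R * (5 / 8 : ℝ) ^ w) * (Real.exp (j + 1 / 2) * (1 + Real.log Y) ^ 2))
    (hWρ : 2 * (Wm : ℝ) * 972 ^ ρ ≤ 1024 ^ ρ) :
    ∃ p, p.Prime ∧ V < p ∧ Real.log p ≤ 1.01 * j ∧ (p : ZMod M) = e ∧ (128 : ℝ) ^ ρ ≤ 12 * Wm * numSols 3 m p := by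
  classical
  have : NeZero M := ⟨hM.ne'⟩
  have hbc : ∀ s : Finset (Σ d : ℕ, DirichletCharacter ℂ d), (∀ x ∈ s, x ∈ BadSet V Y U T j) → (s.card : ℝ) ≤ R :=
    fun s hs => (bad_card V Y U 300 T j hV1 hVY hT (by positivity) hcond s hs).trans hR
  set B := (bad_finite (V := V) (Y := Y) (Qm := U) (T := T) (τ := (j : ℝ))).toFinset with hB
  have hBm : ∀ x, x ∈ B ↔ x ∈ BadSet V Y U T j := fun x => by rw [hB, Set.Finite.mem_toFinset]
  have hBR : (B.card : ℝ) ≤ R := hbc B fun x hx => (hBm x).1 hx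
  have hR0 : 0 ≤ R := le_trans (by positivity) hBR
  obtain ⟨k, u0, P, hk, hk0, hW, hu0, hu0le, huW, hPc, hP, hsel⟩ := selection (M := M) (g := g) (U := U) (D0 := D0) (w := w)
    (n := n) (H := H) (D1 := D1) (Z := Z) (c0 := c0) (r := 5 * ρ) hM hg hD0 hH1 B
    (fun x hx => by
      have := (hBm x).1 hx
      exact ⟨this.1, this.2.1, this.2.2.1⟩)
    (by
      have : ((B.card * n : ℕ) : ℝ) < H := by
        push_cast
        exact lt_of_le_of_lt (by gcongr) hRn
      exact_mod_cast this)
    h3 h4 hZ (by rw [← hWm]; exact h5) (lt_of_le_of_lt hBR h6)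
  rw [← hWm] at hW hu0le
  set W := g * M * ∏ i, k i with hWd
  have hkp : 0 < ∏ i, k i := Finset.prod_pos fun i _ => hk0 i
  have hW0 : 0 < W := by positivity
  set q := ∏ p ∈ P, p with hq
  have hq0 : 0 < q := Finset.prod_pos fun p hp => (hP p hp).1.pos
  have hcopu : Nat.Coprime W u0 := by
    rw [Nat.coprime_iff_gcd_eq_one, ← Nat.dvd_one, ← Nat.dvd_add_right (Nat.gcd_dvd_right W u0)]
    exact (Nat.gcd_dvd_left W u0).trans huW
  have hcopq : Nat.Coprime W q := Nat.Coprime.prod_right fun p hp =>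
    (((hP p hp).1.coprime_iff_not_dvd).2 (hP p hp).2.2.1).symm
  have hcop : Nat.Coprime W (u0 * q) := Nat.Coprime.mul_right hcopu hcopq
  have hMW : M ∣ W := ⟨g * ∏ i, k i, by rw [hWd]; ring⟩
  have hgW : g ∣ W := ⟨M * ∏ i, k i, by rw [hWd]; ring⟩
  have hN0 : 0 < u0 * q := by positivity
  have hMN : Nat.Coprime M (u0 * q) := hcop.coprime_dvd_left hMW
  have hgN : Nat.Coprime g (u0 * q) := hcop.coprime_dvd_left hgW
  obtain ⟨b, hb⟩ := exists_neg_inv g (u0 * q) hN0 hgN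
  obtain ⟨cc, hcM, hcN⟩ := Nat.chineseRemainder hMN e b
  have hcg : u0 * q ∣ cc * g + 1 := ((((hcN.mul_right g).add_right 1)).dvd_iff (dvd_refl _)).2 hb
  have hcce : (cc : ZMod M) = e := (ZMod.natCast_eq_natCast_iff _ _ _).2 hcM
  set Q := M * u0 * q with hQ
  have hQ0 : 0 < Q := by positivity
  have : NeZero Q := ⟨hQ0.ne'⟩
  have hMQ : M ∣ Q := ⟨u0 * q, by rw [hQ]; ring⟩
  have hccop : Nat.Coprime cc Q := by
    rw [hQ, mul_assoc]
    refine Nat.Coprime.mul_right ?_ ?_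
    · rw [Nat.coprime_iff_gcd_eq_one, hcM.gcd_eq]; exact heM
    · rw [Nat.coprime_iff_gcd_eq_one, ← Nat.dvd_one]
      have h1 : Nat.gcd cc (u0 * q) ∣ cc * g + 1 := (Nat.gcd_dvd_right _ _).trans hcg
      rwa [Nat.dvd_add_right ((Nat.gcd_dvd_left cc (u0 * q)).mul_right g)] at h1
  have hkQ : ∀ i, Nat.Coprime (k i) Q := by
    intro i
    rw [hQ, mul_assoc]
    refine Nat.Coprime.mul_right ?_ ?_
    · rw [← ZMod.isUnit_iff_coprime, hk i]; exact isUnit_one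
    · exact hcop.coprime_dvd_left ((Finset.dvd_prod_of_mem k (Finset.mem_univ i)).trans ⟨g * M, by rw [hWd]; ring⟩)
  have hqZ : q ≤ Z ^ (5 * ρ) := by
    rw [← hPc]; exact Finset.prod_le_pow_card _ _ _ fun p hp => (hP p hp).2.1
  have hMu : M * u0 ≤ M * (Wm * (H + 1)) := Nat.mul_le_mul_left _ hu0le
  have hQle : Q ≤ U := (Nat.mul_le_mul hMu hqZ).trans hQU
  have hVp : ∀ p, p.Prime → p ∣ Q → p ≤ V := by
    intro p hp hpd
    rcases (hp.dvd_mul).1 hpd with h | h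
    · exact (Nat.le_of_dvd (by positivity) h).trans (hMu.trans hSV)
    · obtain ⟨r, hr, hpr⟩ := (hp.prime.dvd_finsetProd_iff _).1 h
      rw [(Nat.prime_dvd_prime_iff_eq hp (hP r hr).1).1 hpr]
      exact (hP r hr).2.1.trans hZV
  have hdiv : (Q.divisors.card : ℝ) ≤ ((M * (Wm * (H + 1)) * 2 ^ (5 * ρ) : ℕ) : ℝ) := by
    have h1 : Q.divisors.card ≤ M * (Wm * (H + 1)) * 2 ^ (5 * ρ) := by
      refine (card_divisors_mul_le _ _).trans (Nat.mul_le_mul ((Nat.card_divisors_le_self _).trans hMu) ?_)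
      rw [← hPc]; exact card_divisors_prod_le P fun p hp => (hP p hp).1
    exact_mod_cast h1
  obtain ⟨J, hJ⟩ := prime_ap hMQ U V Y hQle hUY j T j (by positivity) hy hT (by positivity) k hk hkQ hVp cc e hccop hcce
    R (Real.sqrt (R * (5 / 8 : ℝ) ^ w)) (Real.sqrt_nonneg _) hbc (by
      intro χ hχM hχB
      apply Real.le_sqrt_of_sq_le
      have hcd : ¬ χ.conductor ∣ M := fun h => hχM ((DirichletCharacter.mem_conductorSet_iff_conductor_dvd χ hMQ).2 h)
      have h1 := hsel _ ((hBm _).2 hχB) χ.conductor_dvd_level hcd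
      have h2 : ‖SS k χ‖ ^ 2 = ∏ i, ‖(1 + χ.primitiveCharacter (k i : ZMod χ.conductor)) / 2‖ ^ 2 := by
        unfold SS
        rw [norm_prod, ← Finset.prod_pow]
        refine Finset.prod_congr rfl fun i _ => ?_
        rw [prim_nat χ _ (hkQ i)]
      rw [h2]
      refine h1.trans ?_
      gcongr)
  have hlow := main_lower e V Y j c hY hsum
  have hErr := Err_le (V := V) (Y := Y) (y := j) (T := T) (τ := j) hQ0 hQle hdiv
  set S := ∑ n ∈ (Finset.Icc 1 Y).filter (fun n : ℕ => (e : ZMod M) = (n : ZMod M)), hh V Y n * gv j n with hS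
  have hS0 : 0 ≤ S := Finset.sum_nonneg fun n _ => mul_nonneg (hh_nonneg _ _ _) (gv_pos _ _).le
  have hφM : (1 : ℝ) ≤ M.totient := by exact_mod_cast Nat.totient_pos.2 hM
  have hφQ0 : (0 : ℝ) < Q.totient := by exact_mod_cast Nat.totient_pos.2 hQ0
  have hφQ : (Q.totient : ℝ) ≤ U := by exact_mod_cast (Nat.totient_le Q).trans hQle
  have hlY := Real.log_natCast_nonneg Y
  obtain ⟨p, hp, hVp', hlp, hpc⟩ := extract_prime V Y j hj (fun n : ℕ => (cc : ZMod Q) = (((∏ i ∈ J, k i) * n : ℕ) : ZMod Q)) (by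
    refine lt_of_lt_of_le ?_ hJ
    rw [lt_div_iff₀ hφQ0]
    have e1 : (2 * Real.exp (0.505 * j) * (1.01 * j) + Y * Real.log Y * Real.exp (-(j : ℝ) ^ 2 / 20000)) * Q.totient
        ≤ U * (2 * Real.exp (0.505 * j) * (1.01 * j) + Y * Real.log Y * Real.exp (-(j : ℝ) ^ 2 / 20000)) := by
      rw [mul_comm]
      exact mul_le_mul_of_nonneg_right hφQ (by positivity)
    have e2 : S ≤ M.totient * S := le_mul_of_one_le_left hS0 hφM
    linarith)
  have hfin := arith_end hm hM hmM hg hge k hk0 hk hu0 huW P hPc (fun p hp => (hP p hp).1) hcop hcce hcg J hp.pos hpc (Wm : ℝ)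
    (by exact_mod_cast hW) hWρ
  exact ⟨p, hp, hVp', hlp, hfin.1, hfin.2⟩

end

section

open Filter

lemma ev_ge (K : ℝ) : ∀ᶠ j : ℕ in atTop, K ≤ (j : ℝ) := tendsto_natCast_atTop_atTop.eventually_ge_atTop K

lemma ev_log_ge (K : ℝ) : ∀ᶠ j : ℕ in atTop, K ≤ Real.log j :=
  (Real.tendsto_log_atTop.comp tendsto_natCast_atTop_atTop).eventually_ge_atTop K

lemma ev_rpow_ge (K a : ℝ) (ha : 0 < a) : ∀ᶠ j : ℕ in atTop, K ≤ (j : ℝ) ^ a :=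
  ((tendsto_rpow_atTop ha).comp tendsto_natCast_atTop_atTop).eventually_ge_atTop K

lemma ev_pow_exp (K : ℝ) (n : ℕ) (a : ℝ) (ha : 0 < a) : ∀ᶠ j : ℕ in atTop, K * (j : ℝ) ^ n ≤ Real.exp (a * j) := by
  have h := (isLittleO_pow_exp_pos_mul_atTop n ha).bound (c := 1 / (|K| + 1)) (by positivity)
  filter_upwards [tendsto_natCast_atTop_atTop.eventually h] with j hj
  rw [Real.norm_of_nonneg (by positivity), Real.norm_of_nonneg (by positivity), one_div, inv_mul_eq_div, le_div_iff₀ (by positivity)] at hj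
  have h1 : (0 : ℝ) ≤ (j : ℝ) ^ n := by positivity
  nlinarith [le_abs_self K]

lemma ev_log_rpow (K : ℝ) (n : ℕ) (a : ℝ) (ha : 0 < a) : ∀ᶠ j : ℕ in atTop, K * Real.log j ^ n ≤ (j : ℝ) ^ a := by
  have h := (isLittleO_log_rpow_rpow_atTop (n : ℝ) ha).bound (c := 1 / (|K| + 1)) (by positivity)
  filter_upwards [tendsto_natCast_atTop_atTop.eventually h] with j hj
  have hL := Real.log_natCast_nonneg j
  rw [Real.rpow_natCast, Real.norm_of_nonneg (by positivity), Real.norm_of_nonneg (by positivity), one_div, inv_mul_eq_div, le_div_iff₀ (by positivity)] at hj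
  have h1 : (0 : ℝ) ≤ Real.log j ^ n := by positivity
  nlinarith [le_abs_self K]

noncomputable def pU (j : ℕ) : ℕ := ⌈Real.exp (0.32 * j)⌉₊
noncomputable def pV (j : ℕ) : ℕ := ⌈Real.exp (0.01 * j)⌉₊
noncomputable def pY (j : ℕ) : ℕ := ⌈Real.exp (2 * j)⌉₊
noncomputable def pZ (j : ℕ) : ℕ := ⌊(j : ℝ) ^ (1.02 : ℝ)⌋₊
noncomputable def pc0 (j : ℕ) : ℕ := ⌈14002 * Real.log j⌉₊
noncomputable def pw (j : ℕ) : ℕ := ⌈60000 * Real.log j⌉₊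
noncomputable def pn (j : ℕ) : ℕ := ⌈(j : ℝ) ^ (0.4 : ℝ)⌉₊
noncomputable def pD1 (j : ℕ) : ℕ := ⌈Real.exp ((j : ℝ) ^ (0.66 : ℝ))⌉₊
noncomputable def prho (j : ℕ) : ℕ := ⌊0.319 * (j : ℝ) / (5.1 * Real.log j)⌋₊
noncomputable def pD0 (M j : ℕ) : ℕ := M * pD1 j * pZ j ^ pc0 j
noncomputable def pW (M g j : ℕ) : ℕ := g * M * (1 + M * (4 * pD0 M j)) ^ pw j
noncomputable def pS (M g j : ℕ) : ℕ := M * (pW M g j * (j ^ 8000 + 1))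

lemma ceil_le_two_mul' {y : ℝ} (hy : 1 ≤ y) : (⌈y⌉₊ : ℝ) ≤ 2 * y := by
  have := Nat.ceil_lt_add_one (by linarith : 0 ≤ y); linarith

lemma pU_le (j : ℕ) : (pU j : ℝ) ≤ 2 * Real.exp (0.32 * j) := ceil_le_two_mul' (Real.one_le_exp (by positivity))
lemma pV_le (j : ℕ) : (pV j : ℝ) ≤ 2 * Real.exp (0.01 * j) := ceil_le_two_mul' (Real.one_le_exp (by positivity))
lemma pY_le (j : ℕ) : (pY j : ℝ) ≤ 2 * Real.exp (2 * j) := ceil_le_two_mul' (Real.one_le_exp (by positivity))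
lemma le_pU (j : ℕ) : Real.exp (0.32 * j) ≤ pU j := Nat.le_ceil _
lemma le_pV (j : ℕ) : Real.exp (0.01 * j) ≤ pV j := Nat.le_ceil _
lemma le_pY (j : ℕ) : Real.exp (2 * j) ≤ pY j := Nat.le_ceil _
lemma pU_pos (j : ℕ) : (0 : ℝ) < pU j := (Real.exp_pos _).trans_le (le_pU j)
lemma pV_pos (j : ℕ) : (0 : ℝ) < pV j := (Real.exp_pos _).trans_le (le_pV j)
lemma pY_pos (j : ℕ) : (0 : ℝ) < pY j := (Real.exp_pos _).trans_le (le_pY j)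

lemma two_le_exp {j : ℕ} (hj : 1 ≤ j) : 2 ≤ Real.exp j := by
  have : (1 : ℝ) ≤ j := by exact_mod_cast hj
  have := Real.add_one_le_exp (j : ℝ); linarith

lemma log_pY_le {j : ℕ} (hj : 1 ≤ j) : Real.log (pY j) ≤ 3 * j := by
  rw [Real.log_le_iff_le_exp (pY_pos j)]
  calc _ ≤ 2 * Real.exp (2 * j) := pY_le j
    _ ≤ Real.exp j * Real.exp (2 * j) := by gcongr; exact two_le_exp hj
    _ = _ := by rw [← Real.exp_add]; congr 1; ring

lemma pU_le_exp {j : ℕ} (hj : 2 ≤ j) : (pU j : ℝ) ≤ Real.exp j := by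
  have h2 : (2 : ℝ) ≤ j := by exact_mod_cast hj
  calc _ ≤ 2 * Real.exp (0.32 * j) := pU_le j
    _ ≤ Real.exp (0.68 * j) * Real.exp (0.32 * j) := by
        gcongr
        have := Real.add_one_le_exp (0.68 * j : ℝ); linarith
    _ = _ := by rw [← Real.exp_add]; congr 1; ring

lemma log_pU_le {j : ℕ} (hj : 2 ≤ j) : Real.log (pU j) ≤ j := by
  rw [Real.log_le_iff_le_exp (pU_pos j)]; exact pU_le_exp hj

lemma le_log_pY (j : ℕ) : 2 * (j : ℝ) ≤ Real.log (pY j) := by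
  rw [Real.le_log_iff_exp_le (pY_pos j)]; exact le_pY j

lemma log_pYU_le {j : ℕ} (hj : 2 ≤ j) : Real.log (pY j * pU j : ℕ) ≤ 4 * j := by
  push_cast
  rw [Real.log_mul (pY_pos j).ne' (pU_pos j).ne']
  have := log_pY_le (j := j) (by omega)
  have := log_pU_le hj
  linarith

lemma pV_le_pY (j : ℕ) : pV j ≤ pY j := Nat.ceil_mono (Real.exp_le_exp.2 (by have : (0 : ℝ) ≤ j := by positivity
                                                                             linarith))
lemma pU_le_pY (j : ℕ) : pU j ≤ pY j := Nat.ceil_mono (Real.exp_le_exp.2 (by have : (0 : ℝ) ≤ j := by positivity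
                                                                             linarith))

lemma pZ_le {j : ℕ} (hj : 1 ≤ j) : (pZ j : ℝ) ≤ Real.exp (1.02 * Real.log j) := by
  have h0 : (0 : ℝ) < j := by exact_mod_cast hj
  unfold pZ
  refine (Nat.floor_le (by positivity)).trans ?_
  rw [Real.rpow_def_of_pos h0, mul_comm]

/-- the smooth part is small -/
lemma ev_S (M g : ℕ) (hM : 0 < M) (hg : 0 < g) :
    ∀ᶠ j : ℕ in atTop, (pS M g j : ℝ) ≤ Real.exp (0.001 * (j / Real.log j)) := by
  set K0 : ℝ := Real.log (10 * M ^ 2) with hK0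
  set K1 : ℝ := Real.log (2 * g * M ^ 2) with hK1
  have hM1 : (1 : ℝ) ≤ M := by exact_mod_cast hM
  have hg1 : (1 : ℝ) ≤ g := by exact_mod_cast hg
  have hK00 : 0 ≤ K0 := Real.log_nonneg (by nlinarith)
  have hK10 : 0 ≤ K1 := Real.log_nonneg (by nlinarith [mul_le_mul hg1 hM1 (by norm_num) (by linarith)])
  filter_upwards [ev_log_ge 1, ev_ge 3, ev_log_rpow ((120000 * (K0 + 30001) + K1 + 8000) * 1000) 4 0.34 (by norm_num)] with j hL hj hlog
  set L := Real.log j with hLd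
  have hj0 : (0 : ℝ) < j := by linarith
  have hj1 : 1 ≤ j := by have : (1 : ℝ) ≤ j := by linarith
                         exact_mod_cast this
  set y := (j : ℝ) ^ (0.66 : ℝ) with hy
  have hy1 : 1 ≤ y := Real.one_le_rpow (by linarith) (by norm_num)
  have hD1 : (pD1 j : ℝ) ≤ 2 * Real.exp y := ceil_le_two_mul' (Real.one_le_exp (by linarith))
  have hc0 : (pc0 j : ℝ) ≤ 28004 * L := (ceil_le_two_mul' (by linarith)).trans (by linarith)
  have hw : (pw j : ℝ) ≤ 120000 * L := (ceil_le_two_mul' (by linarith)).trans (by linarith)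
  have hZ := pZ_le hj1
  have hZc : (pZ j : ℝ) ^ pc0 j ≤ Real.exp (30000 * L ^ 2) := by
    calc _ ≤ Real.exp (1.02 * L) ^ pc0 j := by gcongr
      _ = Real.exp (pc0 j * (1.02 * L)) := by rw [Real.exp_nat_mul]
      _ ≤ _ := by apply Real.exp_le_exp.2; nlinarith
  have hD0 : (pD0 M j : ℝ) ≤ M * (2 * Real.exp y) * Real.exp (30000 * L ^ 2) := by
    unfold pD0; push_cast; gcongr
  have hbase : (1 : ℝ) + M * (4 * pD0 M j) ≤ Real.exp (K0 + y + 30000 * L ^ 2) := by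
    rw [Real.exp_add, Real.exp_add, hK0, Real.exp_log (by positivity)]
    have e1 : 1 ≤ Real.exp y := Real.one_le_exp (by linarith)
    have e2 : 1 ≤ Real.exp (30000 * L ^ 2) := Real.one_le_exp (by positivity)
    have e3 : 1 ≤ (M : ℝ) ^ 2 * Real.exp y * Real.exp (30000 * L ^ 2) := by
      have : (1 : ℝ) ≤ (M : ℝ) ^ 2 := one_le_pow₀ hM1
      exact one_le_mul_of_one_le_of_one_le (one_le_mul_of_one_le_of_one_le this e1) e2
    have e4 : (M : ℝ) * (4 * pD0 M j) ≤ M * (4 * (M * (2 * Real.exp y) * Real.exp (30000 * L ^ 2))) := by gcongr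
    nlinarith
  have hpow : ((1 : ℝ) + M * (4 * pD0 M j)) ^ pw j ≤ Real.exp (120000 * L * (K0 + y + 30000 * L ^ 2)) := by
    calc _ ≤ Real.exp (K0 + y + 30000 * L ^ 2) ^ pw j := by gcongr
      _ = Real.exp (pw j * (K0 + y + 30000 * L ^ 2)) := by rw [Real.exp_nat_mul]
      _ ≤ _ := by
        apply Real.exp_le_exp.2
        have : 0 ≤ K0 + y + 30000 * L ^ 2 := by positivity
        gcongr
  have hH : (j : ℝ) ^ 8000 + 1 ≤ 2 * Real.exp (8000 * L) := by
    have e1 : (j : ℝ) ^ 8000 = Real.exp (8000 * L) := by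
      rw [show (8000 : ℝ) * L = ((8000 : ℕ) : ℝ) * L by norm_num, Real.exp_nat_mul, hLd, Real.exp_log hj0]
    rw [e1]
    have := Real.one_le_exp (by positivity : 0 ≤ 8000 * L)
    linarith
  have hS : (pS M g j : ℝ) ≤ Real.exp (K1 + 8000 * L + 120000 * L * (K0 + y + 30000 * L ^ 2)) := by
    unfold pS pW
    push_cast
    rw [Real.exp_add, Real.exp_add, hK1, Real.exp_log (by positivity)]
    calc _ ≤ (M : ℝ) * (g * M * Real.exp (120000 * L * (K0 + y + 30000 * L ^ 2)) * (2 * Real.exp (8000 * L))) := by gcongr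
      _ = _ := by ring
  refine hS.trans (Real.exp_le_exp.2 ?_)
  rw [← mul_div_assoc, le_div_iff₀ (by linarith)]
  have hjy : (j : ℝ) = y * (j : ℝ) ^ (0.34 : ℝ) := by
    rw [hy, ← Real.rpow_add hj0]; norm_num
  have h1 : y * ((120000 * (K0 + 30001) + K1 + 8000) * 1000 * L ^ 4) ≤ j := by
    rw [hjy]; gcongr
  have hL2 : L ≤ L ^ 4 := le_self_pow₀ hL (by norm_num)
  have hL3 : L ^ 2 ≤ L ^ 4 := pow_le_pow_right₀ hL (by norm_num)
  have hLy : ∀ a : ℝ, 0 ≤ a → a ≤ L ^ 4 → a ≤ y * L ^ 4 := fun a ha h =>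
    h.trans (le_mul_of_one_le_left (by positivity) hy1)
  have a1 := mul_le_mul_of_nonneg_left (hLy L (by linarith) hL2) hK10
  have a2 := hLy (L ^ 2) (by positivity) hL3
  have a3 := mul_le_mul_of_nonneg_left a2 hK00
  have a4 : L ^ 2 * y ≤ y * L ^ 4 := by rw [mul_comm]; gcongr
  have a5 := hLy (L ^ 4) (by positivity) le_rfl
  linarith

end

section

open Filter

lemma ev_cond : ∀ᶠ j : ℕ in atTop,
    2 * (((300 : ℕ) * Real.log (pY j)) ^ (2 * 300) * (1 + (300 : ℕ) * Real.log (pY j))) *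
      ((pU j : ℝ) ^ 6 * (3 + 2 * (j : ℝ)) / (pV j : ℝ) ^ 300) ≤ ((1 / (j : ℝ) ^ 10) ^ 300) ^ 2 := by
  obtain ⟨K, hK⟩ : ∃ K : ℝ, K = (900 : ℝ) ^ 600 := ⟨_, rfl⟩
  have hK0 : 0 ≤ K := by rw [hK]; positivity
  filter_upwards [ev_ge 2, ev_pow_exp (2 * (K * 901) * (64 * 5)) 6602 1 (by norm_num)] with j hj hev
  have hj2 : 2 ≤ j := by exact_mod_cast hj
  have hj0 : (0 : ℝ) < j := by linarith
  have hlY0 := Real.log_natCast_nonneg (pY j)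
  have hlY := log_pY_le (j := j) (by omega)
  have h1 : ((300 : ℕ) * Real.log (pY j)) ^ (2 * 300) ≤ K * (j : ℝ) ^ 600 := by
    rw [hK, ← mul_pow]
    norm_num only
    apply pow_le_pow_left₀ (by positivity)
    linarith
  clear hK
  have h2 : (1 + (300 : ℕ) * Real.log (pY j)) ≤ 901 * j := by push_cast; linarith
  have h3 : (pU j : ℝ) ^ 6 ≤ 64 * Real.exp (1.92 * j) := by
    calc _ ≤ (2 * Real.exp (0.32 * j)) ^ 6 := by gcongr; exact pU_le j
      _ = _ := by rw [mul_pow, ← Real.exp_nat_mul]; norm_num; ring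
  have h4 : Real.exp (3 * j) ≤ (pV j : ℝ) ^ 300 := by
    calc _ = Real.exp (0.01 * j) ^ 300 := by rw [← Real.exp_nat_mul]; congr 1; push_cast; ring
      _ ≤ _ := by gcongr; exact le_pV j
  have h5 : (3 + 2 * (j : ℝ)) ≤ 5 * j := by linarith
  have h6 : (pU j : ℝ) ^ 6 * (3 + 2 * (j : ℝ)) / (pV j : ℝ) ^ 300 ≤ 64 * Real.exp (1.92 * j) * (5 * j) / Real.exp (3 * j) := by
    gcongr
  have h7 : 64 * Real.exp (1.92 * j) * (5 * j) / Real.exp (3 * j) = (64 * 5) * j * Real.exp (-(1.08 * j)) := by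
    rw [div_eq_mul_inv, ← Real.exp_neg, show -(1.08 * (j : ℝ)) = 1.92 * j + -(3 * j) by ring, Real.exp_add]; ring
  rw [h7] at h6
  have h8 : ((1 / (j : ℝ) ^ 10) ^ 300) ^ 2 = ((j : ℝ) ^ 6000)⁻¹ := by
    rw [one_div, inv_pow, inv_pow, ← pow_mul, ← pow_mul]
  rw [h8]
  calc _ ≤ 2 * ((K * (j : ℝ) ^ 600) * (901 * j)) * ((64 * 5) * j * Real.exp (-(1.08 * j))) := by
        have : 0 ≤ (pU j : ℝ) ^ 6 * (3 + 2 * (j : ℝ)) / (pV j : ℝ) ^ 300 := by positivity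
        gcongr
    _ = (2 * (K * 901) * (64 * 5) * (j : ℝ) ^ 602) * Real.exp (-(1.08 * j)) := by
        rw [show (602 : ℕ) = 600 + 1 + 1 by norm_num, pow_add _ _ 1, pow_add _ _ 1, pow_one]; ring
    _ ≤ (Real.exp j / (j : ℝ) ^ 6000) * Real.exp (-(1.08 * j)) := by
        gcongr
        rw [le_div_iff₀ (by positivity), mul_assoc, ← pow_add]
        rw [one_mul] at hev
        exact hev
    _ = ((j : ℝ) ^ 6000)⁻¹ * Real.exp (-(0.08 * j)) := by
        rw [div_mul_eq_mul_div, ← Real.exp_add, div_eq_inv_mul]; congr 2; ring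
    _ ≤ ((j : ℝ) ^ 6000)⁻¹ * 1 := by
        gcongr
        exact Real.exp_le_one_iff.2 (by linarith)
    _ = _ := mul_one _

lemma ev_R : ∀ᶠ j : ℕ in atTop, RB (pY j) 300 ((j : ℝ) ^ 10) ≤ (j : ℝ) ^ 7000 := by
  obtain ⟨K, hK⟩ : ∃ K : ℝ, K = (900 : ℝ) ^ 600 := ⟨_, rfl⟩
  have hK0 : 0 ≤ K := by rw [hK]; positivity
  filter_upwards [ev_ge 2, ev_ge (2 * (K * 901) * 901)] with j hj hev
  have hj2 : 2 ≤ j := by exact_mod_cast hj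
  have hlY0 := Real.log_natCast_nonneg (pY j)
  have hlY := log_pY_le (j := j) (by omega)
  have h1 : ((300 : ℕ) * Real.log (pY j)) ^ (2 * 300) ≤ K * (j : ℝ) ^ 600 := by
    rw [hK, ← mul_pow]
    norm_num only
    apply pow_le_pow_left₀ (by positivity)
    linarith
  clear hK
  have h2 : (1 + (300 : ℕ) * Real.log (pY j)) ≤ 901 * j := by push_cast; linarith
  unfold RB
  calc _ ≤ 2 * ((K * (j : ℝ) ^ 600) * (901 * j)) * (901 * j) * ((j : ℝ) ^ 10) ^ (2 * 300) := by gcongr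
    _ = (2 * (K * 901) * 901) * (j : ℝ) ^ 6602 := by
        rw [← pow_mul, show (6602 : ℕ) = 600 + 1 + 1 + 10 * (2 * 300) by norm_num, pow_add _ _ (10 * (2 * 300)), pow_add _ _ 1, pow_add _ _ 1, pow_one]
        ring
    _ ≤ j * (j : ℝ) ^ 6602 := by gcongr
    _ = (j : ℝ) ^ 6603 := by rw [pow_succ' _ 6602]
    _ ≤ _ := pow_le_pow_right₀ (by linarith) (by norm_num)

lemma ev_Rn : ∀ᶠ j : ℕ in atTop, (j : ℝ) ^ 7000 * (pn j : ℕ) < ((j ^ 8000 : ℕ) : ℝ) := by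
  filter_upwards [ev_ge 2] with j hj
  have h1 : (pn j : ℝ) ≤ j := by
    have : pn j ≤ j := by
      unfold pn
      rw [Nat.ceil_le]
      exact Real.rpow_le_self_of_one_le (by linarith) (by norm_num)
    exact_mod_cast this
  push_cast
  calc _ ≤ (j : ℝ) ^ 7000 * j := by gcongr
    _ = (j : ℝ) ^ 7001 := by rw [pow_succ _ 7000]
    _ < _ := pow_lt_pow_right₀ (by linarith) (by norm_num)

lemma ev_h3 : ∀ᶠ j : ℕ in atTop, pU j * (j ^ 8000) ^ (pn j * pn j) < pD1 j ^ pn j := by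
  filter_upwards [ev_ge 2, ev_log_rpow 32000 1 0.26 (by norm_num), ev_rpow_ge 3 0.06 (by norm_num), ev_log_ge 1] with j hj hlog hbig hL
  have hj2 : 2 ≤ j := by exact_mod_cast hj
  have hj0 : (0 : ℝ) < j := by linarith
  have hU := pU_le_exp hj2
  set L := Real.log j with hLd
  set n := pn j with hn
  have hn1 : (j : ℝ) ^ (0.4 : ℝ) ≤ n := Nat.le_ceil _
  have hn2 : (n : ℝ) ≤ 2 * (j : ℝ) ^ (0.4 : ℝ) := ceil_le_two_mul' (Real.one_le_rpow (by linarith) (by norm_num))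
  have hD : Real.exp ((j : ℝ) ^ (0.66 : ℝ)) ≤ pD1 j := Nat.le_ceil _
  have e1 : (j : ℝ) = Real.exp L := by rw [hLd, Real.exp_log hj0]
  have key : ((pU j * (j ^ 8000) ^ (n * n) : ℕ) : ℝ) < ((pD1 j ^ n : ℕ) : ℝ) := by
    push_cast
    calc _ ≤ Real.exp j * (Real.exp L ^ 8000) ^ (n * n) := by rw [← e1]; gcongr
      _ = Real.exp (j + n * (n * (8000 * L))) := by
          rw [← Real.exp_nat_mul, ← Real.exp_nat_mul, ← Real.exp_add]; congr 1; push_cast; ring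
      _ < Real.exp (n * (j : ℝ) ^ (0.66 : ℝ)) := by
          apply Real.exp_lt_exp.2
          have a1 : (j : ℝ) ^ (0.66 : ℝ) = (j : ℝ) ^ (0.4 : ℝ) * (j : ℝ) ^ (0.26 : ℝ) := by
            rw [← Real.rpow_add hj0]; norm_num
          have a2 : (j : ℝ) ^ (0.4 : ℝ) * (j : ℝ) ^ (0.66 : ℝ) = j * (j : ℝ) ^ (0.06 : ℝ) := by
            rw [← Real.rpow_add hj0, ← Real.rpow_one_add' hj0.le (by norm_num)]; norm_num
          have a3 : 0 < (j : ℝ) ^ (0.4 : ℝ) := by positivity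
          have a4 : (n : ℝ) * (8000 * L) ≤ (j : ℝ) ^ (0.66 : ℝ) / 2 := by
            rw [a1]
            rw [pow_one] at hlog
            calc (n : ℝ) * (8000 * L) ≤ (2 * (j : ℝ) ^ (0.4 : ℝ)) * (8000 * L) := by gcongr
              _ = (j : ℝ) ^ (0.4 : ℝ) * (32000 * L) / 2 := by ring
              _ ≤ _ := by gcongr
          have a5 : (n : ℝ) * (n * (8000 * L)) ≤ n * ((j : ℝ) ^ (0.66 : ℝ) / 2) := by gcongr
          have a6 : (j : ℝ) ^ (0.4 : ℝ) * (j : ℝ) ^ (0.66 : ℝ) ≤ n * (j : ℝ) ^ (0.66 : ℝ) := by gcongr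
          nlinarith
      _ = Real.exp ((j : ℝ) ^ (0.66 : ℝ)) ^ n := by rw [Real.exp_nat_mul]
      _ ≤ _ := by gcongr
  exact_mod_cast key

lemma ev_h6 : ∀ᶠ j : ℕ in atTop, (j : ℝ) ^ 7000 < Real.exp ((pc0 j : ℝ) / 2) := by
  filter_upwards [ev_ge 2] with j hj
  have hj0 : (0 : ℝ) < j := by linarith
  have h1 : 14002 * Real.log j ≤ pc0 j := Nat.le_ceil _
  calc (j : ℝ) ^ 7000 < (j : ℝ) ^ 7001 := pow_lt_pow_right₀ (by linarith) (by norm_num)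
    _ = Real.exp (7001 * Real.log j) := by
        rw [show (7001 : ℝ) * Real.log j = ((7001 : ℕ) : ℝ) * Real.log j by norm_num, Real.exp_nat_mul, Real.exp_log hj0]
    _ ≤ _ := by apply Real.exp_le_exp.2; linarith

lemma prho_le (j : ℕ) (hL : 1 ≤ Real.log j) : (prho j : ℝ) ≤ 0.319 / 5.1 * (j / Real.log j) := by
  refine (Nat.floor_le (by positivity)).trans (le_of_eq ?_)
  field_simp

lemma le_prho (j : ℕ) (hL : 1 ≤ Real.log j) : 0.319 / 5.1 * (j / Real.log j) - 1 ≤ prho j := by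
  have := (Nat.sub_one_lt_floor (0.319 * (j : ℝ) / (5.1 * Real.log j))).le
  refine le_trans (le_of_eq ?_) this
  field_simp

lemma ev_h5 (M g : ℕ) (hM : 0 < M) (hg : 0 < g) : ∀ᶠ j : ℕ in atTop,
    Nat.log 2 (pW M g j) + Nat.log 2 (pW M g j * (j ^ 8000 + 1)) + 2 * (5 * prho j) ≤ ((Finset.Icc 1 (pZ j)).filter Nat.Prime).card := by
  filter_upwards [ev_S M g hM hg, ev_ge 3, ev_log_ge 1, ev_rpow_ge 10 0.02 (by norm_num)] with j hS hj hL hbig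
  have hj0 : (0 : ℝ) < j := by linarith
  have hj1 : 1 ≤ j := by have : (1 : ℝ) ≤ j := by linarith
                         exact_mod_cast this
  set L := Real.log j with hLd
  set t := (j : ℝ) / L with ht
  have htL : t * L = j := by rw [ht]; field_simp
  have ht0 : 0 ≤ t := by positivity
  have hW0 : 0 < pW M g j := by unfold pW; positivity
  have hS0 : 0 < pS M g j := by unfold pS; positivity
  have hle1 : pW M g j * (j ^ 8000 + 1) ≤ pS M g j := Nat.le_mul_of_pos_left _ hM
  have hle2 : pW M g j ≤ pS M g j := le_trans (Nat.le_mul_of_pos_right _ (by positivity)) hle1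
  have hlog : (Nat.log 2 (pS M g j) : ℝ) ≤ 0.002 * t := by
    have h1 : (2 : ℝ) ^ Nat.log 2 (pS M g j) ≤ Real.exp (0.001 * t) := by
      refine le_trans ?_ hS
      exact_mod_cast Nat.pow_log_le_self 2 hS0.ne'
    have h2 := Real.log_le_log (by positivity) h1
    rw [Real.log_pow, Real.log_exp] at h2
    have := Real.log_two_gt_d9
    have h3 : (0 : ℝ) ≤ Nat.log 2 (pS M g j) := by positivity
    nlinarith
  have hρ := prho_le j hL
  have h1 : Nat.log 2 (pW M g j) ≤ Nat.log 2 (pS M g j) := Nat.log_mono_right hle2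
  have h2 : Nat.log 2 (pW M g j * (j ^ 8000 + 1)) ≤ Nat.log 2 (pS M g j) := Nat.log_mono_right hle1
  have hcard : ((Finset.Icc 1 (pZ j)).filter Nat.Prime).card = Nat.primeCounting (pZ j) := by
    rw [Nat.primeCounting, Nat.primeCounting', Nat.count_eq_card_filter_range]
    congr 1
    ext p
    simp only [Finset.mem_filter, Finset.mem_Icc, Finset.mem_range]
    constructor
    · rintro ⟨⟨_, h⟩, hp⟩; exact ⟨by omega, hp⟩
    · rintro ⟨h, hp⟩; exact ⟨⟨hp.one_lt.le, by omega⟩, hp⟩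
  have hπ : t ≤ Nat.primeCounting (pZ j) := by
    have e1 := Chebyshev.psi_ge (pZ j)
    have e2 := Chebyshev.psi_le_primeCounting_mul_log (pZ j)
    have hZ1 : (j : ℝ) ^ (1.02 : ℝ) - 1 ≤ pZ j := (Nat.sub_one_lt_floor _).le
    have hZ2 : (j : ℝ) ^ (1.02 : ℝ) = j * (j : ℝ) ^ (0.02 : ℝ) := by
      rw [← Real.rpow_one_add' hj0.le (by norm_num)]; norm_num
    have hZ3 : 10 * (j : ℝ) - 1 ≤ pZ j := by nlinarith
    have hZ4 := pZ_le hj1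
    have hZ0 : (0 : ℝ) < pZ j := by linarith
    have hlZ : Real.log (pZ j) ≤ 1.02 * L := by rw [Real.log_le_iff_le_exp hZ0]; exact hZ4
    have hlZ1 : Real.log (pZ j + 1) ≤ 1.02 * L + 1 := by
      rw [Real.log_le_iff_le_exp (by linarith), Real.exp_add]
      have : (2 : ℝ) ≤ Real.exp 1 := by have := Real.add_one_le_exp (1 : ℝ); linarith
      have h1 : 1 ≤ Real.exp (1.02 * L) := Real.one_le_exp (by linarith)
      nlinarith
    have hLj : L ≤ j := by have := Real.log_le_sub_one_of_pos hj0; linarith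
    have hl2 := Real.log_two_gt_d9
    have e3 : 1.02 * (t * L) ≤ Nat.primeCounting (pZ j) * (1.02 * L) := by
      rw [htL]
      have e4 : (Nat.primeCounting (pZ j) : ℝ) * Real.log (pZ j) ≤ Nat.primeCounting (pZ j) * (1.02 * L) := by gcongr
      have e5 : (pZ j : ℝ) * 0.69 ≤ pZ j * Real.log 2 := by gcongr; linarith
      linarith
    have : t * (1.02 * L) ≤ Nat.primeCounting (pZ j) * (1.02 * L) := by linarith
    exact le_of_mul_le_mul_right this (by linarith)
  rw [hcard]
  have h3 : ((Nat.log 2 (pS M g j) + Nat.log 2 (pS M g j) + 2 * (5 * prho j) : ℕ) : ℝ) ≤ Nat.primeCounting (pZ j) := by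
    push_cast
    norm_num at hρ ⊢
    linarith
  have h4 : Nat.log 2 (pS M g j) + Nat.log 2 (pS M g j) + 2 * (5 * prho j) ≤ Nat.primeCounting (pZ j) := by exact_mod_cast h3
  omega

lemma ev_QU (M g : ℕ) (hM : 0 < M) (hg : 0 < g) : ∀ᶠ j : ℕ in atTop,
    pS M g j * pZ j ^ (5 * prho j) ≤ pU j ∧ pS M g j ≤ pV j ∧ pZ j ≤ pV j ∧ 0 < pZ j := by
  filter_upwards [ev_S M g hM hg, ev_ge 3, ev_log_ge 1, ev_pow_exp 1 2 0.01 (by norm_num)] with j hS hj hL hexp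
  have hj0 : (0 : ℝ) < j := by linarith
  have hj1 : 1 ≤ j := by have : (1 : ℝ) ≤ j := by linarith
                         exact_mod_cast this
  set L := Real.log j with hLd
  set t := (j : ℝ) / L with ht
  have htL : t * L = j := by rw [ht]; field_simp
  have ht0 : 0 ≤ t := by positivity
  have htj : t ≤ j := by nlinarith
  have hρ := prho_le j hL
  have hZ := pZ_le hj1
  refine ⟨?_, ?_, ?_, ?_⟩
  · have : ((pS M g j * pZ j ^ (5 * prho j) : ℕ) : ℝ) ≤ pU j := by
      push_cast
      calc _ ≤ Real.exp (0.001 * t) * Real.exp (1.02 * L) ^ (5 * prho j) := by gcongr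
        _ = Real.exp (0.001 * t + 5 * prho j * (1.02 * L)) := by rw [← Real.exp_nat_mul, ← Real.exp_add]; push_cast; rfl
        _ ≤ Real.exp (0.32 * j) := by
          apply Real.exp_le_exp.2
          have h1 : 5 * (prho j : ℝ) * (1.02 * L) ≤ 5 * (0.319 / 5.1 * t) * (1.02 * L) := by gcongr
          have h2 : 5 * (0.319 / 5.1 * t) * (1.02 * L) = 0.319 * (t * L) := by ring
          rw [h2, htL] at h1
          linarith
        _ ≤ _ := le_pU j
    exact_mod_cast this
  · have : (pS M g j : ℝ) ≤ pV j := hS.trans (le_trans (Real.exp_le_exp.2 (by linarith)) (le_pV j))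
    exact_mod_cast this
  · have : (pZ j : ℝ) ≤ pV j := by
      refine le_trans ?_ (hexp.trans (le_pV j))
      refine (Nat.floor_le (by positivity)).trans ?_
      rw [one_mul, ← Real.rpow_natCast]
      exact Real.rpow_le_rpow_of_exponent_le (by linarith) (by norm_num)
    exact_mod_cast this
  · unfold pZ
    rw [Nat.floor_pos]
    exact Real.one_le_rpow (by linarith) (by norm_num)

lemma ev_t (K : ℝ) : ∀ᶠ j : ℕ in atTop, K ≤ (j : ℝ) / Real.log j := by
  filter_upwards [ev_ge 1, ev_log_ge 1, ev_log_rpow |K| 1 1 (by norm_num)] with j hj hL h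
  rw [pow_one, Real.rpow_one] at h
  rw [le_div_iff₀ (by linarith)]
  nlinarith [le_abs_self K]

lemma pW_le_pS (M g j : ℕ) (hM : 0 < M) : pW M g j ≤ pS M g j :=
  le_trans (Nat.le_mul_of_pos_right _ (by positivity)) (Nat.le_mul_of_pos_left _ hM)

lemma ev_Wrho (M g : ℕ) (hM : 0 < M) (hg : 0 < g) : ∀ᶠ j : ℕ in atTop,
    2 * (pW M g j : ℝ) * 972 ^ prho j ≤ 1024 ^ prho j := by
  filter_upwards [ev_S M g hM hg, ev_log_ge 1, ev_t 1000] with j hS hL ht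
  set t := (j : ℝ) / Real.log j with htd
  have hρ := le_prho j hL
  have hW : (pW M g j : ℝ) ≤ Real.exp (0.001 * t) := le_trans (by exact_mod_cast pW_le_pS M g j hM) hS
  have h1 : Real.exp 0.05 ≤ 1024 / 972 := by
    have := Real.exp_bound' (x := 0.05) (by norm_num) (by norm_num) (n := 3) (by norm_num)
    refine this.trans ?_
    norm_num [Finset.sum_range_succ, Nat.factorial]
  have h2 : 2 * Real.exp (0.001 * t) ≤ Real.exp 0.05 ^ prho j := by
    rw [← Real.exp_nat_mul]
    have h3 : (2 : ℝ) ≤ Real.exp 1 := by have := Real.add_one_le_exp (1 : ℝ); linarith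
    calc _ ≤ Real.exp 1 * Real.exp (0.001 * t) := by gcongr
      _ = Real.exp (1 + 0.001 * t) := by rw [Real.exp_add]
      _ ≤ _ := by apply Real.exp_le_exp.2; norm_num at hρ ⊢; linarith
  calc _ ≤ 2 * Real.exp (0.001 * t) * 972 ^ prho j := by gcongr
    _ ≤ Real.exp 0.05 ^ prho j * 972 ^ prho j := by gcongr
    _ ≤ (1024 / 972) ^ prho j * 972 ^ prho j := by gcongr
    _ = _ := by rw [← mul_pow]; norm_num

lemma ev_final (M g : ℕ) (hM : 0 < M) (hg : 0 < g) : ∀ᶠ j : ℕ in atTop,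
    12 * (pW M g j : ℝ) * Real.exp (5 * Real.log 2 / 12 * (1.01 * (j / Real.log j))) ≤ 128 ^ prho j := by
  filter_upwards [ev_S M g hM hg, ev_log_ge 1, ev_t 2000] with j hS hL ht
  set t := (j : ℝ) / Real.log j with htd
  have hρ := le_prho j hL
  have hW : (pW M g j : ℝ) ≤ Real.exp (0.001 * t) := le_trans (by exact_mod_cast pW_le_pS M g j hM) hS
  have h1 : (128 : ℝ) ^ prho j = Real.exp (prho j * (7 * Real.log 2)) := by
    rw [Real.exp_nat_mul]
    congr 1
    rw [show (7 : ℝ) * Real.log 2 = ((7 : ℕ) : ℝ) * Real.log 2 by norm_num, Real.exp_nat_mul, Real.exp_log (by norm_num)]; norm_num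
  have h2 : (12 : ℝ) ≤ Real.exp 11 := by have := Real.add_one_le_exp (11 : ℝ); linarith
  have hl1 := Real.log_two_gt_d9
  have hl2 := Real.log_two_lt_d9
  rw [h1]
  calc _ ≤ Real.exp 11 * Real.exp (0.001 * t) * Real.exp (5 * Real.log 2 / 12 * (1.01 * t)) := by gcongr
    _ = Real.exp (11 + 0.001 * t + 5 * Real.log 2 / 12 * (1.01 * t)) := by rw [Real.exp_add, Real.exp_add]
    _ ≤ _ := by
      apply Real.exp_le_exp.2
      have h3 : (0.319 / 5.1 * t - 1) * (7 * Real.log 2) ≤ prho j * (7 * Real.log 2) := by gcongr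
      refine le_trans ?_ h3
      have h4 : 0.69 * (0.017 * t) ≤ Real.log 2 * (0.017 * t) := by gcongr; linarith
      have h5 : 0 ≤ Real.log 2 * t := by positivity
      norm_num
      nlinarith

end

open Filter

lemma ev_ce (K : ℝ) (n : ℕ) (a c : ℝ) (ha : a < 1) (hc : 0 < c) :
    ∀ᶠ j : ℕ in atTop, K * (j : ℝ) ^ n * Real.exp (a * j) ≤ c * Real.exp j := by
  filter_upwards [ev_pow_exp (K / c) n (1 - a) (by linarith)] with j hj
  have h1 : K * (j : ℝ) ^ n ≤ c * Real.exp ((1 - a) * j) := by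
    have := mul_le_mul_of_nonneg_left hj hc.le
    calc _ = c * (K / c * (j : ℝ) ^ n) := by field_simp
      _ ≤ _ := this
  calc _ ≤ c * Real.exp ((1 - a) * j) * Real.exp (a * j) := by gcongr
    _ = _ := by rw [mul_assoc, ← Real.exp_add]; congr 2; ring

lemma ev_inv (K c : ℝ) (hc : 0 < c) : ∀ᶠ j : ℕ in atTop, K / (j : ℝ) ≤ c := by
  filter_upwards [ev_ge (K / c), ev_ge 1] with j hj h1
  rw [div_le_iff₀ hc] at hj
  rw [div_le_iff₀ (by linarith)]
  linarith

lemma ev_ma (c : ℝ) (hc : 0 < c) : ∀ᶠ j : ℕ in atTop,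
    pU j * (2 * Real.exp (0.505 * j) * (1.01 * j) + pY j * Real.log (pY j) * Real.exp (-(j : ℝ) ^ 2 / 20000)) ≤ c * Real.exp j := by
  filter_upwards [ev_ge 200000, ev_ce (4.04 + 12) 1 0.825 c (by norm_num) hc] with j hj h
  have hj1 : 1 ≤ j := by have : (1 : ℝ) ≤ j := by linarith
                         exact_mod_cast this
  have hlY0 := Real.log_natCast_nonneg (pY j)
  have hlY := log_pY_le hj1
  have hU := pU_le j
  have hY := pY_le j
  have h1 : Real.exp (-(j : ℝ) ^ 2 / 20000) ≤ Real.exp (-(2 * j)) := by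
    apply Real.exp_le_exp.2; nlinarith
  refine le_trans ?_ h
  calc _ ≤ (2 * Real.exp (0.32 * j)) * (2 * Real.exp (0.505 * j) * (1.01 * j) + (2 * Real.exp (2 * j)) * (3 * j) * Real.exp (-(2 * j))) := by gcongr
    _ = (2 * Real.exp (0.32 * j)) * (2 * Real.exp (0.505 * j) * (1.01 * j) + 2 * (3 * j)) := by
        rw [Real.exp_neg]; field_simp
    _ ≤ (2 * Real.exp (0.32 * j)) * (2 * Real.exp (0.505 * j) * (1.01 * j) + 2 * (3 * j) * Real.exp (0.505 * j)) := by
        have h2 : 2 * (3 * (j : ℝ)) ≤ 2 * (3 * j) * Real.exp (0.505 * j) :=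
          le_mul_of_one_le_right (by positivity) (Real.one_le_exp (by positivity))
        exact mul_le_mul_of_nonneg_left (add_le_add_right h2 _) (by positivity)
    _ = _ := by
        rw [show (0.825 : ℝ) * j = 0.32 * j + 0.505 * j by ring, Real.exp_add]; ring

lemma ev_mc (c : ℝ) (hc : 0 < c) : ∀ᶠ j : ℕ in atTop, pV j * Real.log (pY j) ≤ c * Real.exp j := by
  filter_upwards [ev_ge 1, ev_ce 6 1 0.01 c (by norm_num) hc] with j hj h
  have hj1 : 1 ≤ j := by exact_mod_cast hj
  have hlY0 := Real.log_natCast_nonneg (pY j)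
  have hlY := log_pY_le hj1
  have hV := pV_le j
  refine le_trans ?_ h
  calc _ ≤ (2 * Real.exp (0.01 * j)) * (3 * j) := by gcongr
    _ = _ := by ring

lemma ev_D (M g : ℕ) (hM : 0 < M) (hg : 0 < g) : ∀ᶠ j : ℕ in atTop,
    ((pS M g j * 2 ^ (5 * prho j) : ℕ) : ℝ) ≤ Real.exp (0.002 * j) := by
  filter_upwards [ev_S M g hM hg, ev_log_ge 400] with j hS hL
  set L := Real.log j with hLd
  set t := (j : ℝ) / L with ht
  have hL0 : L ≠ 0 := by linarith
  have htL : t * L = j := by rw [ht]; field_simp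
  have ht0 : 0 ≤ t := by positivity
  have htj : 400 * t ≤ j := by nlinarith
  have hρ := prho_le j (by linarith)
  have h2 : (2 : ℝ) ≤ Real.exp 1 := by have := Real.add_one_le_exp (1 : ℝ); linarith
  push_cast
  calc _ ≤ Real.exp (0.001 * t) * Real.exp 1 ^ (5 * prho j) := by gcongr
    _ = Real.exp (0.001 * t + 5 * prho j) := by rw [← Real.exp_nat_mul, ← Real.exp_add]; push_cast; rw [mul_one]
    _ ≤ _ := by
      apply Real.exp_le_exp.2
      norm_num at hρ ⊢
      linarith

lemma ev_err (M g : ℕ) (hM : 0 < M) (hg : 0 < g) (c : ℝ) (hc : 0 < c) : ∀ᶠ j : ℕ in atTop,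
    ErrB (pU j) (pV j) (pY j) ((pS M g j * 2 ^ (5 * prho j) : ℕ) : ℝ) j ((j : ℝ) ^ 10) j ≤ 3 * (c * Real.exp j) := by
  filter_upwards [ev_ge 100, ev_D M g hM hg, ev_ce (2 * (40 * 8 * 4 * 3 * 3 * 16)) 5 0.974 c (by norm_num) hc,
    ev_ce (64 * 6 * 3) 1 0.96 c (by norm_num) hc, ev_pow_exp 1 12 1 (by norm_num), ev_inv (2 * 2 * 3125 * 17) c hc] with j hj hD e1 e2 e3 e4
  have hj1 : 1 ≤ j := by have : (1 : ℝ) ≤ j := by linarith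
                         exact_mod_cast this
  have hj2 : 2 ≤ j := by have : (2 : ℝ) ≤ j := by linarith
                         exact_mod_cast this
  have hj0 : (0 : ℝ) < j := by linarith
  have hlY0 := Real.log_natCast_nonneg (pY j)
  have hlU0 := Real.log_natCast_nonneg (pU j)
  have hlYU0 := Real.log_natCast_nonneg (pY j * pU j)
  have hlY := log_pY_le hj1
  have hlU := log_pU_le hj2
  have hlYU := log_pYU_le hj2
  have hU := pU_le j
  have hV := pV_le j
  have hY := pY_le j
  set D := ((pS M g j * 2 ^ (5 * prho j) : ℕ) : ℝ) with hDd
  have hD0 : 0 ≤ D := by rw [hDd]; positivity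
  clear_value D
  unfold ErrB
  have A : 2 * (40 * (pU j : ℝ) ^ 2 * (pU j * D ^ 2 * (1 + Real.log (pU j)) ^ 2) * (1 + pV j) * Real.log (pY j) * (1 + Real.log (pY j)) ^ 2) ≤ c * Real.exp j := by
    refine le_trans ?_ e1
    have b1 : (1 + Real.log (pU j)) ≤ 2 * j := by linarith
    have b2 : (1 + Real.log (pY j)) ≤ 4 * j := by linarith
    have b3 : (1 : ℝ) + pV j ≤ 3 * Real.exp (0.01 * j) := by
      have := Real.one_le_exp (by positivity : (0 : ℝ) ≤ 0.01 * j); linarith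
    calc _ ≤ 2 * (40 * (2 * Real.exp (0.32 * j)) ^ 2 * ((2 * Real.exp (0.32 * j)) * (Real.exp (0.002 * j)) ^ 2 * (2 * j) ^ 2) * (3 * Real.exp (0.01 * j)) * (3 * j) * (4 * j) ^ 2) := by gcongr
      _ = _ := by
        rw [show (0.974 : ℝ) * j = 0.32 * j + 0.32 * j + 0.32 * j + 0.002 * j + 0.002 * j + 0.01 * j by ring, Real.exp_add, Real.exp_add, Real.exp_add, Real.exp_add, Real.exp_add]
        ring
  have B : (pU j : ℝ) * (6 * (pY j : ℝ) ^ 3 * (pU j : ℝ) ^ 2 * Real.log (pY j) * Real.exp (-((j : ℝ) ^ 2) / 2)) ≤ c * Real.exp j := by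
    refine le_trans ?_ e2
    have h1 : Real.exp (-(j : ℝ) ^ 2 / 2) ≤ Real.exp (-(6 * j)) := by
      apply Real.exp_le_exp.2; nlinarith
    calc _ ≤ (2 * Real.exp (0.32 * j)) * (6 * (2 * Real.exp (2 * j)) ^ 3 * (2 * Real.exp (0.32 * j)) ^ 2 * (3 * j) * Real.exp (-(6 * j))) := by gcongr
      _ = _ := by
        rw [show (0.96 : ℝ) * j = 0.32 * j + 0.32 * j + 0.32 * j + (2 * j + 2 * j + 2 * j + -(6 * j)) by ring, Real.exp_add, Real.exp_add, Real.exp_add, Real.exp_add (2 * (j : ℝ) + 2 * j + 2 * j), Real.exp_add, Real.exp_add]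
        ring
  have C : Real.exp (j + 1 / 2) * (2 * ((1 + Real.log (pY j * pU j : ℕ)) ^ 5 * (1 / (j : ℝ) ^ 10 + (1 + Real.log (pY j)) ^ 2 * Real.exp (-((j : ℝ) ^ 2) / 4)))) ≤ c * Real.exp j := by
    have b1 : (1 + Real.log (pY j * pU j : ℕ)) ≤ 5 * j := by linarith
    have b2 : (1 + Real.log (pY j)) ≤ 4 * j := by linarith
    have b3 : Real.exp (-((j : ℝ) ^ 2) / 4) ≤ 1 / (j : ℝ) ^ 12 := by
      calc _ ≤ Real.exp (-(1 * j)) := by apply Real.exp_le_exp.2; nlinarith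
        _ ≤ _ := by
          rw [Real.exp_neg, one_div]
          rw [one_mul] at e3
          gcongr
    have b4 : Real.exp (1 / 2) ≤ 2 := by
      have := Real.exp_bound' (x := 1 / 2) (by norm_num) (by norm_num) (n := 3) (by norm_num)
      refine this.trans ?_
      norm_num [Finset.sum_range_succ, Nat.factorial]
    rw [Real.exp_add]
    have b5 : (2 * 2 * 3125 * 17) / (j : ℝ) ^ 5 ≤ c := by
      refine le_trans ?_ e4
      gcongr
      exact le_self_pow₀ (by linarith) (by norm_num)
    calc _ ≤ Real.exp j * 2 * (2 * ((5 * j) ^ 5 * (1 / (j : ℝ) ^ 10 + (4 * j) ^ 2 * (1 / (j : ℝ) ^ 12)))) := by gcongr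
      _ = Real.exp j * ((2 * 2 * 3125 * 17) / (j : ℝ) ^ 5) := by field_simp; ring
      _ ≤ Real.exp j * c := by gcongr
      _ = _ := by ring
  linarith

lemma ev_mg (c : ℝ) (hc : 0 < c) : ∀ᶠ j : ℕ in atTop,
    (j : ℝ) ^ 7000 * Real.sqrt ((j : ℝ) ^ 7000 * (5 / 8 : ℝ) ^ pw j) * (Real.exp (j + 1 / 2) * (1 + Real.log (pY j)) ^ 2) ≤ c * Real.exp j := by
  filter_upwards [ev_ge 2, ev_inv 32 c hc] with j hj h
  have hj1 : 1 ≤ j := by have : (1 : ℝ) ≤ j := by linarith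
                         exact_mod_cast this
  have hj0 : (0 : ℝ) < j := by linarith
  have hlY0 := Real.log_natCast_nonneg (pY j)
  have hlY := log_pY_le hj1
  have b2 : (1 + Real.log (pY j)) ≤ 4 * j := by linarith
  have b4 : Real.exp (1 / 2) ≤ 2 := by
    have := Real.exp_bound' (x := 1 / 2) (by norm_num) (by norm_num) (n := 3) (by norm_num)
    refine this.trans ?_
    norm_num [Finset.sum_range_succ, Nat.factorial]
  have h58 : (5 / 8 : ℝ) ≤ Real.exp (-0.4) := by
    have := Real.add_one_le_exp (-0.4 : ℝ)
    have h2 : Real.exp (0.4) ≤ 8 / 5 := by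
      have := Real.exp_bound' (x := 0.4) (by norm_num) (by norm_num) (n := 4) (by norm_num)
      refine this.trans ?_
      norm_num [Finset.sum_range_succ, Nat.factorial]
    rw [show (5 / 8 : ℝ) = (8 / 5)⁻¹ by norm_num, Real.exp_neg]
    gcongr
  have hw : 60000 * Real.log j ≤ pw j := Nat.le_ceil _
  have h5 : (5 / 8 : ℝ) ^ pw j ≤ ((j : ℝ) ^ 24000)⁻¹ := by
    calc _ ≤ Real.exp (-0.4) ^ pw j := by gcongr
      _ = Real.exp (-(pw j * 0.4)) := by rw [← Real.exp_nat_mul]; congr 1; ring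
      _ ≤ Real.exp (-((24000 : ℕ) * Real.log j)) := by
          apply Real.exp_le_exp.2; push_cast; linarith
      _ = _ := by rw [Real.exp_neg, Real.exp_nat_mul, Real.exp_log hj0]
  have h6 : Real.sqrt ((j : ℝ) ^ 7000 * (5 / 8 : ℝ) ^ pw j) ≤ ((j : ℝ) ^ 8500)⁻¹ := by
    rw [Real.sqrt_le_left (by positivity)]
    calc _ ≤ (j : ℝ) ^ 7000 * ((j : ℝ) ^ 24000)⁻¹ := by gcongr
      _ = _ := by
        rw [inv_pow, ← pow_mul, show (24000 : ℕ) = 7000 + 8500 * 2 by norm_num, pow_add, mul_inv, ← mul_assoc, mul_inv_cancel₀ (by positivity), one_mul]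
  have h7 : (j : ℝ) ^ 7000 * Real.sqrt ((j : ℝ) ^ 7000 * (5 / 8 : ℝ) ^ pw j) ≤ ((j : ℝ) ^ 3)⁻¹ := by
    calc _ ≤ (j : ℝ) ^ 7000 * ((j : ℝ) ^ 8500)⁻¹ := by gcongr
      _ ≤ (j : ℝ) ^ 7000 * ((j : ℝ) ^ (7000 + 3))⁻¹ := by
        gcongr
        · linarith
        · norm_num
      _ = _ := by rw [pow_add, mul_inv, ← mul_assoc, mul_inv_cancel₀ (by positivity), one_mul]
  rw [Real.exp_add]
  calc _ ≤ ((j : ℝ) ^ 3)⁻¹ * (Real.exp j * 2 * (4 * j) ^ 2) := by gcongr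
    _ = Real.exp j * (32 / j) := by field_simp; ring
    _ ≤ Real.exp j * c := by gcongr
    _ = _ := mul_comm _ _

lemma ev_main (M g : ℕ) (hM : 0 < M) (hg : 0 < g) (c : ℝ) (hc : 0 < c) : ∀ᶠ j : ℕ in atTop,
    pU j * (2 * Real.exp (0.505 * j) * (1.01 * j) + pY j * Real.log (pY j) * Real.exp (-(j : ℝ) ^ 2 / 20000)) <
      (c * Real.exp j - pV j * Real.log (pY j)) / 2 - ErrB (pU j) (pV j) (pY j) ((pS M g j * 2 ^ (5 * prho j) : ℕ) : ℝ) j ((j : ℝ) ^ 10) j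
       - (j : ℝ) ^ 7000 * Real.sqrt ((j : ℝ) ^ 7000 * (5 / 8 : ℝ) ^ pw j) * (Real.exp (j + 1 / 2) * (1 + Real.log (pY j)) ^ 2) := by
  filter_upwards [ev_ma (c / 20) (by positivity), ev_mc (c / 20) (by positivity), ev_err M g hM hg (c / 20) (by positivity),
    ev_mg (c / 20) (by positivity)] with j h1 h2 h3 h4
  have : 0 < c * Real.exp j := by positivity
  linarith

lemma ev_target (M g : ℕ) (hM : 0 < M) (hg : 0 < g) (L' ε : ℝ) (hL' : 1 ≤ L') (hε : 0 < ε) : ∀ᶠ j : ℕ in atTop,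
    ∀ (p : ℕ) (x : ℝ), pV j < p → Real.log p ≤ 1.01 * j → (128 : ℝ) ^ prho j ≤ 12 * pW M g j * x →
      Real.exp (((5 * Real.log 2) / (12 * L') - ε) * (Real.log p / Real.log (Real.log p))) ≤ x := by
  filter_upwards [ev_ge 300, ev_final M g hM hg, ev_log_ge 1] with j hj hfin hL p x hp hlp hx
  have hW : (0 : ℝ) < pW M g j := by
    have : 0 < pW M g j := by unfold pW; positivity
    exact_mod_cast this
  have hpV : (pV j : ℝ) < p := by exact_mod_cast hp
  have h1 : 0.01 * (j : ℝ) ≤ Real.log p := by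
    rw [Real.le_log_iff_exp_le ((pV_pos j).trans hpV)]
    exact (le_pV j).trans hpV.le
  have he : Real.exp 1 ≤ Real.log p := by have := Real.exp_one_lt_d9; linarith
  have hanti := Real.log_div_self_antitoneOn (a := Real.log p) (b := 1.01 * j) he (le_trans he hlp) hlp
  have hlp0 : 0 < Real.log p := by have := Real.exp_pos 1; linarith
  have hll : 1 ≤ Real.log (Real.log p) := by rw [Real.le_log_iff_exp_le hlp0]; exact he
  have hj0 : (0 : ℝ) < j := by linarith
  have hlj : Real.log j ≤ Real.log (1.01 * j) := Real.log_le_log hj0 (by linarith)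
  have h2 : Real.log p / Real.log (Real.log p) ≤ 1.01 * (j / Real.log j) := by
    simp only at hanti
    rw [div_le_div_iff₀ (by linarith) hlp0] at hanti
    rw [← mul_div_assoc, div_le_div_iff₀ (by linarith) (by linarith)]
    have : Real.log p * Real.log j ≤ Real.log p * Real.log (1.01 * j) := by gcongr
    linarith
  have hl2 : 0 < Real.log 2 := Real.log_pos (by norm_num)
  have h3 : (5 * Real.log 2) / (12 * L') - ε ≤ 5 * Real.log 2 / 12 := by
    have : (5 * Real.log 2) / (12 * L') ≤ 5 * Real.log 2 / 12 := by gcongr; linarith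
    linarith
  have h4 : ((5 * Real.log 2) / (12 * L') - ε) * (Real.log p / Real.log (Real.log p)) ≤ 5 * Real.log 2 / 12 * (1.01 * (j / Real.log j)) := by
    have : 0 ≤ Real.log p / Real.log (Real.log p) := by positivity
    calc _ ≤ 5 * Real.log 2 / 12 * (Real.log p / Real.log (Real.log p)) := by gcongr
      _ ≤ _ := by gcongr
  refine (Real.exp_le_exp.2 h4).trans ?_
  have h5 := hfin.trans hx
  exact le_of_mul_le_mul_left h5 (by positivity)

theorem stmt_11 (m e f : ℕ) (hm : 0 < m) (he : 0 < e) (hf : 0 < f)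
    (hef : Nat.gcd e f = 1) (ε : ℝ) (hε : 0 < ε) :
    ∀ N : ℕ, ∃ p : ℕ, N ≤ p ∧ p.Prime ∧ p ≡ e [MOD f] ∧
      Real.exp (((5 * Real.log 2) / (12 * (Nat.lcm m f : ℝ)) - ε) *
          (Real.log p / Real.log (Real.log p)))
        ≤ (numSols 3 m p : ℝ) := by
  intro N
  obtain ⟨M, hMd⟩ : ∃ M, M = Nat.lcm m f := ⟨_, rfl⟩
  have hM : 0 < M := by rw [hMd]; exact Nat.lcm_pos hm hf
  have hmM : m ∣ M := by rw [hMd]; exact Nat.dvd_lcm_left m f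
  have hfM : f ∣ M := by rw [hMd]; exact Nat.dvd_lcm_right m f
  rw [← hMd]
  have : NeZero M := ⟨hM.ne'⟩
  obtain ⟨e', he'M, he'e⟩ : ∃ e' : ℕ, Nat.Coprime e' M ∧ e' ≡ e [MOD f] := by
    obtain ⟨u, hu⟩ := ZMod.unitsMap_surjective hfM (ZMod.unitOfCoprime e hef)
    refine ⟨(u : ZMod M).val, ZMod.val_coe_unit_coprime u, ?_⟩
    rw [← ZMod.natCast_eq_natCast_iff]
    have h1 := congrArg Units.val hu
    rw [ZMod.unitsMap_val, ZMod.coe_unitOfCoprime] at h1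
    rw [← h1, ZMod.natCast_val]
  obtain ⟨g0, hg0⟩ := exists_neg_inv e' m hm (he'M.coprime_dvd_right hmM)
  obtain ⟨g, hg, hge⟩ : ∃ g, 0 < g ∧ m ∣ g * e' + 1 := by
    refine ⟨g0 + m, by omega, ?_⟩
    have : (g0 + m) * e' + 1 = (g0 * e' + 1) + m * e' := by ring
    rw [this]
    exact hg0.add (Dvd.intro _ rfl)
  obtain ⟨c, hc, hlam⟩ := lambda_ap (e' : ZMod M) ((ZMod.isUnit_iff_coprime e' M).2 he'M)
  have hev : ∀ᶠ j : ℕ in atTop, (N : ℝ) ≤ Real.exp (0.01 * j) := by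
    have := ev_pow_exp N 0 0.01 (by norm_num)
    simpa using this
  have hall := hev.and ((ev_ge 2).and (ev_cond.and (ev_R.and (ev_Rn.and (ev_h3.and ((ev_h5 M g hM hg).and (ev_h6.and
    ((ev_QU M g hM hg).and ((ev_main M g hM hg c hc).and ((ev_Wrho M g hM hg).and
      (ev_target M g hM hg (M : ℝ) ε (by exact_mod_cast hM) hε)))))))))))
  obtain ⟨J, hJ⟩ := eventually_atTop.1 hall
  obtain ⟨j, hjJ, hsum⟩ := hlam J
  obtain ⟨hN, hj2, hcond, hR, hRn, h3, h5, h6, ⟨hQU, hSV, hZV, hZ0⟩, hmain, hWρ, htar⟩ := hJ j hjJ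
  have hj0 : (0 : ℝ) < j := by linarith
  have hjn : 1 ≤ j := by have : (1 : ℝ) ≤ j := by linarith
                         exact_mod_cast this
  obtain ⟨p, hp, hVp, hlp, hpe, hfin⟩ := assembly hm hM hmM hg he'M hge (pU j) (pV j) (pY j) j (pD0 M j) (pw j) (pn j) (j ^ 8000)
    (pD1 j) (pZ j) (pc0 j) (prho j) (pW M g j) ((j : ℝ) ^ 10) c ((j : ℝ) ^ 7000) rfl hjn
    (by
      have : 0 < pD1 j := by unfold pD1; exact Nat.ceil_pos.2 (Real.exp_pos _)
      unfold pD0; positivity)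
    (Nat.one_le_pow _ _ hjn) hZ0 (by positivity)
    (by have := pV_pos j; exact_mod_cast this) (pV_le_pY j) (pU_le_pY j) (le_log_pY j)
    (le_trans (Real.exp_le_exp.2 (by linarith)) (le_pY j)) hcond hR hRn h3 le_rfl h5 h6 hQU hSV hZV hsum hmain hWρ
  refine ⟨p, ?_, hp, ?_, htar p _ hVp hlp hfin⟩
  · have : (N : ℝ) ≤ p := hN.trans ((le_pV j).trans (by exact_mod_cast hVp.le))
    exact_mod_cast this
  · exact (((ZMod.natCast_eq_natCast_iff _ _ _).1 hpe).of_dvd hfM).trans he'e
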